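/- Let ℓ be a prime and let K be a function field over an algebraically closed field k with char k ≠ ℓ and trdeg(K|k) ≥ 2. If F is a relatively algebraically closed subextension of K|k with trdeg(F|k) = 1, then Ω_K(F) ∈ 𝔐^1(K); that is, dim^M_K(Ω_K(F)) = 1 and for every z ∈ k^M_1(K) not contained in Ω_K(F), the subgroup generated by Ω_K(F) and z satisfies dim^M_K ≥ 2. -/

import Mathlib

/-! Common definitions: mod-ℓ Milnor K-theory, K^×/(K^×)^ℓ, Ω_K, relative algebraic
closure, transcendence degree predicates, discrete valuations, etc. -/

noncomputable section

open scoped TensorProduct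

universe u v

/-- The `n`-fold tensor power (over `ℤ`) of the multiplicative group `Kˣ`,
written additively. -/
abbrev MilnorPre (n : ℕ) (K : Type*) [Field K] : Type _ :=
  PiTensorProduct ℤ (fun _ : Fin n => Additive Kˣ)

/-- The submodule of Steinberg relations: generated by all `a₁ ⊗ ⋯ ⊗ aₙ`
with `aᵢ + aⱼ = 1` for some `i < j`. -/
def SteinbergRel (n : ℕ) (K : Type*) [Field K] : Submodule ℤ (MilnorPre n K) :=
  Submodule.span ℤ
    {x | ∃ a : Fin n → Kˣ,
      (∃ i j : Fin n, i < j ∧ ((a i : K) + (a j : K) = 1)) ∧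
        x = PiTensorProduct.tprod ℤ (fun i => Additive.ofMul (a i))}

/-- The `n`-th Milnor K-group `K^M_n(K)`: the quotient of the `n`-fold tensor
power of `K^×` by the Steinberg relations. -/
abbrev MilnorK (n : ℕ) (K : Type*) [Field K] : Type _ :=
  MilnorPre n K ⧸ SteinbergRel n K

/-- The mod-`ℓ` Milnor K-group `k^M_n(K) = K^M_n(K)/ℓ`. -/
abbrev MilnorKMod (ℓ n : ℕ) (K : Type*) [Field K] : Type _ :=
  MilnorK n K ⧸ LinearMap.range ((ℓ : ℤ) • (LinearMap.id : MilnorK n K →ₗ[ℤ] MilnorK n K))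

/-- The symbol `{a₁, …, aₙ}` in `k^M_n(K)`. -/
def milnorSymbol (ℓ : ℕ) {n : ℕ} {K : Type*} [Field K] (a : Fin n → Kˣ) :
    MilnorKMod ℓ n K :=
  Submodule.Quotient.mk (Submodule.Quotient.mk
    (PiTensorProduct.tprod ℤ (fun i => Additive.ofMul (a i))))

/-- `k^M_1(K) = K^×/(K^×)^ℓ`, written multiplicatively. -/
abbrev K1 (ℓ : ℕ) (K : Type*) [Field K] : Type _ :=
  Kˣ ⧸ (powMonoidHom ℓ : Kˣ →* Kˣ).range

/-- The projection `K^× → K^×/(K^×)^ℓ`. -/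
def K1proj (ℓ : ℕ) (K : Type*) [Field K] : Kˣ →* K1 ℓ K :=
  QuotientGroup.mk' _

/-- The subgroup of `Kˣ` consisting of the units lying in an intermediate field `L`. -/
def fieldUnits {k K : Type*} [Field k] [Field K] [Algebra k K]
    (L : IntermediateField k K) : Subgroup Kˣ where
  carrier := {x : Kˣ | (x : K) ∈ L}
  one_mem' := by simpa using one_mem L
  mul_mem' := by
    intro a b ha hb
    simpa using mul_mem ha hb
  inv_mem' := by
    intro a ha
    simpa using inv_mem (show (a : K) ∈ L from ha)

/-- `Ω_K(L)`: the image of `L^×` in `K^×/(K^×)^ℓ`. -/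
def Omega (ℓ : ℕ) {k K : Type*} [Field k] [Field K] [Algebra k K]
    (L : IntermediateField k K) : Subgroup (K1 ℓ K) :=
  (fieldUnits L).map (K1proj ℓ K)

/-- A subextension `L` of `K|k` is relatively algebraically closed in `K` if every
element of `K` algebraic over `L` lies in `L`. -/
def RelAlgClosed {k K : Type*} [Field k] [Field K] [Algebra k K]
    (L : IntermediateField k K) : Prop :=
  ∀ x : K, IsAlgebraic L x → x ∈ L

/-- `K` is a function field over `k`: a finitely generated field extension. -/
def IsFunctionField (k K : Type*) [Field k] [Field K] [Algebra k K] : Prop :=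
  ∃ s : Finset K, IntermediateField.adjoin k (s : Set K) = ⊤

/-- `trdeg(K|k) = d`: there is a transcendence basis indexed by `Fin d`. -/
def HasTrdeg (k : Type*) (K : Type*) [Field k] [Field K] [Algebra k K] (d : ℕ) : Prop :=
  ∃ x : Fin d → K, IsTranscendenceBasis k x

/-- `trdeg(K|k) ≥ m`: there are `m` algebraically independent elements. -/
def TrdegGe (k : Type*) (K : Type*) [Field k] [Field K] [Algebra k K] (m : ℕ) : Prop :=
  ∃ x : Fin m → K, AlgebraicIndependent k x

/-- `dim^M_K(S) ≥ d` for a subset `S ⊆ k^M_1(K)`: there are `s₁, …, s_d ∈ S` with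
`{s₁, …, s_d} ≠ 0` in `k^M_d(K)`. -/
def dimMge (ℓ : ℕ) {K : Type*} [Field K] (S : Set (K1 ℓ K)) (d : ℕ) : Prop :=
  ∃ a : Fin d → Kˣ, (∀ i, K1proj ℓ K (a i) ∈ S) ∧ milnorSymbol ℓ a ≠ 0

/-- `dim^M_K(S) = r`. -/
def dimMeq (ℓ : ℕ) {K : Type*} [Field K] (S : Set (K1 ℓ K)) (r : ℕ) : Prop :=
  dimMge ℓ S r ∧ ¬ dimMge ℓ S (r + 1)

/-- `t` is a general element of `K` over `k`: `t ∉ k` and `k(t)` is relatively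
algebraically closed in `K`. -/
def IsGeneralElement (k : Type*) {K : Type*} [Field k] [Field K] [Algebra k K] (t : K) : Prop :=
  t ∉ (⊥ : IntermediateField k K) ∧ RelAlgClosed (IntermediateField.adjoin k {t})

/-- A rational subgroup of `k^M_1(K)`: `Ω_K(k(t))` for a general element `t`. -/
def IsRationalSubgroup (ℓ : ℕ) (k : Type*) {K : Type*} [Field k] [Field K] [Algebra k K]
    (A : Subgroup (K1 ℓ K)) : Prop :=
  ∃ t : K, IsGeneralElement k t ∧ A = Omega ℓ (IntermediateField.adjoin k {t})

/-- `𝔊^r(K|k)`: the subgroups `Ω_K(L)` for `L` relatively algebraically closed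
in `K` of transcendence degree `r` over `k`. -/
def GSet (ℓ : ℕ) (k : Type*) {K : Type*} [Field k] [Field K] [Algebra k K] (r : ℕ) :
    Set (Subgroup (K1 ℓ K)) :=
  {A | ∃ L : IntermediateField k K, RelAlgClosed L ∧ HasTrdeg k L r ∧ A = Omega ℓ L}

/-- `𝔐^1(K)`: subgroups maximal among the subgroups `B` of `k^M_1(K)`
with `dim^M_K(B) = 1`. -/
def M1Set (ℓ : ℕ) (K : Type*) [Field K] : Set (Subgroup (K1 ℓ K)) :=
  {A | dimMeq ℓ (A : Set (K1 ℓ K)) 1 ∧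
    ∀ B : Subgroup (K1 ℓ K), dimMeq ℓ (B : Set (K1 ℓ K)) 1 → A ≤ B → B = A}

/-- Condition (a) and (b) of the maximality characterization of `𝔊^r`:
`B` is generated by rational subgroups and `dim^M_K(B) = r`. -/
def SpannedByRatWithDim (ℓ : ℕ) (k : Type*) {K : Type*} [Field k] [Field K] [Algebra k K]
    (r : ℕ) (B : Subgroup (K1 ℓ K)) : Prop :=
  (∃ S : Set (Subgroup (K1 ℓ K)), (∀ T ∈ S, IsRationalSubgroup ℓ k T) ∧ B = sSup S) ∧
    dimMeq ℓ (B : Set (K1 ℓ K)) r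

/-- A discrete valuation of a field `F`: a surjective homomorphism `F^× → ℤ`
satisfying the ultrametric inequality. -/
structure DiscreteValuation (F : Type*) [Field F] where
  v : Fˣ → ℤ
  map_mul' : ∀ x y : Fˣ, v (x * y) = v x + v y
  surjective' : Function.Surjective v
  min_le' : ∀ x y z : Fˣ, (x : F) + (y : F) = (z : F) → min (v x) (v y) ≤ v z

lemma DiscreteValuation.v_one {F : Type*} [Field F] (w : DiscreteValuation F) : w.v 1 = 0 := by
  have h := w.map_mul' 1 1
  simp only [mul_one] at h
  omega

/-- A discrete valuation of `F` is trivial on the base field `k`. -/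
def DiscreteValuation.TrivialOn (k : Type*) {F : Type*} [Field k] [Field F] [Algebra k F]
    (w : DiscreteValuation F) : Prop :=
  ∀ (c : k) (hc : algebraMap k F c ≠ 0), w.v (Units.mk0 _ hc) = 0

/-- The unit group `U_w ⊆ F^×` of a discrete valuation. -/
def DiscreteValuation.units {F : Type*} [Field F] (w : DiscreteValuation F) : Subgroup Fˣ where
  carrier := {x : Fˣ | w.v x = 0}
  one_mem' := w.v_one
  mul_mem' := by
    intro a b ha hb
    have h := w.map_mul' a b
    simp only [Set.mem_setOf_eq] at ha hb ⊢
    omega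
  inv_mem' := by
    intro a ha
    have h := w.map_mul' a a⁻¹
    rw [mul_inv_cancel] at h
    have h1 := w.v_one
    simp only [Set.mem_setOf_eq] at ha ⊢
    omega

/-- `𝔘_v`: the image of the unit group `U_v` in `K^×/(K^×)^ℓ`. -/
def DiscreteValuation.unitsImage (ℓ : ℕ) {F : Type*} [Field F] (w : DiscreteValuation F) :
    Subgroup (K1 ℓ F) :=
  w.units.map (K1proj ℓ F)

/-- For a discrete valuation `w` of an intermediate field `F` of `K|k`, the image of
the unit group `U_w` in `K^×/(K^×)^ℓ`. -/
def unitsImageIn (ℓ : ℕ) {k K : Type*} [Field k] [Field K] [Algebra k K]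
    (F : IntermediateField k K) (w : DiscreteValuation F) : Subgroup (K1 ℓ K) :=
  (w.units.map (Units.map (algebraMap F K).toMonoidHom)).map (K1proj ℓ K)

/-- The residue field of `v` has transcendence degree `≥ m` over `k`: there are
`v`-units `x₁, …, x_m` whose residues are algebraically independent over `k`,
expressed by saying that every nonzero polynomial over `k` evaluated at the `xᵢ`
is a unit of value `0`. -/
def DiscreteValuation.ResidueTrdegGe (k : Type*) {K : Type*} [Field k] [Field K] [Algebra k K]
    (v : DiscreteValuation K) (m : ℕ) : Prop :=
  ∃ x : Fin m → Kˣ, (∀ i, v.v (x i) = 0) ∧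
    ∀ P : MvPolynomial (Fin m) k, P ≠ 0 →
      ∃ u : Kˣ, (u : K) = MvPolynomial.aeval (fun i => ((x i : K))) P ∧ v.v u = 0

/-- A divisorial-type valuation of `K|k` (where `d = trdeg(K|k)`): a discrete valuation
trivial on `k` whose residue field has transcendence degree exactly `d - 1` over `k`. -/
def IsDivisorialType (k : Type*) {K : Type*} [Field k] [Field K] [Algebra k K] (d : ℕ)
    (v : DiscreteValuation K) : Prop :=
  v.TrivialOn k ∧ v.ResidueTrdegGe k (d - 1) ∧ ¬ v.ResidueTrdegGe k d

/-- `Δ_A`: the set of subgroups `A ⊓ 𝔘_v`, for `v` ranging over the divisorial-type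
valuations of `K` with `A ⊄ 𝔘_v`. -/
def DeltaA (ℓ : ℕ) (k : Type*) {K : Type*} [Field k] [Field K] [Algebra k K] (d : ℕ)
    (A : Subgroup (K1 ℓ K)) : Set (Subgroup (K1 ℓ K)) :=
  {T | ∃ v : DiscreteValuation K, IsDivisorialType k d v ∧
    ¬ A ≤ v.unitsImage ℓ ∧ T = A ⊓ v.unitsImage ℓ}

/-- A good rational subgroup: a rational subgroup `A = Ω_K(k(t))` such that for every
discrete valuation `w` of `k(t)` trivial on `k`, the image of `U_w` in `K^×/(K^×)^ℓ`
belongs to `Δ_A`. -/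
def IsGoodRationalSubgroup (ℓ : ℕ) (k : Type*) {K : Type*} [Field k] [Field K] [Algebra k K]
    (d : ℕ) (A : Subgroup (K1 ℓ K)) : Prop :=
  ∃ t : K, IsGeneralElement k t ∧ A = Omega ℓ (IntermediateField.adjoin k {t}) ∧
    ∀ w : DiscreteValuation (IntermediateField.adjoin k {t}), w.TrivialOn k →
      unitsImageIn ℓ (IntermediateField.adjoin k {t}) w ∈ DeltaA ℓ k d A

/-- A very general element: a general element `t` such that `Ω_K(k(t))` is a good
rational subgroup. -/
def IsVeryGeneral (ℓ : ℕ) (k : Type*) {K : Type*} [Field k] [Field K] [Algebra k K]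
    (d : ℕ) (t : K) : Prop :=
  IsGeneralElement k t ∧ IsGoodRationalSubgroup ℓ k d (Omega ℓ (IntermediateField.adjoin k {t}))

/-- `x` is separable in `K`: in characteristic `p > 0`, `x` is not a `p`-th power;
in characteristic `0` every element is separable. -/
def IsSeparableIn (K : Type*) [Field K] (x : K) : Prop :=
  ∀ p : ℕ, p.Prime → CharP K p → ¬ ∃ y : K, y ^ p = x

/-- A perfect closure of `K`: a perfect field which is a purely inseparable
extension of `K`. -/
structure PerfectClosureOf (K : Type u) [Field K] : Type (u + 1) where
  carrier : Type u
  [fieldInst : Field carrier]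
  [algebraInst : Algebra K carrier]
  purelyInseparable : IsPurelyInseparable K carrier
  perfect : PerfectField carrier

attribute [instance] PerfectClosureOf.fieldInst PerfectClosureOf.algebraInst

/-- A group isomorphism `φ : k^M_1(K) → k^M_1(L)` is induced by a field isomorphism
`σ : K^i → L^i` of the perfect closures, via the canonical identifications
`k^M_1(K) ≅ k^M_1(K^i)` and `k^M_1(L) ≅ k^M_1(L^i)`. -/
def InducesOnK1 (ℓ : ℕ) {K : Type u} {L : Type v} [Field K] [Field L]
    (PK : PerfectClosureOf K) (PL : PerfectClosureOf L)
    (σ : PK.carrier ≃+* PL.carrier) (φ : K1 ℓ K ≃* K1 ℓ L) : Prop :=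
  ∀ (x : Kˣ) (y : Lˣ),
    (φ (K1proj ℓ K x) = K1proj ℓ L y ↔
      ∃ z : (PL.carrier)ˣ,
        Units.map σ.toRingHom.toMonoidHom
            (Units.map (algebraMap K PK.carrier).toMonoidHom x) =
          Units.map (algebraMap L PL.carrier).toMonoidHom y * z ^ ℓ)

/-- `φ : k^M_1(K) → k^M_1(L)` is compatible with `k^M_2`: `φ ⊗ φ` descends, along the
multiplication maps, to an isomorphism `k^M_2(K) → k^M_2(L)`; equivalently, there is an
additive isomorphism `k^M_2(K) ≃ k^M_2(L)` carrying `{a, b}` to `{a', b'}` whenever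
`φ` carries the class of `a` (resp. `b`) to the class of `a'` (resp. `b'`). -/
def CompatWithK2 (ℓ : ℕ) {K L : Type*} [Field K] [Field L] (φ : K1 ℓ K ≃* K1 ℓ L) : Prop :=
  ∃ ψ : MilnorKMod ℓ 2 K ≃+ MilnorKMod ℓ 2 L,
    ∀ (a b : Kˣ) (a' b' : Lˣ),
      φ (K1proj ℓ K a) = K1proj ℓ L a' → φ (K1proj ℓ K b) = K1proj ℓ L b' →
        ψ (milnorSymbol ℓ ![a, b]) = milnorSymbol ℓ ![a', b']

/-- `φ : k^M_1(K) → k^M_1(L)` is compatible with `𝔊^1_rat`: it maps rational subgroups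
bijectively onto rational subgroups. -/
def CompatWithRat (ℓ : ℕ) (k : Type*) (l : Type*) {K L : Type*}
    [Field k] [Field K] [Algebra k K] [Field l] [Field L] [Algebra l L]
    (φ : K1 ℓ K ≃* K1 ℓ L) : Prop :=
  (∀ A : Subgroup (K1 ℓ K), IsRationalSubgroup ℓ k A →
     IsRationalSubgroup ℓ l (A.map φ.toMonoidHom)) ∧
  (∀ B : Subgroup (K1 ℓ L), IsRationalSubgroup ℓ l B →
     ∃ A : Subgroup (K1 ℓ K), IsRationalSubgroup ℓ k A ∧ A.map φ.toMonoidHom = B)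

/-- Two isomorphisms of perfect closures differ by a power of the Frobenius
(in characteristic `0`, they are equal). -/
def FrobTwistEquiv {Ki Li : Type*} [Field Ki] [Field Li] (σ σ' : Ki ≃+* Li) : Prop :=
  σ = σ' ∨ ∃ p : ℕ, p.Prime ∧ CharP Ki p ∧
    ((∃ n : ℕ, ∀ x, σ' x = σ (x ^ p ^ n)) ∨ (∃ n : ℕ, ∀ x, σ x = σ' (x ^ p ^ n)))

/-- The group `k^M_2(K)`, sealed as a type of its own. -/
def MilnorK2 (ℓ : ℕ) (K : Type*) [Field K] : Type _ := MilnorKMod ℓ 2 K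

instance (ℓ : ℕ) (K : Type*) [Field K] : AddCommGroup (MilnorK2 ℓ K) :=
  inferInstanceAs (AddCommGroup (MilnorKMod ℓ 2 K))

namespace MilnorK2

/-- The symbol `{a, b}` in `k^M_2(K)`. -/
def sym (ℓ : ℕ) {K : Type*} [Field K] (a b : Kˣ) : MilnorK2 ℓ K := milnorSymbol ℓ ![a, b]

variable {ℓ : ℕ} {K : Type*} [Field K]

lemma sym_mul_left (a a' b : Kˣ) : sym ℓ (a * a') b = sym ℓ a b + sym ℓ a' b := by
  have h : ∀ c : Kˣ, (fun i => Additive.ofMul ((![c, b] : Fin 2 → Kˣ) i)) =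
      Function.update (fun i => Additive.ofMul ((![a, b] : Fin 2 → Kˣ) i)) 0
        (Additive.ofMul c) := by
    intro c; funext i; fin_cases i <;> simp
  change milnorSymbol ℓ _ = milnorSymbol ℓ _ + milnorSymbol ℓ _
  simp only [milnorSymbol]
  rw [h (a * a'), ofMul_mul, MultilinearMap.map_update_add, ← h, ← h]
  rfl

lemma sym_mul_right (a b b' : Kˣ) : sym ℓ a (b * b') = sym ℓ a b + sym ℓ a b' := by
  have h : ∀ c : Kˣ, (fun i => Additive.ofMul ((![a, c] : Fin 2 → Kˣ) i)) =
      Function.update (fun i => Additive.ofMul ((![a, b] : Fin 2 → Kˣ) i)) 1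
        (Additive.ofMul c) := by
    intro c; funext i; fin_cases i <;> simp
  change milnorSymbol ℓ _ = milnorSymbol ℓ _ + milnorSymbol ℓ _
  simp only [milnorSymbol]
  rw [h (b * b'), ofMul_mul, MultilinearMap.map_update_add, ← h, ← h]
  rfl

lemma sym_steinberg {a b : Kˣ} (h : (a : K) + b = 1) : sym ℓ a b = 0 := by
  change milnorSymbol ℓ _ = 0
  simp only [milnorSymbol]
  rw [(Submodule.Quotient.mk_eq_zero (SteinbergRel 2 K)).2]
  · rfl
  · exact Submodule.subset_span ⟨![a, b], ⟨0, 1, by decide, by simpa using h⟩, rfl⟩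

lemma smul_eq_zero' (x : MilnorK2 ℓ K) : ℓ • x = 0 := by
  obtain ⟨y, rfl⟩ := Submodule.Quotient.mk_surjective _ x
  change Submodule.Quotient.mk (ℓ • y) = _
  refine (Submodule.Quotient.mk_eq_zero _).2 ⟨y, ?_⟩
  simp

/-- A Steinberg symbol killed by `ℓ` factors through `k^M_2`. -/
lemma exists_lift {A : Type*} [AddCommGroup A] (f : Kˣ → Kˣ → A)
    (hl : ∀ a a' b, f (a * a') b = f a b + f a' b)
    (hr : ∀ a b b', f a (b * b') = f a b + f a b')
    (hs : ∀ a b : Kˣ, (a : K) + b = 1 → f a b = 0)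
    (hA : ∀ x : A, ℓ • x = 0) :
    ∃ φ : MilnorK2 ℓ K →+ A, ∀ a b, φ (sym ℓ a b) = f a b := by
  let f1 : Kˣ → (Additive Kˣ →+ A) := fun a =>
    AddMonoidHom.mk' (fun b => f a b.toMul) (fun b b' => hr a b.toMul b'.toMul)
  let f2 : Additive Kˣ →+ (Additive Kˣ →+ A) :=
    AddMonoidHom.mk' (fun a => f1 a.toMul) (fun a a' => by ext b; exact hl _ _ _)
  let m : MultilinearMap ℤ (fun _ : Fin 2 => Additive Kˣ) A :=
    { toFun := fun g => f2 (g 0) (g 1)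
      map_update_add' := by
        intro inst g i x y
        have : inst = instDecidableEqFin 2 := Subsingleton.elim _ _
        subst this
        fin_cases i <;> simp
      map_update_smul' := by
        intro inst g i c x
        have : inst = instDecidableEqFin 2 := Subsingleton.elim _ _
        subst this
        fin_cases i <;> simp }
  let L1 : MilnorPre 2 K →ₗ[ℤ] A := PiTensorProduct.lift m
  have h1 : SteinbergRel 2 K ≤ LinearMap.ker L1 := by
    refine Submodule.span_le.2 ?_
    rintro x ⟨a, ⟨i, j, hij, h⟩, rfl⟩
    have hi : i = 0 := by omega
    have hj : j = 1 := by omega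
    subst hi hj
    simp only [SetLike.mem_coe, LinearMap.mem_ker, L1, PiTensorProduct.lift.tprod]
    exact hs _ _ h
  let L2 : MilnorK 2 K →ₗ[ℤ] A := (SteinbergRel 2 K).liftQ L1 h1
  have h2 : LinearMap.range ((ℓ : ℤ) • (LinearMap.id : MilnorK 2 K →ₗ[ℤ] MilnorK 2 K)) ≤
      LinearMap.ker L2 := by
    rintro _ ⟨x, rfl⟩
    simp [hA]
  let L3 : MilnorKMod ℓ 2 K →ₗ[ℤ] A := Submodule.liftQ _ L2 h2
  refine ⟨L3.toAddMonoidHom, fun a b => ?_⟩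
  change PiTensorProduct.lift m (PiTensorProduct.tprod ℤ _) = _
  rw [PiTensorProduct.lift.tprod]
  rfl

/-- The hom `a ↦ {a, b}`. -/
def symLeft (ℓ : ℕ) (b : Kˣ) : Additive Kˣ →+ MilnorK2 ℓ K :=
  AddMonoidHom.mk' (fun a => sym ℓ a.toMul b) (fun a a' => sym_mul_left a.toMul a'.toMul b)

/-- The hom `b ↦ {a, b}`. -/
def symRight (ℓ : ℕ) (a : Kˣ) : Additive Kˣ →+ MilnorK2 ℓ K :=
  AddMonoidHom.mk' (fun b => sym ℓ a b.toMul) (fun b b' => sym_mul_right a b.toMul b'.toMul)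

@[simp] lemma sym_one_left (b : Kˣ) : sym ℓ 1 b = 0 := map_zero (symLeft ℓ b)
@[simp] lemma sym_one_right (a : Kˣ) : sym ℓ a 1 = 0 := map_zero (symRight ℓ a)
lemma sym_inv_left (a b : Kˣ) : sym ℓ a⁻¹ b = -sym ℓ a b :=
  map_neg (symLeft ℓ b) (Additive.ofMul a)
lemma sym_inv_right (a b : Kˣ) : sym ℓ a b⁻¹ = -sym ℓ a b :=
  map_neg (symRight ℓ a) (Additive.ofMul b)
lemma sym_pow_left (a b : Kˣ) (n : ℕ) : sym ℓ (a ^ n) b = n • sym ℓ a b :=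
  map_nsmul (symLeft ℓ b) n (Additive.ofMul a)
lemma sym_pow_right (a b : Kˣ) (n : ℕ) : sym ℓ a (b ^ n) = n • sym ℓ a b :=
  map_nsmul (symRight ℓ a) n (Additive.ofMul b)
lemma sym_powl_left (a b : Kˣ) : sym ℓ (a ^ ℓ) b = 0 := by
  rw [sym_pow_left, smul_eq_zero']
lemma sym_powl_right (a b : Kˣ) : sym ℓ a (b ^ ℓ) = 0 := by
  rw [sym_pow_right, smul_eq_zero']

lemma sym_self_neg (a : Kˣ) : sym ℓ a (-a) = 0 := by
  by_cases h : (a : K) = 1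
  · have : a = 1 := Units.ext h
    simp [this]
  have h1 : (1 - a : K) ≠ 0 := fun h2 => h (sub_eq_zero.1 h2).symm
  have h2 : (1 - (a : K)⁻¹ : K) ≠ 0 := by
    intro h3
    apply h
    have := (sub_eq_zero.1 h3)
    exact inv_eq_one.1 this.symm
  have e : -a = Units.mk0 _ h1 * (Units.mk0 _ h2)⁻¹ := by
    rw [eq_mul_inv_iff_mul_eq]
    ext
    have := a.ne_zero
    simp only [Units.val_mul, Units.val_neg, Units.val_mk0]
    field_simp
    ring
  rw [e, sym_mul_right, sym_inv_right, sym_steinberg (by simp), ← sym_inv_left,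
    sym_steinberg (by simp), add_zero]

lemma sym_self (h : ∃ c : Kˣ, c ^ ℓ = -1) (a : Kˣ) : sym ℓ a a = 0 := by
  obtain ⟨c, hc⟩ := h
  have := sym_self_neg (ℓ := ℓ) a
  rwa [show -a = c ^ ℓ * a by rw [hc]; simp, sym_mul_right, sym_powl_right, zero_add] at this

lemma sym_swap (h : ∃ c : Kˣ, c ^ ℓ = -1) (a b : Kˣ) : sym ℓ a b = -sym ℓ b a := by
  have := sym_self h (a * b)
  rw [sym_mul_left, sym_mul_right, sym_mul_right, sym_self h, sym_self h, zero_add, add_zero]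
    at this
  exact eq_neg_of_add_eq_zero_left this

/-- The Steinberg relation in homogeneous form. -/
lemma sym_of_add_eq (h : ∃ c : Kˣ, c ^ ℓ = -1) {a b c : Kˣ} (hab : (a : K) + b = c) :
    sym ℓ a b = sym ℓ a c + sym ℓ c b := by
  have h0 : sym ℓ (a * c⁻¹) (b * c⁻¹) = 0 := by
    apply sym_steinberg
    have := c.ne_zero
    simp only [Units.val_mul, Units.val_inv_eq_inv_val]
    field_simp
    exact hab
  rw [sym_mul_left, sym_mul_right, sym_mul_right, sym_inv_left, sym_inv_left, sym_inv_right,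
    sym_inv_right, sym_self h] at h0
  have h1 : sym ℓ a b - (sym ℓ a c + sym ℓ c b) = 0 := by rw [← h0]; abel
  exact sub_eq_zero.1 h1

/-- Functoriality of `k^M_2`. -/
lemma exists_map {L : Type*} [Field L] (φ : K →+* L) :
    ∃ m : MilnorK2 ℓ K →+ MilnorK2 ℓ L, ∀ a b,
      m (sym ℓ a b) = sym ℓ (Units.map φ.toMonoidHom a) (Units.map φ.toMonoidHom b) := by
  refine exists_lift (fun a b => sym ℓ (Units.map φ.toMonoidHom a) (Units.map φ.toMonoidHom b))
    ?_ ?_ ?_ smul_eq_zero'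
  · intro a a' b
    simp only [map_mul, sym_mul_left]
  · intro a b b'
    simp only [map_mul, sym_mul_right]
  · intro a b h
    apply sym_steinberg
    have := congrArg φ h
    simpa using this

/-- The map on `k^M_2` induced by a field homomorphism. -/
def map (ℓ : ℕ) {L : Type*} [Field L] (φ : K →+* L) : MilnorK2 ℓ K →+ MilnorK2 ℓ L :=
  (exists_map (ℓ := ℓ) φ).choose

lemma map_sym {L : Type*} [Field L] (φ : K →+* L) (a b : Kˣ) :
    map ℓ φ (sym ℓ a b) =
      sym ℓ (Units.map φ.toMonoidHom a) (Units.map φ.toMonoidHom b) :=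
  (exists_map (ℓ := ℓ) φ).choose_spec a b

end MilnorK2

/-- The group `Kˣ / ℓ`, written additively and sealed as a type of its own. -/
def UnitsMod (ℓ : ℕ) (K : Type*) [Field K] : Type _ := Additive (K1 ℓ K)

instance (ℓ : ℕ) (K : Type*) [Field K] : AddCommGroup (UnitsMod ℓ K) :=
  @Additive.addCommGroup _ (QuotientGroup.Quotient.commGroup _)

/-- The class of a unit in `Kˣ / ℓ`. -/
def unitsMod (ℓ : ℕ) {K : Type*} [Field K] (a : Kˣ) : UnitsMod ℓ K :=
  Additive.ofMul (K1proj ℓ K a)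

section UnitsMod

variable {ℓ : ℕ} {K : Type*} [Field K]

lemma unitsMod_mul (a b : Kˣ) : unitsMod ℓ (a * b) = unitsMod ℓ a + unitsMod ℓ b :=
  congrArg Additive.ofMul (map_mul (K1proj ℓ K) a b)

lemma unitsMod_eq_zero {a : Kˣ} : unitsMod ℓ a = 0 ↔ ∃ u : Kˣ, u ^ ℓ = a := by
  change K1proj ℓ K a = 1 ↔ _
  exact QuotientGroup.eq_one_iff _

lemma unitsMod_surjective (x : UnitsMod ℓ K) : ∃ a : Kˣ, unitsMod ℓ a = x :=
  QuotientGroup.mk_surjective (s := (powMonoidHom ℓ : Kˣ →* Kˣ).range) x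

/-- The class map as an additive homomorphism. -/
def unitsModHom (ℓ : ℕ) (K : Type*) [Field K] : Additive Kˣ →+ UnitsMod ℓ K :=
  AddMonoidHom.mk' (fun a => unitsMod ℓ a.toMul) (fun a b => unitsMod_mul a.toMul b.toMul)

@[simp] lemma unitsMod_one : unitsMod ℓ (1 : Kˣ) = 0 := map_zero (unitsModHom ℓ K)
lemma unitsMod_smul (x : UnitsMod ℓ K) : ℓ • x = 0 := by
  obtain ⟨a, rfl⟩ := unitsMod_surjective x
  have : ℓ • unitsMod ℓ a = unitsMod ℓ (a ^ ℓ) :=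
    (map_nsmul (unitsModHom ℓ K) ℓ (Additive.ofMul a)).symm
  rw [this, unitsMod_eq_zero]
  exact ⟨a, rfl⟩

lemma unitsMod_neg (h : ∃ c : Kˣ, c ^ ℓ = -1) (a : Kˣ) : unitsMod ℓ (-a) = unitsMod ℓ a := by
  rw [show -a = -1 * a by simp, unitsMod_mul, unitsMod_eq_zero.2 h, zero_add]

/-- A symbol killed on `ℓ`-multiples factors through `Kˣ / ℓ`. -/
lemma unitsMod_exists_lift {A : Type*} [AddCommGroup A] (f : Kˣ → A)
    (hf : ∀ a b, f (a * b) = f a + f b) (hA : ∀ x : A, ℓ • x = 0) :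
    ∃ φ : UnitsMod ℓ K →+ A, ∀ a, φ (unitsMod ℓ a) = f a := by
  let f1 : Kˣ →* Multiplicative A := MonoidHom.mk' (fun a => Multiplicative.ofAdd (f a)) hf
  have h : (powMonoidHom ℓ : Kˣ →* Kˣ).range ≤ f1.ker := by
    rintro _ ⟨x, rfl⟩
    rw [MonoidHom.mem_ker]
    simp only [powMonoidHom_apply, map_pow]
    exact hA (f x)
  exact ⟨MonoidHom.toAdditive (QuotientGroup.lift _ f1 h), fun a => rfl⟩

end UnitsMod

/-- A symbol of length one vanishes only on `ℓ`-th powers. -/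
lemma milnorSymbol_one_ne_zero {ℓ : ℕ} {K : Type*} [Field K] {a : Kˣ}
    (ha : ¬ ∃ u : Kˣ, u ^ ℓ = a) : milnorSymbol ℓ ![a] ≠ 0 := by
  let m : MultilinearMap ℤ (fun _ : Fin 1 => Additive Kˣ) (UnitsMod ℓ K) :=
    { toFun := fun g => unitsModHom ℓ K (g 0)
      map_update_add' := by
        intro inst g i x y
        have : inst = instDecidableEqFin 1 := Subsingleton.elim _ _
        subst this
        fin_cases i
        simp
      map_update_smul' := by
        intro inst g i c x
        have : inst = instDecidableEqFin 1 := Subsingleton.elim _ _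
        subst this
        fin_cases i
        simp }
  let L1 : MilnorPre 1 K →ₗ[ℤ] UnitsMod ℓ K := PiTensorProduct.lift m
  have h1 : SteinbergRel 1 K ≤ LinearMap.ker L1 := by
    refine Submodule.span_le.2 ?_
    rintro x ⟨a, ⟨i, j, hij, h⟩, rfl⟩
    omega
  let L2 : MilnorK 1 K →ₗ[ℤ] UnitsMod ℓ K := (SteinbergRel 1 K).liftQ L1 h1
  have h2 : LinearMap.range ((ℓ : ℤ) • (LinearMap.id : MilnorK 1 K →ₗ[ℤ] MilnorK 1 K)) ≤
      LinearMap.ker L2 := by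
    rintro _ ⟨x, rfl⟩
    simp [unitsMod_smul]
  let L3 : MilnorKMod ℓ 1 K →ₗ[ℤ] UnitsMod ℓ K := Submodule.liftQ _ L2 h2
  intro h0
  have h3 : L3 (milnorSymbol ℓ ![a]) = 0 := by rw [h0, map_zero]
  have h4 : L3 (milnorSymbol ℓ ![a]) = unitsMod ℓ a := by
    change PiTensorProduct.lift m (PiTensorProduct.tprod ℤ _) = _
    rw [PiTensorProduct.lift.tprod]
    rfl
  rw [h4] at h3
  exact ha (unitsMod_eq_zero.1 h3)

/-- The valuation and the angular component of a discrete valuation on `K` with residue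
field inside `κ`, with respect to a fixed uniformizer. -/
structure TameDatum (K κ : Type*) [Field K] [Field κ] where
  v : Kˣ → ℤ
  s : Kˣ → κˣ
  v_mul : ∀ a b, v (a * b) = v a + v b
  s_mul : ∀ a b, s (a * b) = s a * s b
  of_pos : ∀ a b : Kˣ, (a : K) + b = 1 → 0 < v a → v b = 0 ∧ s b = 1
  of_neg : ∀ a b : Kˣ, (a : K) + b = 1 → v a < 0 → v b = v a ∧ s b = -s a
  of_zero : ∀ a b : Kˣ, (a : K) + b = 1 → v a = 0 → v b = 0 → (s a : κ) + s b = 1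

namespace TameDatum

open MilnorK2

variable {ℓ : ℕ} {K κ : Type*} [Field K] [Field κ]

lemma steinberg_cases (T : TameDatum K κ) {a b : Kˣ} (h : (a : K) + b = 1) :
    (T.v b = 0 ∧ T.s b = 1) ∨ (T.v b = T.v a ∧ T.s b = -T.s a) ∨
      (T.v a = 0 ∧ T.s a = 1) ∨ (T.v a = 0 ∧ T.v b = 0 ∧ (T.s a : κ) + T.s b = 1) := by
  have h' : (b : K) + a = 1 := by rw [add_comm]; exact h
  rcases lt_trichotomy (T.v a) 0 with h1 | h1 | h1
  · exact Or.inr (Or.inl (T.of_neg a b h h1))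
  · rcases lt_trichotomy (T.v b) 0 with h2 | h2 | h2
    · have := (T.of_neg b a h' h2).1
      omega
    · exact Or.inr (Or.inr (Or.inr ⟨h1, h2, T.of_zero a b h h1 h2⟩))
    · exact Or.inr (Or.inr (Or.inl (T.of_pos b a h' h2)))
  · exact Or.inl (T.of_pos a b h h1)

/-- The tame symbol. -/
lemma exists_tame (T : TameDatum K κ) (hm : ∃ c : κˣ, c ^ ℓ = -1) :
    ∃ d : MilnorK2 ℓ K →+ UnitsMod ℓ κ, ∀ a b,
      d (sym ℓ a b) = T.v b • unitsMod ℓ (T.s a) - T.v a • unitsMod ℓ (T.s b) := by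
  refine exists_lift (fun a b => T.v b • unitsMod ℓ (T.s a) - T.v a • unitsMod ℓ (T.s b))
    ?_ ?_ ?_ unitsMod_smul
  · intro a a' b
    simp only [T.v_mul, T.s_mul, unitsMod_mul, smul_add, add_smul]
    abel
  · intro a a' b
    simp only [T.v_mul, T.s_mul, unitsMod_mul, smul_add, add_smul]
    abel
  · intro a b h
    rcases T.steinberg_cases h with h | h | h | h
    · simp [h.1, h.2]
    · simp [h.1, h.2, unitsMod_neg hm]
    · simp [h.1, h.2]
    · simp [h.1, h.2]

/-- The specialization map. -/
lemma exists_specialization (T : TameDatum K κ) :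
    ∃ d : MilnorK2 ℓ K →+ MilnorK2 ℓ κ, ∀ a b, d (sym ℓ a b) = sym ℓ (T.s a) (T.s b) := by
  refine exists_lift (fun a b => sym ℓ (T.s a) (T.s b)) ?_ ?_ ?_ smul_eq_zero'
  · intro a a' b
    simp only [T.s_mul, sym_mul_left]
  · intro a a' b
    simp only [T.s_mul, sym_mul_right]
  · intro a b h
    rcases T.steinberg_cases h with h | h | h | h
    · simp [h.2]
    · simp [h.2, sym_self_neg]
    · simp [h.2]
    · exact sym_steinberg h.2.2

end TameDatum

section Construction

variable {B K κ : Type*} [CommRing B] [Field K] [Algebra B K]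
  [IsFractionRing B K] [Field κ] (φ : B →+* κ) {π h : B}

lemma exists_factor_pow [IsDomain B] [IsNoetherianRing B] (hπ : φ π = 0) (hh : φ h ≠ 0)
    (H : ∀ f, φ f = 0 → π ∣ h * f) {b : B} (hb : b ≠ 0) :
    ∃ (n : ℕ) (c : B), φ c ≠ 0 ∧ h ^ n * b = π ^ n * c := by
  by_contra! hcon
  have key : ∀ n : ℕ, ∃ c, h ^ n * b = π ^ n * c := by
    intro n
    induction n with
    | zero => exact ⟨b, by simp⟩
    | succ n ih =>
      obtain ⟨c, hc⟩ := ih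
      have : φ c = 0 := by
        by_contra h0
        exact hcon n c h0 hc
      obtain ⟨d, hd⟩ := H c this
      refine ⟨d, ?_⟩
      rw [pow_succ', mul_assoc, hc, mul_left_comm, hd, pow_succ]
      ring
  let p : Ideal B := RingHom.ker φ
  have hp : p.IsPrime := RingHom.ker_isPrime φ
  let A := Localization.AtPrime p
  have hA : IsNoetherianRing A := IsLocalization.isNoetherianRing p.primeCompl A inferInstance
  have hne : Ideal.span {algebraMap B A π} ≠ ⊤ := by
    intro htop
    have : algebraMap B A π ∈ IsLocalRing.maximalIdeal A := by
      rw [IsLocalization.AtPrime.to_map_mem_maximal_iff A p]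
      exact hπ
    rw [Ideal.eq_top_iff_one] at htop
    have h2 : Ideal.span {algebraMap B A π} ≤ IsLocalRing.maximalIdeal A := by
      rw [Ideal.span_le]
      simpa using this
    exact (Ideal.ne_top_iff_one _).1 (IsLocalRing.maximalIdeal.isMaximal A).ne_top (h2 htop)
  have hdom : IsDomain A := IsLocalization.isDomain_localization p.primeCompl_le_nonZeroDivisors
  have hbot := Ideal.iInf_pow_eq_bot_of_isDomain _ hne
  have hmem : algebraMap B A b ∈ ⨅ i : ℕ, Ideal.span {algebraMap B A π} ^ i := by
    rw [Ideal.mem_iInf]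
    intro n
    obtain ⟨c, hc⟩ := key n
    have hu : IsUnit (algebraMap B A (h ^ n)) :=
      IsLocalization.map_units A (⟨h ^ n, by
        intro h0
        have h1 : φ (h ^ n) = 0 := h0
        rw [map_pow] at h1
        exact hh (eq_zero_of_pow_eq_zero h1)⟩ : p.primeCompl)
    rw [Ideal.span_singleton_pow, Ideal.mem_span_singleton, ← hu.dvd_mul_left, ← map_mul, hc,
      map_mul, map_pow]
    exact Dvd.intro _ rfl
  rw [hbot, Ideal.mem_bot] at hmem
  exact hb ((IsLocalization.injective A p.primeCompl_le_nonZeroDivisors) (by simpa using hmem))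

/-- `x = π ^ n * c / d` with `u` the residue of `c / d`. -/
def IsTameExpansion (π : B) (x : Kˣ) (n : ℤ) (u : κˣ) : Prop :=
  ∃ c d : B, φ c ≠ 0 ∧ φ d ≠ 0 ∧
    (x : K) * algebraMap B K d = algebraMap B K π ^ n * algebraMap B K c ∧ (u : κ) * φ d = φ c

lemma IsTameExpansion.exists [IsDomain B] [IsNoetherianRing B] (hπ0 : π ≠ 0) (hπ : φ π = 0)
    (hh : φ h ≠ 0)
    (H : ∀ f, φ f = 0 → π ∣ h * f) (x : Kˣ) : ∃ n u, IsTameExpansion φ π x n u := by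
  obtain ⟨a, b, hb, hx⟩ := IsFractionRing.div_surjective (A := B) (x : K)
  have hb0 : b ≠ 0 := nonZeroDivisors.ne_zero hb
  have ha0 : a ≠ 0 := by
    rintro rfl
    exact x.ne_zero (by rw [← hx]; simp)
  obtain ⟨n, c, hc, hac⟩ := exists_factor_pow φ hπ hh H ha0
  obtain ⟨m, d, hd, hbd⟩ := exists_factor_pow φ hπ hh H hb0
  have hc' : φ (h ^ m * c) ≠ 0 := by
    rw [map_mul, map_pow]
    exact mul_ne_zero (pow_ne_zero _ hh) hc
  have hd' : φ (h ^ n * d) ≠ 0 := by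
    rw [map_mul, map_pow]
    exact mul_ne_zero (pow_ne_zero _ hh) hd
  refine ⟨(n : ℤ) - m, Units.mk0 (φ (h ^ m * c) / φ (h ^ n * d)) (div_ne_zero hc' hd'), h ^ m * c,
    h ^ n * d, hc', hd', ?_, by rw [Units.val_mk0, div_mul_cancel₀ _ hd']⟩
  have inj := IsFractionRing.injective B K
  have e1 := congrArg (algebraMap B K) hac
  have e2 := congrArg (algebraMap B K) hbd
  have hπK : algebraMap B K π ≠ 0 := by simpa using hπ0
  have hbK : algebraMap B K b ≠ 0 := by simpa using hb0
  have hhK : algebraMap B K h ≠ 0 := by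
    have : h ≠ 0 := by rintro rfl; simp at hh
    simpa using this
  simp only [map_mul, map_pow] at e1 e2 ⊢
  rw [← hx, zpow_sub₀ hπK, zpow_natCast, zpow_natCast]
  field_simp
  calc _ = (algebraMap B K h ^ n * algebraMap B K a) *
        (algebraMap B K π ^ m * algebraMap B K d) := by ring
    _ = _ := by rw [e1, ← e2]; ring

lemma IsTameExpansion.mul {x y : Kˣ} {n m : ℤ} {u w : κˣ} (hπ0 : π ≠ 0)
    (hx : IsTameExpansion φ π x n u)
    (hy : IsTameExpansion φ π y m w) : IsTameExpansion φ π (x * y) (n + m) (u * w) := by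
  obtain ⟨c, d, hc, hd, h1, h2⟩ := hx
  obtain ⟨c', d', hc', hd', h1', h2'⟩ := hy
  have hπK : algebraMap B K π ≠ 0 := by simpa using hπ0
  refine ⟨c * c', d * d', by simp [hc, hc'], by simp [hd, hd'], ?_, ?_⟩
  · simp only [map_mul, Units.val_mul, zpow_add₀ hπK]
    calc _ = ((x : K) * algebraMap B K d) * (y * algebraMap B K d') := by ring
      _ = _ := by rw [h1, h1']; ring
  · simp only [map_mul, Units.val_mul]
    rw [← h2, ← h2']
    ring

lemma IsTameExpansion.unique {x : Kˣ} {n m : ℤ} {u w : κˣ} (hπ0 : π ≠ 0) (hπ : φ π = 0)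
    (hx : IsTameExpansion φ π x n u) (hy : IsTameExpansion φ π x m w) : n = m ∧ u = w := by
  have hπK : algebraMap B K π ≠ 0 := by simpa using hπ0
  have inj := IsFractionRing.injective B K
  have aux : ∀ {n m : ℤ} {u w : κˣ}, IsTameExpansion φ π x n u →
      IsTameExpansion φ π x m w → m ≤ n := by
    rintro n m u w ⟨c, d, hc, hd, h1, h2⟩ ⟨c', d', hc', hd', h1', h2'⟩
    by_contra hlt
    obtain ⟨j, hj⟩ : ∃ j : ℕ, m = n + (j + 1 : ℕ) :=
      ⟨(m - n - 1).toNat, by push_cast; omega⟩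
    have e : algebraMap B K (c * d') = algebraMap B K (π ^ (j + 1) * c' * d) := by
      have h3 : algebraMap B K π ^ n ≠ 0 := zpow_ne_zero _ hπK
      apply mul_left_cancel₀ h3
      simp only [map_mul, map_pow]
      calc _ = (algebraMap B K π ^ n * algebraMap B K c) * algebraMap B K d' := by ring
        _ = (x * algebraMap B K d') * algebraMap B K d := by rw [← h1]; ring
        _ = _ := by rw [h1', hj, zpow_add₀ hπK, zpow_natCast]; ring
    have e2 := congrArg φ (inj e)
    simp [hπ, hc, hd'] at e2
  have hnm : n = m := le_antisymm (aux hy hx) (aux hx hy)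
  refine ⟨hnm, ?_⟩
  subst hnm
  obtain ⟨c, d, hc, hd, h1, h2⟩ := hx
  obtain ⟨c', d', hc', hd', h1', h2'⟩ := hy
  have e : algebraMap B K (c * d') = algebraMap B K (c' * d) := by
    have h3 : algebraMap B K π ^ n ≠ 0 := zpow_ne_zero _ hπK
    apply mul_left_cancel₀ h3
    simp only [map_mul]
    calc _ = (algebraMap B K π ^ n * algebraMap B K c) * algebraMap B K d' := by ring
      _ = (x * algebraMap B K d') * algebraMap B K d := by rw [← h1]; ring
      _ = _ := by rw [h1']; ring
  have e2 := congrArg φ (inj e)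
  simp only [map_mul, ← h2, ← h2'] at e2
  ext
  have h4 : φ d * φ d' ≠ 0 := mul_ne_zero hd hd'
  apply mul_right_cancel₀ h4
  linear_combination e2

/-- If the kernel of `φ : B → κ` becomes principal, generated by `π`, after inverting `h`,
then it defines a discrete valuation on the fraction field of `B`. -/
lemma exists_tameDatum [IsDomain B] [IsNoetherianRing B] (hπ0 : π ≠ 0) (hπ : φ π = 0) (hh : φ h ≠ 0)
    (H : ∀ f, φ f = 0 → π ∣ h * f) :
    ∃ T : TameDatum K κ, (∀ x : Kˣ, (x : K) = algebraMap B K π → T.v x = 1 ∧ T.s x = 1) ∧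
      ∀ (b : B) (x : Kˣ), φ b ≠ 0 → (x : K) = algebraMap B K b →
        T.v x = 0 ∧ (T.s x : κ) = φ b := by
  have hπK : algebraMap B K π ≠ 0 := by simpa using hπ0
  choose v s hvs using IsTameExpansion.exists (K := K) φ hπ0 hπ hh H
  have uniq : ∀ {x : Kˣ} {n : ℤ} {u : κˣ}, IsTameExpansion φ π x n u → v x = n ∧ s x = u :=
    fun hx => IsTameExpansion.unique φ hπ0 hπ (hvs _) hx
  have neg_case : ∀ a b : Kˣ, (a : K) + b = 1 → v a < 0 → v b = v a ∧ s b = -s a := by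
    intro a b hab ha
    apply uniq
    obtain ⟨c, d, hc, hd, h1, h2⟩ := hvs a
    obtain ⟨j, hj⟩ : ∃ j : ℕ, v a = -((j + 1 : ℕ) : ℤ) := ⟨(-v a - 1).toNat, by omega⟩
    refine ⟨π ^ (j + 1) * d - c, d, by simp [hπ, hc], hd, ?_, by simp [hπ, h2]⟩
    have hb : (b : K) = 1 - a := by rw [← hab]; ring
    rw [hb, sub_mul, h1, map_sub, mul_sub, hj, zpow_neg, zpow_natCast, map_mul, map_pow]
    field_simp
  refine ⟨⟨v, s, fun a b => (uniq (IsTameExpansion.mul φ hπ0 (hvs a) (hvs b))).1,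
    fun a b => (uniq (IsTameExpansion.mul φ hπ0 (hvs a) (hvs b))).2, ?_, neg_case, ?_⟩, ?_, ?_⟩
  · intro a b hab ha
    apply uniq
    obtain ⟨c, d, hc, hd, h1, h2⟩ := hvs a
    obtain ⟨j, hj⟩ : ∃ j : ℕ, v a = ((j + 1 : ℕ) : ℤ) := ⟨(v a - 1).toNat, by omega⟩
    refine ⟨d - π ^ (j + 1) * c, d, by simp [hπ, hd], hd, ?_, by simp [hπ]⟩
    have hb : (b : K) = 1 - a := by rw [← hab]; ring
    rw [hb, sub_mul, h1, hj, zpow_natCast]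
    simp
  · intro a b hab ha hb
    obtain ⟨c, d, hc, hd, h1, h2⟩ := hvs a
    obtain ⟨c', d', hc', hd', h1', h2'⟩ := hvs b
    rw [ha, zpow_zero, one_mul] at h1
    rw [hb, zpow_zero, one_mul] at h1'
    have e : algebraMap B K (c * d' + c' * d) = algebraMap B K (d * d') := by
      simp only [map_add, map_mul, ← h1, ← h1']
      linear_combination algebraMap B K d * algebraMap B K d' * hab
    have e2 := congrArg φ (IsFractionRing.injective B K e)
    simp only [map_add, map_mul, ← h2, ← h2'] at e2
    apply mul_right_cancel₀ (mul_ne_zero hd hd')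
    linear_combination e2
  · intro x hx
    exact uniq ⟨1, 1, by simp, by simp, by simp [hx], by simp⟩
  · intro b x hb hx
    have := uniq (x := x) (n := 0) (u := Units.mk0 _ hb) ⟨b, 1, hb, by simp, by simp [hx], by simp⟩
    exact ⟨this.1, congrArg Units.val this.2⟩

end Construction

section PolynomialSymbols

open Polynomial MilnorK2

variable {ℓ : ℕ} {F : Type*} [Field F]

/-- A nonzero polynomial as a unit of the rational function field (`1` for the zero polynomial). -/
def polyUnit (f : F[X]) : (FractionRing F[X])ˣ :=
  open Classical in
  if h : f = 0 then 1 else Units.mk0 (algebraMap F[X] (FractionRing F[X]) f) (by simpa using h)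

lemma polyUnit_val {f : F[X]} (hf : f ≠ 0) :
    (polyUnit f : FractionRing F[X]) = algebraMap F[X] (FractionRing F[X]) f := by
  simp [polyUnit, hf]

lemma polyUnit_mul {f g : F[X]} (hf : f ≠ 0) (hg : g ≠ 0) :
    polyUnit (f * g) = polyUnit f * polyUnit g := by
  ext
  rw [Units.val_mul, polyUnit_val hf, polyUnit_val hg, polyUnit_val (mul_ne_zero hf hg), map_mul]

variable (ℓ) in
/-- The symbol of two polynomials. -/
def psym (f g : F[X]) : MilnorK2 ℓ (FractionRing F[X]) := sym ℓ (polyUnit f) (polyUnit g)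

lemma psym_mul_left {f g : F[X]} (hf : f ≠ 0) (hg : g ≠ 0) (h : F[X]) :
    psym ℓ (f * g) h = psym ℓ f h + psym ℓ g h := by
  rw [psym, polyUnit_mul hf hg, sym_mul_left]; rfl

lemma psym_mul_right {f g : F[X]} (hf : f ≠ 0) (hg : g ≠ 0) (h : F[X]) :
    psym ℓ h (f * g) = psym ℓ h f + psym ℓ h g := by
  rw [psym, polyUnit_mul hf hg, sym_mul_right]; rfl

lemma exists_root_neg_one {R : Type*} [CommRing R] (hm : ∃ c : Fˣ, c ^ ℓ = -1) (φ : F →+* R) :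
    ∃ c : Rˣ, c ^ ℓ = -1 := by
  obtain ⟨c, hc⟩ := hm
  refine ⟨Units.map φ.toMonoidHom c, ?_⟩
  rw [← map_pow, hc]
  ext
  simp

lemma exists_root_neg_one_fractionRing (hm : ∃ c : Fˣ, c ^ ℓ = -1) :
    ∃ c : (FractionRing F[X])ˣ, c ^ ℓ = -1 :=
  exists_root_neg_one hm ((algebraMap F[X] (FractionRing F[X])).comp C)

lemma psym_swap (hm : ∃ c : Fˣ, c ^ ℓ = -1) (f g : F[X]) : psym ℓ f g = -psym ℓ g f :=
  sym_swap (exists_root_neg_one_fractionRing hm) _ _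

lemma psym_self (hm : ∃ c : Fˣ, c ^ ℓ = -1) (f : F[X]) : psym ℓ f f = 0 :=
  sym_self (exists_root_neg_one_fractionRing hm) _

lemma psym_of_add_eq (hm : ∃ c : Fˣ, c ^ ℓ = -1) {f g h : F[X]} (hf : f ≠ 0) (hg : g ≠ 0)
    (hh : h ≠ 0) (e : f + g = h) : psym ℓ f g = psym ℓ f h + psym ℓ h g := by
  refine sym_of_add_eq (exists_root_neg_one_fractionRing hm) ?_
  rw [polyUnit_val hf, polyUnit_val hg, polyUnit_val hh, ← e, map_add]

variable (ℓ F) in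
/-- The subgroup generated by symbols of polynomials of degree at most `d`. -/
def degFil (d : ℕ) : AddSubgroup (MilnorK2 ℓ (FractionRing F[X])) :=
  AddSubgroup.closure {x | ∃ f g : F[X], f ≠ 0 ∧ g ≠ 0 ∧ f.natDegree ≤ d ∧ g.natDegree ≤ d ∧
    x = psym ℓ f g}

lemma psym_mem_degFil {f g : F[X]} {d : ℕ} (hf : f ≠ 0) (hg : g ≠ 0) (hfd : f.natDegree ≤ d)
    (hgd : g.natDegree ≤ d) : psym ℓ f g ∈ degFil ℓ F d :=
  AddSubgroup.subset_closure (Set.mem_ofPred_eq ▸ ⟨f, g, hf, hg, hfd, hgd, rfl⟩)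

/-- Monic irreducible polynomials of degree `d`. -/
abbrev MonicIrred (F : Type*) [Field F] (d : ℕ) : Type _ :=
  {π : F[X] // π.Monic ∧ Irreducible π ∧ π.natDegree = d}

instance {d : ℕ} (π : MonicIrred F d) : Fact (Irreducible π.1) := ⟨π.2.2.1⟩

variable (ℓ F) in
/-- The subgroup generated by the degree at most `d` part and the symbols `{f, π}`. -/
def degFilGen (d : ℕ) : AddSubgroup (MilnorK2 ℓ (FractionRing F[X])) :=
  AddSubgroup.closure ({x | ∃ (f : F[X]) (π : MonicIrred F (d + 1)), f ≠ 0 ∧ f.natDegree ≤ d ∧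
    x = psym ℓ f π.1} ∪ degFil ℓ F d)

lemma degFil_le_degFilGen (d : ℕ) : degFil ℓ F d ≤ degFilGen ℓ F d :=
  fun _ hx => AddSubgroup.subset_closure (Or.inr hx)

lemma psym_mem_degFilGen {d : ℕ} {f : F[X]} (π : MonicIrred F (d + 1)) (hf : f ≠ 0)
    (hd : f.natDegree ≤ d) : psym ℓ f π.1 ∈ degFilGen ℓ F d :=
  AddSubgroup.subset_closure (Or.inl (Set.mem_ofPred_eq ▸ ⟨f, π, hf, hd, rfl⟩))

lemma mem_of_factor {d : ℕ} (p : F[X] → Prop) (hmul : ∀ f g, f ≠ 0 → g ≠ 0 → p f → p g → p (f * g))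
    (hlow : ∀ f, f ≠ 0 → f.natDegree ≤ d → p f) (hπ : ∀ π : MonicIrred F (d + 1), p π.1)
    {f : F[X]} (hf : f ≠ 0) (hfd : f.natDegree ≤ d + 1) : p f := by
  rcases Nat.lt_or_ge d f.natDegree with h | h
  swap
  · exact hlow f hf h
  have hfd' : f.natDegree = d + 1 := by omega
  have hc : f.leadingCoeff ≠ 0 := leadingCoeff_ne_zero.2 hf
  have hmon : (C f.leadingCoeff⁻¹ * f).Monic := by
    rw [mul_comm]; exact monic_mul_leadingCoeff_inv hf
  have hdeg : (C f.leadingCoeff⁻¹ * f).natDegree = d + 1 := by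
    rw [natDegree_C_mul (inv_ne_zero hc), hfd']
  have hCne : (C f.leadingCoeff : F[X]) ≠ 0 := by simpa using hf
  have e : f = C f.leadingCoeff * (C f.leadingCoeff⁻¹ * f) := by
    rw [← mul_assoc, ← C_mul, mul_inv_cancel₀ hc, C_1, one_mul]
  rw [e]
  refine hmul _ _ hCne hmon.ne_zero (hlow _ hCne (by simp)) ?_
  by_cases hirr : Irreducible (C f.leadingCoeff⁻¹ * f)
  · exact hπ ⟨_, hmon, hirr, hdeg⟩
  rw [hmon.irreducible_iff_natDegree] at hirr
  push Not at hirr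
  obtain ⟨a, b, ha, hb, hab, ha0, hb0⟩ := hirr (by
    intro h1
    rw [h1] at hdeg
    simp at hdeg)
  have := ha.natDegree_mul hb
  rw [hab, hdeg] at this
  rw [← hab]
  exact hmul _ _ ha.ne_zero hb.ne_zero (hlow _ ha.ne_zero (by omega)) (hlow _ hb.ne_zero (by omega))

lemma degFil_succ_le (hm : ∃ c : Fˣ, c ^ ℓ = -1) (d : ℕ) :
    degFil ℓ F (d + 1) ≤ degFilGen ℓ F d := by
  have swap : ∀ f g : F[X], psym ℓ f g ∈ degFilGen ℓ F d → psym ℓ g f ∈ degFilGen ℓ F d := by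
    intro f g h
    rw [psym_swap hm]
    exact neg_mem h
  refine (AddSubgroup.closure_le _).2 ?_
  rintro _ ⟨f, g, hf, hg, hfd, hgd, rfl⟩
  refine mem_of_factor (fun f => psym ℓ f g ∈ degFilGen ℓ F d) ?_ ?_ ?_ hf hfd
  · intro f f' hf hf' h h'
    rw [psym_mul_left hf hf']
    exact add_mem h h'
  · intro f hf hfd
    refine mem_of_factor (fun g => psym ℓ f g ∈ degFilGen ℓ F d) ?_ ?_ ?_ hg hgd
    · intro g g' hg hg' h h'
      rw [psym_mul_right hg hg']
      exact add_mem h h'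
    · intro g hg hgd
      exact degFil_le_degFilGen d (psym_mem_degFil hf hg hfd hgd)
    · intro π
      exact psym_mem_degFilGen π hf hfd
  · intro π
    refine mem_of_factor (fun g => psym ℓ π.1 g ∈ degFilGen ℓ F d) ?_ ?_ ?_ hg hgd
    · intro g g' hg hg' h h'
      rw [psym_mul_right hg hg']
      exact add_mem h h'
    · intro g hg hgd
      exact swap _ _ (psym_mem_degFilGen π hg hgd)
    · intro π'
      by_cases hne : π.1 = π'.1
      · rw [hne, psym_self hm]
        exact zero_mem _
      have hr : π.1 - π'.1 ≠ 0 := sub_ne_zero.2 hne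
      have hdeg : (π.1 - π'.1).natDegree ≤ d := by
        have h1 := degree_sub_lt_left (p := π.1) (q := π'.1)
          (by rw [degree_eq_natDegree π.2.1.ne_zero, degree_eq_natDegree π'.2.1.ne_zero,
            π.2.2.2, π'.2.2.2]) π.2.1.ne_zero
          (by rw [π.2.1.leadingCoeff, π'.2.1.leadingCoeff])
        have h2 := natDegree_lt_natDegree hr h1
        rw [π.2.2.2] at h2
        omega
      have h := psym_of_add_eq (ℓ := ℓ) hm π'.2.1.ne_zero hr π.2.1.ne_zero
        (add_sub_cancel π'.1 π.1)
      apply swap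
      rw [eq_sub_of_add_eq h.symm]
      exact sub_mem (swap _ _ (psym_mem_degFilGen π' hr hdeg))
        (swap _ _ (psym_mem_degFilGen π hr hdeg))

end PolynomialSymbols

section PolynomialResidues

open Polynomial MilnorK2

variable {ℓ : ℕ} {F : Type*} [Field F]

lemma not_dvd_of_natDegree_le {d : ℕ} (π : MonicIrred F (d + 1)) {f : F[X]} (hf : f ≠ 0)
    (hd : f.natDegree ≤ d) : ¬ π.1 ∣ f := by
  intro h
  have := natDegree_le_of_dvd h hf
  rw [π.2.2.2] at this
  omega

lemma psym_reduce (hm : ∃ c : Fˣ, c ^ ℓ = -1) {d : ℕ} (π : MonicIrred F (d + 1))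
    {f₁ f₂ f₃ q : F[X]} (h₁ : f₁ ≠ 0) (h₂ : f₂ ≠ 0) (h₃ : f₃ ≠ 0) (d₁ : f₁.natDegree ≤ d)
    (d₂ : f₂.natDegree ≤ d) (d₃ : f₃.natDegree ≤ d) (e : π.1 * q + f₃ = f₁ * f₂) :
    psym ℓ f₁ π.1 + psym ℓ f₂ π.1 - psym ℓ f₃ π.1 ∈ degFil ℓ F d := by
  by_cases hq : q = 0
  · rw [hq, mul_zero, zero_add] at e
    rw [e, psym_mul_left h₁ h₂, sub_self]
    exact zero_mem _
  have hπ := π.2.1.ne_zero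
  have h12 : f₁ * f₂ ≠ 0 := mul_ne_zero h₁ h₂
  have dq : q.natDegree ≤ d := by
    have e1 : π.1 * q = f₁ * f₂ - f₃ := by rw [← e]; ring
    have e2 := natDegree_mul hπ hq
    rw [e1, π.2.2.2] at e2
    have e3 := natDegree_sub_le (f₁ * f₂) f₃
    rw [natDegree_mul h₁ h₂] at e3
    omega
  have key := psym_of_add_eq (ℓ := ℓ) hm (mul_ne_zero hπ hq) h₃ h12 e
  rw [psym_mul_left hπ hq, psym_mul_left hπ hq, psym_mul_right h₁ h₂, psym_mul_right h₁ h₂,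
    psym_mul_left h₁ h₂, psym_swap hm π.1, psym_swap hm π.1, psym_swap hm π.1] at key
  have : psym ℓ f₁ π.1 + psym ℓ f₂ π.1 - psym ℓ f₃ π.1 =
      psym ℓ q f₁ + psym ℓ q f₂ + (psym ℓ f₁ f₃ + psym ℓ f₂ f₃) - psym ℓ q f₃ := by
    have key2 := sub_eq_zero.2 key
    rw [← sub_eq_zero, ← key2]
    abel
  rw [this]
  exact sub_mem (add_mem (add_mem (psym_mem_degFil hq h₁ dq d₁) (psym_mem_degFil hq h₂ dq d₂))
    (add_mem (psym_mem_degFil h₁ h₃ d₁ d₃) (psym_mem_degFil h₂ h₃ d₂ d₃)))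
    (psym_mem_degFil hq h₃ dq d₃)

/-- The section of the residue map at `π`, modulo symbols of smaller degree. -/
lemma exists_degFil_section (hm : ∃ c : Fˣ, c ^ ℓ = -1) {d : ℕ} (π : MonicIrred F (d + 1)) :
    ∃ θ : UnitsMod ℓ (AdjoinRoot π.1) →+ (MilnorK2 ℓ (FractionRing F[X]) ⧸ degFil ℓ F d),
      ∀ (f : F[X]) (u : (AdjoinRoot π.1)ˣ), f ≠ 0 → f.natDegree ≤ d →
        (u : AdjoinRoot π.1) = AdjoinRoot.mk π.1 f →
        θ (unitsMod ℓ u) = QuotientAddGroup.mk' (degFil ℓ F d) (psym ℓ f π.1) := by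
  let rep : (AdjoinRoot π.1)ˣ → F[X] := fun u => AdjoinRoot.modByMonicHom π.2.1 u
  have hrep : ∀ u, AdjoinRoot.mk π.1 (rep u) = u := fun u => AdjoinRoot.mk_leftInverse π.2.1 _
  have hrep0 : ∀ u, rep u ≠ 0 := by
    intro u h
    have := hrep u
    rw [h, map_zero] at this
    exact u.ne_zero this.symm
  have hne1 : π.1 ≠ 1 := fun h => π.2.2.1.not_isUnit (h ▸ isUnit_one)
  have hrepmk : ∀ (f : F[X]) (u : (AdjoinRoot π.1)ˣ), f.natDegree ≤ d →
      (u : AdjoinRoot π.1) = AdjoinRoot.mk π.1 f → rep u = f := by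
    intro f u hf hu
    change AdjoinRoot.modByMonicHom π.2.1 (u : AdjoinRoot π.1) = f
    rw [hu, AdjoinRoot.modByMonicHom_mk, modByMonic_eq_self_iff π.2.1]
    apply degree_lt_degree
    rw [π.2.2.2]
    omega
  have hrepd : ∀ u, (rep u).natDegree ≤ d := by
    intro u
    have h1 : rep u = rep u %ₘ π.1 := by
      rw [← AdjoinRoot.modByMonicHom_mk π.2.1, hrep u]
    have := natDegree_modByMonic_lt (rep u) π.2.1 hne1
    rw [← h1, π.2.2.2] at this
    omega
  obtain ⟨θ, hθ⟩ := unitsMod_exists_lift (ℓ := ℓ)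
    (fun u : (AdjoinRoot π.1)ˣ => QuotientAddGroup.mk' (degFil ℓ F d) (psym ℓ (rep u) π.1))
    (by
      intro u w
      have h1 : AdjoinRoot.mk π.1 (rep u * rep w) = AdjoinRoot.mk π.1 (rep (u * w)) := by
        rw [map_mul, hrep, hrep, hrep, Units.val_mul]
      obtain ⟨q, hq⟩ := AdjoinRoot.mk_eq_mk.1 h1
      have := psym_reduce (ℓ := ℓ) hm π (hrep0 u) (hrep0 w) (hrep0 (u * w)) (hrepd _) (hrepd _)
        (hrepd _) (q := q) (by rw [← hq]; ring)
      rw [← QuotientAddGroup.eq_zero_iff] at this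
      have h2 : QuotientAddGroup.mk' (degFil ℓ F d)
        (psym ℓ (rep u) π.1 + psym ℓ (rep w) π.1 - psym ℓ (rep (u * w)) π.1) = 0 := this
      rw [map_sub, map_add, sub_eq_zero] at h2
      exact h2.symm)
    (by
      intro x
      obtain ⟨y, rfl⟩ := QuotientAddGroup.mk'_surjective _ x
      rw [← map_nsmul, smul_eq_zero', map_zero])
  refine ⟨θ, fun f u hf hfd hu => ?_⟩
  rw [hθ, hrepmk f u hfd hu]

/-- The residue map at `π`. -/
lemma exists_residueHom (hm : ∃ c : Fˣ, c ^ ℓ = -1) {d : ℕ} (π : MonicIrred F d) :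
    ∃ δ : MilnorK2 ℓ (FractionRing F[X]) →+ UnitsMod ℓ (AdjoinRoot π.1),
      (∀ f g, ¬ π.1 ∣ f → ¬ π.1 ∣ g → δ (psym ℓ f g) = 0) ∧
      ∀ (f : F[X]) (u : (AdjoinRoot π.1)ˣ), (u : AdjoinRoot π.1) = AdjoinRoot.mk π.1 f →
        δ (psym ℓ f π.1) = unitsMod ℓ u := by
  obtain ⟨T, hT1, hT2⟩ := exists_tameDatum (K := FractionRing F[X]) (AdjoinRoot.mk π.1)
    (π := π.1) (h := 1) π.2.1.ne_zero (by rw [AdjoinRoot.mk_eq_zero]) (by simp)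
    (fun f hf => by rwa [one_mul, ← AdjoinRoot.mk_eq_zero])
  obtain ⟨δ, hδ⟩ := T.exists_tame (ℓ := ℓ) (exists_root_neg_one hm (AdjoinRoot.of π.1))
  have hdvd : ∀ f : F[X], ¬ π.1 ∣ f → f ≠ 0 := by
    rintro f h rfl
    exact h (dvd_zero _)
  have hunit : ∀ f : F[X], ¬ π.1 ∣ f → T.v (polyUnit f) = 0 ∧
      (T.s (polyUnit f) : AdjoinRoot π.1) = AdjoinRoot.mk π.1 f := fun f hf =>
    hT2 f _ (by rwa [Ne, AdjoinRoot.mk_eq_zero]) (polyUnit_val (hdvd f hf))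
  refine ⟨δ, ?_, ?_⟩
  · intro f g hf hg
    rw [psym, hδ, (hunit f hf).1, (hunit g hg).1]
    simp
  · intro f u hu
    have hf : ¬ π.1 ∣ f := by
      rw [← AdjoinRoot.mk_eq_zero, ← hu]
      exact u.ne_zero
    have h1 := hT1 _ (polyUnit_val π.2.1.ne_zero)
    rw [psym, hδ, (hunit f hf).1, h1.1, h1.2]
    have : T.s (polyUnit f) = u := Units.ext ((hunit f hf).2.trans hu.symm)
    simp [this]

lemma eq_of_dvd_monicIrred {d : ℕ} {π π' : MonicIrred F d} (h : π.1 ∣ π'.1) : π = π' :=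
  Subtype.ext (eq_of_monic_of_associated π.2.1 π'.2.1
    ((π.2.2.1.associated_of_dvd π'.2.2.1) h))

/-- An element of degree at most `d + 1` all of whose residues of degree `d + 1` vanish
has degree at most `d`. -/
lemma mem_degFil_of_residues (hm : ∃ c : Fˣ, c ^ ℓ = -1) {d : ℕ}
    {w : MilnorK2 ℓ (FractionRing F[X])} (hw : w ∈ degFilGen ℓ F d)
    (hres : ∀ π : MonicIrred F (d + 1), (exists_residueHom (ℓ := ℓ) hm π).choose w = 0) :
    w ∈ degFil ℓ F d := by
  classical
  let δ := fun π : MonicIrred F (d + 1) => (exists_residueHom (ℓ := ℓ) hm π).choose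
  have hδ := fun π : MonicIrred F (d + 1) => (exists_residueHom (ℓ := ℓ) hm π).choose_spec
  choose θ hθ using fun π : MonicIrred F (d + 1) => exists_degFil_section (ℓ := ℓ) hm π
  have hlow : ∀ x ∈ degFil ℓ F d, ∀ π, δ π x = 0 := by
    intro x hx π
    induction hx using AddSubgroup.closure_induction with
    | mem x hx =>
      obtain ⟨f, g, hf, hg, hfd, hgd, rfl⟩ := hx
      exact (hδ π).1 f g (not_dvd_of_natDegree_le π hf hfd) (not_dvd_of_natDegree_le π hg hgd)
    | zero => exact map_zero _
    | add x y _ _ hx hy => rw [map_add, hx, hy, add_zero]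
    | neg x _ hx => rw [map_neg, hx, neg_zero]
  have claim : ∃ s₀ : Finset (MonicIrred F (d + 1)), ∀ s, s₀ ⊆ s →
      QuotientAddGroup.mk' (degFil ℓ F d) w = ∑ π ∈ s, θ π (δ π w) := by
    clear hres
    induction hw using AddSubgroup.closure_induction with
    | mem x hx =>
      rcases hx with ⟨f, π, hf, hfd, rfl⟩ | hx
      · refine ⟨{π}, fun s hs => ?_⟩
        have hmem : π ∈ s := hs (Finset.mem_singleton_self π)
        have hnd := not_dvd_of_natDegree_le π hf hfd
        have hne : AdjoinRoot.mk π.1 f ≠ 0 := by rwa [Ne, AdjoinRoot.mk_eq_zero]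
        rw [Finset.sum_eq_single_of_mem π hmem]
        · have := (hδ π).2 f (Units.mk0 _ hne) rfl
          change _ = θ π ((exists_residueHom (ℓ := ℓ) hm π).choose _)
          rw [this]
          exact (hθ π f _ hf hfd rfl).symm
        · intro π' _ hne'
          have := (hδ π').1 f π.1 (not_dvd_of_natDegree_le π' hf hfd)
            (fun h => hne' (eq_of_dvd_monicIrred h))
          change θ π' ((exists_residueHom (ℓ := ℓ) hm π').choose _) = 0
          rw [this, map_zero]
      · refine ⟨∅, fun s _ => ?_⟩
        rw [Finset.sum_eq_zero]
        · exact (QuotientAddGroup.eq_zero_iff _).2 hx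
        · intro π _
          rw [hlow x hx, map_zero]
    | zero => exact ⟨∅, fun s _ => by simp⟩
    | add x y _ _ hx hy =>
      obtain ⟨s₁, h₁⟩ := hx
      obtain ⟨s₂, h₂⟩ := hy
      refine ⟨s₁ ∪ s₂, fun s hs => ?_⟩
      rw [map_add, h₁ s (Finset.union_subset_left hs), h₂ s (Finset.union_subset_right hs),
        ← Finset.sum_add_distrib]
      exact Finset.sum_congr rfl fun π _ => by rw [map_add, map_add]
    | neg x _ hx =>
      obtain ⟨s₁, h₁⟩ := hx
      refine ⟨s₁, fun s hs => ?_⟩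
      rw [map_neg, h₁ s hs, ← Finset.sum_neg_distrib]
      exact Finset.sum_congr rfl fun π _ => by rw [map_neg, map_neg]
  obtain ⟨s₀, hs₀⟩ := claim
  have h1 := hs₀ s₀ subset_rfl
  rw [Finset.sum_eq_zero (fun π _ => by rw [show δ π w = 0 from hres π, map_zero])] at h1
  exact (QuotientAddGroup.eq_zero_iff _).1 h1

lemma mem_degFil_zero_of_residues (hm : ∃ c : Fˣ, c ^ ℓ = -1)
    {w : MilnorK2 ℓ (FractionRing F[X])} {d : ℕ} (hw : w ∈ degFil ℓ F d)
    (hres : ∀ (d : ℕ) (π : MonicIrred F d), (exists_residueHom (ℓ := ℓ) hm π).choose w = 0) :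
    w ∈ degFil ℓ F 0 := by
  induction d with
  | zero => exact hw
  | succ d ih => exact ih (mem_degFil_of_residues hm (degFil_succ_le hm d hw) (hres _))

/-- If `a` becomes an `ℓ`-th power modulo the irreducible polynomial `P`, then the symbol
`{a, P(e)}` does not depend on `e`. -/
lemma sym_eval_eq_of_isPow (hm : ∃ c : Fˣ, c ^ ℓ = -1) (a : Fˣ) {P : F[X]} (hP : P.Monic)
    (hirr : Irreducible P) (ha : ∃ u : AdjoinRoot P, u ^ ℓ = AdjoinRoot.of P a) (hℓ : ℓ ≠ 0)
    {e e' : F} (he : P.eval e ≠ 0) (he' : P.eval e' ≠ 0) :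
    sym ℓ a (Units.mk0 _ he) = sym ℓ a (Units.mk0 _ he') := by
  have haC : (C (a : F) : F[X]) ≠ 0 := by simp
  have hw : psym ℓ (C (a : F)) P ∈ degFil ℓ F 0 := by
    refine mem_degFil_zero_of_residues hm (d := P.natDegree)
      (psym_mem_degFil haC hP.ne_zero (by simp) le_rfl) ?_
    intro d π
    have hδ := (exists_residueHom (ℓ := ℓ) hm π).choose_spec
    have hπC : ¬ π.1 ∣ C (a : F) := fun h =>
      π.2.2.1.not_isUnit (isUnit_of_dvd_unit h (by simp))
    by_cases hd : π.1 ∣ P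
    · have hπP : π.1 = P := eq_of_monic_of_associated π.2.1 hP
        ((π.2.2.1.associated_of_dvd hirr) hd)
      obtain ⟨π, hπ⟩ := π
      simp only at hπP
      subst hπP
      have : Fact (Irreducible π) := ⟨hirr⟩
      obtain ⟨u, hu⟩ := ha
      have hu0 : u ≠ 0 := by
        rintro rfl
        rw [zero_pow hℓ] at hu
        exact hπC (AdjoinRoot.mk_eq_zero.1 (hu.symm : AdjoinRoot.mk π (C (a : F)) = 0))
      rw [hδ.2 (C (a : F)) (Units.mk0 u hu0 ^ ℓ) (by simpa using hu), unitsMod_eq_zero]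
      exact ⟨_, rfl⟩
    · exact hδ.1 _ _ hπC hd
  have hspec : ∀ e : F, ∃ σ : MilnorK2 ℓ (FractionRing F[X]) →+ MilnorK2 ℓ F,
      ∀ (f g : F[X]) (u v : Fˣ), (u : F) = f.eval e → (v : F) = g.eval e →
        σ (psym ℓ f g) = sym ℓ u v := by
    intro e
    obtain ⟨T, hT1, hT2⟩ := exists_tameDatum (K := FractionRing F[X]) (evalRingHom e)
      (π := X - C e) (h := 1) (X_sub_C_ne_zero e) (by simp) (by simp)
      (fun f hf => by rw [one_mul, dvd_iff_isRoot]; exact hf)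
    obtain ⟨σ, hσ⟩ := T.exists_specialization (ℓ := ℓ)
    have hunit : ∀ (f : F[X]) (u : Fˣ), (u : F) = f.eval e → T.s (polyUnit f) = u := by
      intro f u hu
      have h0 : f.eval e ≠ 0 := hu ▸ u.ne_zero
      have hf : f ≠ 0 := by
        rintro rfl
        simp at h0
      exact Units.ext ((hT2 f _ h0 (polyUnit_val hf)).2.trans hu.symm)
    refine ⟨σ, fun f g u v hu hv => ?_⟩
    rw [psym, hσ, hunit f u hu, hunit g v hv]
  obtain ⟨σ, hσ⟩ := hspec e
  obtain ⟨σ', hσ'⟩ := hspec e'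
  have hagree : ∀ x ∈ degFil ℓ F 0, σ x = σ' x := by
    intro x hx
    induction hx using AddSubgroup.closure_induction with
    | mem x hx =>
      obtain ⟨f, g, hf, hg, hfd, hgd, rfl⟩ := hx
      obtain ⟨c, rfl⟩ := natDegree_eq_zero.1 (Nat.le_zero.1 hfd)
      obtain ⟨c', rfl⟩ := natDegree_eq_zero.1 (Nat.le_zero.1 hgd)
      have hc : c ≠ 0 := by simpa using hf
      have hc' : c' ≠ 0 := by simpa using hg
      rw [hσ _ _ (Units.mk0 c hc) (Units.mk0 c' hc') (by simp) (by simp),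
        hσ' _ _ (Units.mk0 c hc) (Units.mk0 c' hc') (by simp) (by simp)]
    | zero => rw [map_zero, map_zero]
    | add x y _ _ hx hy => rw [map_add, map_add, hx, hy]
    | neg x _ hx => rw [map_neg, map_neg, hx]
  have h1 := hagree _ hw
  rwa [hσ _ _ a (Units.mk0 _ he) (by simp) (by simp),
    hσ' _ _ a (Units.mk0 _ he') (by simp) (by simp)] at h1

end PolynomialResidues

section NormSymbol

open Polynomial MilnorK2 IntermediateField

variable {ℓ : ℕ} {F E : Type*} [Field F] [Field E] [Algebra F E]

/-- The norm as a map on units. -/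
abbrev unitsNorm (F : Type*) {E : Type*} [Field F] [Field E] [Algebra F E] : Eˣ →* Fˣ :=
  Units.map (Algebra.norm F)

lemma norm_eq_minpoly_eval_zero (hfin : Module.finrank F E = ℓ) (hℓ : ℓ.Prime) {y : E}
    (hy : y ∉ (⊥ : IntermediateField F E)) :
    Algebra.norm F y = (-1) ^ ℓ * (minpoly F y).eval 0 ∧
      Nonempty (AdjoinRoot (minpoly F y) ≃ₐ[F] E) := by
  have : FiniteDimensional F E := Module.finite_of_finrank_pos (by rw [hfin]; exact hℓ.pos)
  have hs := isSimpleOrder_of_finrank_prime F E (hfin ▸ hℓ)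
  have htop : F⟮y⟯ = ⊤ := by
    refine (hs.eq_bot_or_eq_top F⟮y⟯).resolve_left fun h => hy ?_
    rw [← h]
    exact mem_adjoin_simple_self F y
  have hInt : IsIntegral F y := IsIntegral.of_finite F y
  let e := (adjoinRootEquivAdjoin F hInt).trans ((equivOfEq htop).trans topEquiv)
  have hey : e (AdjoinRoot.root (minpoly F y)) = y := by
    simp only [e, AlgEquiv.trans_apply, adjoinRootEquivAdjoin_apply_root]
    rfl
  let pb := (AdjoinRoot.powerBasis (minpoly.ne_zero hInt)).map e
  have hgen : pb.gen = y := by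
    simp only [pb, PowerBasis.map_gen, AdjoinRoot.powerBasis_gen, hey]
  refine ⟨?_, ⟨e⟩⟩
  have h := Algebra.PowerBasis.norm_gen_eq_coeff_zero_minpoly pb
  rwa [hgen, ← pb.finrank, hfin, coeff_zero_eq_eval_zero] at h

/-- Norms from `F(a^(1/ℓ))` pair trivially with `a`. -/
lemma sym_norm_eq_zero (hm : ∃ c : Fˣ, c ^ ℓ = -1) (hℓ : ℓ.Prime)
    (hfin : Module.finrank F E = ℓ) (a : Fˣ) (ha : ∃ u : E, u ^ ℓ = algebraMap F E a) (y : Eˣ) :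
    sym ℓ a (unitsNorm F y) = 0 := by
  have : FiniteDimensional F E := Module.finite_of_finrank_pos (by rw [hfin]; exact hℓ.pos)
  have hneg : ∀ b : Fˣ, sym ℓ a ((-1) ^ ℓ * b) = sym ℓ a b := by
    intro b
    rw [sym_mul_right, sym_powl_right, zero_add]
  have key : ∀ z w : Eˣ, (z : E) ∉ (⊥ : IntermediateField F E) → (w : E) = z + 1 →
      sym ℓ a (unitsNorm F w) = sym ℓ a (unitsNorm F z) := by
    intro z w hz hw
    have hInt : IsIntegral F (z : E) := IsIntegral.of_finite F _
    have hw' : (w : E) ∉ (⊥ : IntermediateField F E) := by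
      intro h
      apply hz
      have : (z : E) = w - 1 := by rw [hw]; ring
      rw [this]
      exact sub_mem h (one_mem _)
    obtain ⟨h1, ⟨e⟩⟩ := norm_eq_minpoly_eval_zero hfin hℓ hz
    obtain ⟨h2, -⟩ := norm_eq_minpoly_eval_zero hfin hℓ hw'
    have h3 : minpoly F (w : E) = (minpoly F (z : E)).comp (X - C 1) := by
      rw [hw, ← minpoly.add_algebraMap, map_one]
    rw [h3, eval_comp] at h2
    simp only [map_one, eval_sub, eval_X, eval_one, zero_sub] at h2
    have n1 : (minpoly F (z : E)).eval 0 ≠ 0 := by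
      intro h0
      rw [h0, mul_zero, Algebra.norm_eq_zero_iff] at h1
      exact z.ne_zero h1
    have n2 : (minpoly F (z : E)).eval (-1) ≠ 0 := by
      intro h0
      rw [h0, mul_zero, Algebra.norm_eq_zero_iff] at h2
      exact w.ne_zero h2
    have e1 : unitsNorm F z = (-1) ^ ℓ * Units.mk0 _ n1 := by
      ext
      simpa using h1
    have e2 : unitsNorm F w = (-1) ^ ℓ * Units.mk0 _ n2 := by
      ext
      simpa using h2
    rw [e1, e2, hneg, hneg]
    refine sym_eval_eq_of_isPow hm a (minpoly.monic hInt) (minpoly.irreducible hInt) ?_ hℓ.ne_zero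
      n2 n1
    obtain ⟨u, hu⟩ := ha
    refine ⟨e.symm u, ?_⟩
    rw [← map_pow, hu, AlgEquiv.commutes]
    rfl
  by_cases hy : (y : E) ∈ (⊥ : IntermediateField F E)
  · obtain ⟨c, hc⟩ := mem_bot.1 hy
    have hc0 : c ≠ 0 := by
      rintro rfl
      rw [map_zero] at hc
      exact y.ne_zero hc.symm
    have : unitsNorm F y = Units.mk0 c hc0 ^ ℓ := by
      ext
      simp [← hc, Algebra.norm_algebraMap, hfin]
    rw [this, sym_powl_right]
  · have hy1 : ((y⁻¹ : Eˣ) : E) ∉ (⊥ : IntermediateField F E) := by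
      intro h
      apply hy
      have := inv_mem h
      simpa using this
    have hz0 : (y : E) + 1 ≠ 0 := by
      intro h
      apply hy
      rw [eq_neg_of_add_eq_zero_left h]
      exact neg_mem (one_mem _)
    let z : Eˣ := Units.mk0 _ hz0
    have k1 := key y z hy rfl
    have k2 := key y⁻¹ (z * y⁻¹) hy1 (by
      rw [Units.val_mul, Units.val_inv_eq_inv_val]
      have := y.ne_zero
      simp only [z, Units.val_mk0]
      field_simp
      ring)
    rw [map_mul, map_inv, sym_mul_right, k1, sym_inv_right, add_neg_cancel] at k2
    exact neg_eq_zero.1 k2.symm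

end NormSymbol

section Tsen

open Polynomial

/-- A system of fewer polynomial equations than unknowns over an algebraically closed field which
vanishes at the origin has a nontrivial solution. -/
theorem exists_ne_zero_common_zero {k σ τ : Type*} [Field k] [IsAlgClosed k] [Fintype σ]
    [Fintype τ] (hcard : Fintype.card τ < Fintype.card σ) (f : τ → MvPolynomial σ k)
    (h0 : ∀ i, MvPolynomial.eval 0 (f i) = 0) :
    ∃ x : σ → k, x ≠ 0 ∧ ∀ i, MvPolynomial.eval x (f i) = 0 := by
  classical
  by_contra! hcon
  set I : Ideal (MvPolynomial σ k) := Ideal.span (Set.range f) with hI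
  set m : Ideal (MvPolynomial σ k) := MvPolynomial.vanishingIdeal k {(0 : σ → k)} with hm
  have hzero : MvPolynomial.zeroLocus k I = {0} := by
    rw [hI, MvPolynomial.zeroLocus_span]
    ext x
    simp only [Set.mem_range, forall_exists_index, forall_apply_eq_imp_iff, Set.mem_ofPred_eq,
      Set.mem_singleton_iff, MvPolynomial.aeval_eq_eval]
    constructor
    · intro hx
      by_contra hx0
      obtain ⟨i, hi⟩ := hcon x hx0
      exact hi (hx i)
    · rintro rfl
      exact h0
  have hrad : I.radical = m := by
    rw [← MvPolynomial.vanishingIdeal_zeroLocus_eq_radical (K := k), hzero]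
  have hmin : m ∈ I.minimalPrimes := by
    rw [← Ideal.radical_minimalPrimes, hrad, Ideal.minimalPrimes_eq_subsingleton_self]
    rfl
  have hheight : m.height ≤ (Fintype.card τ : ℕ∞) := by
    refine (Ideal.height_le_card_of_mem_minimalPrimes_span (Set.finite_range f) hmin).trans ?_
    rw [Nat.cast_le, ← Set.image_univ]
    refine (Set.ncard_image_le Set.finite_univ).trans ?_
    rw [Set.ncard_univ, Nat.card_eq_fintype_card]
  have hdim : ringKrullDim (MvPolynomial σ k) ≤ (Fintype.card τ : ℕ∞) := by
    rw [ringKrullDim_le_iff_isMaximal_height_le]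
    intro M hM
    obtain ⟨x, rfl⟩ := MvPolynomial.isMaximal_iff_eq_vanishingIdeal_singleton.1 hM
    let e : MvPolynomial σ k ≃ₐ[k] MvPolynomial σ k :=
      AlgEquiv.ofAlgHom
        (MvPolynomial.aeval fun i => MvPolynomial.X i - MvPolynomial.C (x i))
        (MvPolynomial.aeval fun i => MvPolynomial.X i + MvPolynomial.C (x i))
        (by ext i; simp [MvPolynomial.algHom_C])
        (by ext i; simp [MvPolynomial.algHom_C])
    have hcomap : Ideal.comap e.toRingEquiv (MvPolynomial.vanishingIdeal k {x}) = m := by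
      ext p
      rw [Ideal.mem_comap, MvPolynomial.mem_vanishingIdeal_singleton_iff,
        MvPolynomial.mem_vanishingIdeal_singleton_iff]
      have : (MvPolynomial.aeval x).comp e.toAlgHom = MvPolynomial.aeval (R := k) (0 : σ → k) := by
        ext i
        simp [e]
      rw [← this]
      rfl
    rw [← RingEquiv.height_comap e.toRingEquiv, hcomap]
    exact WithBot.coe_le_coe.2 hheight
  rw [MvPolynomial.ringKrullDim_of_isNoetherianRing, ringKrullDim_eq_zero_of_field, zero_add,
    Nat.card_eq_fintype_card] at hdim
  have : (Fintype.card σ : ℕ∞) ≤ (Fintype.card τ : ℕ∞) := WithBot.coe_le_coe.1 hdim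
  exact absurd (Nat.cast_le.1 this) (not_le.2 hcard)

variable {k R J : Type*} [Field k] [CommRing R] [Algebra k[X] R] [Fintype J] {e : J → R}
  {σ : ℕ → Type*}

/-- A family of polynomial maps into a `k[X]`-algebra whose coordinates with respect to `e` have,
up to a common denominator, degree at most `a * N + C` in `X`. -/
def PolyGrowth (e : J → R) (a : ℕ) (G : ∀ N, (σ N → k) → R) : Prop :=
  ∃ D : k[X], D ≠ 0 ∧ ∃ C : ℕ, ∀ N, ∃ p : J → (MvPolynomial (σ N) k)[X],
    (∀ j, (p j).natDegree ≤ a * N + C) ∧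
      ∀ x, D • G N x = ∑ j, (p j).map (MvPolynomial.eval x) • e j

namespace PolyGrowth

theorem mono {a b : ℕ} (hab : a ≤ b) {G : ∀ N, (σ N → k) → R} (h : PolyGrowth e a G) :
    PolyGrowth e b G := by
  obtain ⟨D, hD, C, h⟩ := h
  refine ⟨D, hD, C, fun N => ?_⟩
  obtain ⟨p, hp, h⟩ := h N
  exact ⟨p, fun j => (hp j).trans (by gcongr), h⟩

theorem const (he : ∀ f : R, ∃ D : k[X], D ≠ 0 ∧ ∃ q : J → k[X], D • f = ∑ j, q j • e j) (c : R) :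
    PolyGrowth e 0 (fun N (_ : σ N → k) => c) := by
  obtain ⟨D, hD, q, hq⟩ := he c
  refine ⟨D, hD, ∑ j, (q j).natDegree, fun N => ⟨fun j => (q j).map MvPolynomial.C, fun j => ?_,
    fun x => ?_⟩⟩
  · refine natDegree_map_le.trans ?_
    rw [zero_mul, zero_add]
    exact Finset.single_le_sum (f := fun j => (q j).natDegree) (fun _ _ => Nat.zero_le _)
      (Finset.mem_univ j)
  · have : (MvPolynomial.eval x).comp (MvPolynomial.C : k →+* MvPolynomial (σ N) k) =
        RingHom.id k := by ext; simp
    simp only [Polynomial.map_map, this, Polynomial.map_id, hq]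

theorem add {a : ℕ} {G H : ∀ N, (σ N → k) → R} (hG : PolyGrowth e a G) (hH : PolyGrowth e a H) :
    PolyGrowth e a (fun N x => G N x + H N x) := by
  obtain ⟨D, hD, C, hG⟩ := hG
  obtain ⟨D', hD', C', hH⟩ := hH
  refine ⟨D * D', mul_ne_zero hD hD', C + C' + D.natDegree + D'.natDegree, fun N => ?_⟩
  obtain ⟨p, hp, hG⟩ := hG N
  obtain ⟨q, hq, hH⟩ := hH N
  have hid : ∀ x : σ N → k, (MvPolynomial.eval x).comp
      (MvPolynomial.C : k →+* MvPolynomial (σ N) k) = RingHom.id k := fun x => by ext; simp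
  refine ⟨fun j => D'.map MvPolynomial.C * p j + D.map MvPolynomial.C * q j, fun j => ?_,
    fun x => ?_⟩
  · refine (natDegree_add_le _ _).trans (max_le ?_ ?_)
    · refine natDegree_mul_le.trans ?_
      have := natDegree_map_le (p := D') (f := (MvPolynomial.C : k →+* MvPolynomial (σ N) k))
      have := hp j
      omega
    · refine natDegree_mul_le.trans ?_
      have := natDegree_map_le (p := D) (f := (MvPolynomial.C : k →+* MvPolynomial (σ N) k))
      have := hq j
      omega
  · simp only [Polynomial.map_add, Polynomial.map_mul, Polynomial.map_map, hid, Polynomial.map_id,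
      add_smul, mul_smul, Finset.sum_add_distrib, ← Finset.smul_sum, ← hG, ← hH, smul_add]
    rw [smul_comm D D']

theorem mul (he : ∀ f : R, ∃ D : k[X], D ≠ 0 ∧ ∃ q : J → k[X], D • f = ∑ j, q j • e j)
    {a b : ℕ} {G H : ∀ N, (σ N → k) → R} (hG : PolyGrowth e a G) (hH : PolyGrowth e b H) :
    PolyGrowth e (a + b) (fun N x => G N x * H N x) := by
  classical
  obtain ⟨D, hD, C, hG⟩ := hG
  obtain ⟨D', hD', C', hH⟩ := hH
  choose E hE q hq using fun ij : J × J => he (e ij.1 * e ij.2)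
  have hE' : ∀ ij : J × J, ∃ P : k[X], ∏ i, E i = P * E ij := fun ij =>
    ⟨∏ i ∈ Finset.univ.erase ij, E i, (Finset.prod_erase_mul _ _ (Finset.mem_univ ij)).symm⟩
  choose P hP using hE'
  let c : J → J → J → k[X] := fun i j l => P (i, j) * q (i, j) l
  have hc : ∀ i j, (∏ i, E i) • (e i * e j) = ∑ l, c i j l • e l := by
    intro i j
    rw [hP (i, j), mul_smul, hq, Finset.smul_sum]
    simp only [c, mul_smul]
  let C'' : ℕ := ∑ i, ∑ j, ∑ l, (c i j l).natDegree
  have hC'' : ∀ i j l, (c i j l).natDegree ≤ C'' := fun i j l =>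
    ((Finset.single_le_sum (f := fun l => (c i j l).natDegree) (fun _ _ => Nat.zero_le _)
      (Finset.mem_univ l)).trans (Finset.single_le_sum
        (f := fun j => ∑ l, (c i j l).natDegree) (fun _ _ => Nat.zero_le _)
      (Finset.mem_univ j))).trans (Finset.single_le_sum
        (f := fun i => ∑ j, ∑ l, (c i j l).natDegree) (fun _ _ => Nat.zero_le _)
      (Finset.mem_univ i))
  refine ⟨D * D' * ∏ i, E i, mul_ne_zero (mul_ne_zero hD hD')
    (Finset.prod_ne_zero_iff.2 fun i _ => hE i), C + C' + C'', fun N => ?_⟩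
  obtain ⟨p, hp, hG⟩ := hG N
  obtain ⟨r, hr, hH⟩ := hH N
  have hid : ∀ x : σ N → k, (MvPolynomial.eval x).comp
      (MvPolynomial.C : k →+* MvPolynomial (σ N) k) = RingHom.id k := fun x => by ext; simp
  refine ⟨fun l => ∑ i, ∑ j, p i * r j * (c i j l).map MvPolynomial.C, fun l => ?_, fun x => ?_⟩
  · refine natDegree_sum_le_of_forall_le _ _ fun i _ =>
      natDegree_sum_le_of_forall_le _ _ fun j _ => ?_
    refine natDegree_mul_le.trans ?_
    have h1 := natDegree_map_le (p := c i j l) (f := (MvPolynomial.C : k →+* MvPolynomial (σ N) k))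
    have h2 := hC'' i j l
    have h3 := natDegree_mul_le (p := p i) (q := r j)
    have h4 := hp i
    have h5 := hr j
    have : (a + b) * N = a * N + b * N := add_mul _ _ _
    omega
  · have h1 : (D * D' * ∏ i, E i) • (G N x * H N x) =
        (∏ i, E i) • ((D • G N x) * (D' • H N x)) := by
      rw [smul_mul_smul_comm, smul_smul, mul_comm]
    rw [h1, hG, hH, Finset.sum_mul_sum, Finset.smul_sum]
    simp only [Finset.smul_sum, Polynomial.map_sum, Polynomial.map_mul, Polynomial.map_map, hid,
      Polynomial.map_id, Finset.sum_smul]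
    rw [Finset.sum_comm' (t' := Finset.univ) (s' := fun _ => Finset.univ) (by simp)]
    conv_rhs => rw [Finset.sum_comm]; enter [2, i]; rw [Finset.sum_comm]
    rw [Finset.sum_comm]
    refine Finset.sum_congr rfl fun i _ => Finset.sum_congr rfl fun j _ => ?_
    rw [smul_mul_smul_comm, smul_comm, hc, Finset.smul_sum]
    simp only [mul_smul]

theorem sum (he : ∀ f : R, ∃ D : k[X], D ≠ 0 ∧ ∃ q : J → k[X], D • f = ∑ j, q j • e j)
    {ι : Type*} (s : Finset ι) {a : ℕ} {G : ι → ∀ N, (σ N → k) → R}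
    (h : ∀ i ∈ s, PolyGrowth e a (G i)) : PolyGrowth e a (fun N x => ∑ i ∈ s, G i N x) := by
  classical
  induction s using Finset.induction_on with
  | empty => simpa using (const he 0).mono (Nat.zero_le a)
  | insert i s hi ih =>
    simp only [Finset.sum_insert hi]
    exact (h i (by simp)).add (ih fun j hj => h j (by simp [hj]))

theorem pow (he : ∀ f : R, ∃ D : k[X], D ≠ 0 ∧ ∃ q : J → k[X], D • f = ∑ j, q j • e j)
    {a : ℕ} {G : ∀ N, (σ N → k) → R} (h : PolyGrowth e a G) (n : ℕ) :
    PolyGrowth e (n * a) (fun N x => G N x ^ n) := by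
  induction n with
  | zero => simpa using const he 1
  | succ n ih =>
    simp only [pow_succ, add_mul, one_mul]
    exact ih.mul he h

theorem prod (he : ∀ f : R, ∃ D : k[X], D ≠ 0 ∧ ∃ q : J → k[X], D • f = ∑ j, q j • e j)
    {ι : Type*} (s : Finset ι) {a : ι → ℕ} {G : ι → ∀ N, (σ N → k) → R}
    (h : ∀ i ∈ s, PolyGrowth e (a i) (G i)) :
    PolyGrowth e (∑ i ∈ s, a i) (fun N x => ∏ i ∈ s, G i N x) := by
  classical
  induction s using Finset.induction_on with
  | empty => simpa using const he 1
  | insert i s hi ih =>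
    simp only [Finset.prod_insert hi, Finset.sum_insert hi]
    exact (h i (by simp)).mul he (ih fun j hj => h j (by simp [hj]))

theorem eval (he : ∀ f : R, ∃ D : k[X], D ≠ 0 ∧ ∃ q : J → k[X], D • f = ∑ j, q j • e j)
    {ι : Type*} [Fintype ι] {ξ : ι → ∀ N, (σ N → k) → R} (h : ∀ i, PolyGrowth e 1 (ξ i))
    (Φ : MvPolynomial ι R) :
    PolyGrowth e Φ.totalDegree (fun N x => MvPolynomial.eval (fun i => ξ i N x) Φ) := by
  simp only [MvPolynomial.eval_eq']
  refine sum he _ fun d hd => ?_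
  have h1 := (const (σ := σ) he (Φ.coeff d)).mul he
    (prod he Finset.univ fun i _ => (h i).pow he (d i))
  refine h1.mono ?_
  rw [zero_add]
  simp only [mul_one]
  have := MvPolynomial.le_totalDegree hd
  rwa [Finsupp.sum_fintype _ _ (fun _ => rfl)] at this

end PolyGrowth

/-- **Tsen's theorem**, in coordinates. -/
theorem exists_ne_zero_eval_eq_zero_of_coordinates [IsAlgClosed k] [FaithfulSMul k[X] R]
    (he : ∀ f : R, ∃ D : k[X], D ≠ 0 ∧ ∃ q : J → k[X], D • f = ∑ j, q j • e j)
    (hli : LinearIndependent k[X] e) [IsDomain R] {ι : Type*} [Fintype ι] (Φ : MvPolynomial ι R)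
    (hdeg : Φ.totalDegree < Fintype.card ι) (h0 : MvPolynomial.eval 0 Φ = 0) :
    ∃ y : ι → R, y ≠ 0 ∧ MvPolynomial.eval y Φ = 0 := by
  classical
  have hJ : Nonempty J := by
    by_contra hJ
    rw [not_nonempty_iff] at hJ
    obtain ⟨D, hD, q, hq⟩ := he 1
    rw [Finset.univ_eq_empty, Finset.sum_empty, Algebra.smul_def, mul_one] at hq
    exact hD ((FaithfulSMul.algebraMap_eq_zero_iff k[X] R).1 hq)
  let σ : ℕ → Type _ := fun N => ι × J × Fin (N + 1)
  let P : ι → ∀ N, J → (MvPolynomial (σ N) k)[X] := fun i N j =>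
    ∑ s : Fin (N + 1), monomial (s : ℕ) (MvPolynomial.X (i, j, s))
  let ξ : ι → ∀ N, (σ N → k) → R := fun i N x =>
    ∑ j, (P i N j).map (MvPolynomial.eval x) • e j
  have hξ : ∀ i, PolyGrowth e 1 (ξ i) := by
    intro i
    refine ⟨1, one_ne_zero, 0, fun N => ⟨P i N, fun j => ?_, fun x => one_smul _ _⟩⟩
    refine natDegree_sum_le_of_forall_le _ _ fun s _ => ?_
    refine (natDegree_monomial_le _).trans ?_
    have := s.2
    omega
  obtain ⟨D, hD, C, h⟩ := PolyGrowth.eval he hξ Φ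
  obtain ⟨N, hN⟩ : ∃ N, N = C + 1 := ⟨_, rfl⟩
  obtain ⟨p, hp, hG⟩ := h N
  have hξ0 : ∀ i, ξ i N 0 = 0 := by
    intro i
    simp [ξ, P, Polynomial.map_sum]
  have key : ∀ x : σ N → k, MvPolynomial.eval (fun i => ξ i N x) Φ = 0 ↔
      ∀ j, (p j).map (MvPolynomial.eval x) = 0 := by
    intro x
    constructor
    · intro hx
      have h1 := hG x
      simp only [hx, smul_zero] at h1
      exact fun j => Fintype.linearIndependent_iff.1 hli _ h1.symm j
    · intro hx
      have h1 := hG x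
      simp only [hx, zero_smul, Finset.sum_const_zero] at h1
      rw [Algebra.smul_def, mul_eq_zero] at h1
      exact h1.resolve_left (mt (FaithfulSMul.algebraMap_eq_zero_iff k[X] R).1 hD)
  let M := Φ.totalDegree * N + C + 1
  obtain ⟨x, hx0, hx⟩ := exists_ne_zero_common_zero (k := k) (σ := σ N) (τ := J × Fin M)
    (by
      simp only [σ, Fintype.card_prod, Fintype.card_fin, M, hN]
      have h1 : 0 < Fintype.card J := Fintype.card_pos
      have h2 : Φ.totalDegree * (C + 1) + C + 1 < Fintype.card ι * (C + 1 + 1) := by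
        have : (Φ.totalDegree + 1) * (C + 1 + 1) ≤ Fintype.card ι * (C + 1 + 1) :=
          Nat.mul_le_mul_right _ hdeg
        nlinarith
      nlinarith)
    (fun js => (p js.1).coeff js.2) (by
      rintro ⟨j, s⟩
      have h1 := (key 0).1 (by simpa [hξ0] using h0) j
      have h2 := congrArg (fun q => q.coeff s) h1
      simpa using h2)
  refine ⟨fun i => ξ i N x, fun hy => hx0 ?_, (key x).2 fun j => ?_⟩
  · funext ⟨i, j, s⟩
    have h1 : ∑ j, (P i N j).map (MvPolynomial.eval x) • e j = 0 := congrFun hy i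
    have h2 := congrArg (fun q => q.coeff (s : ℕ)) (Fintype.linearIndependent_iff.1 hli _ h1 j)
    simp only [P, Polynomial.map_sum, finsetSum_coeff, Polynomial.map_monomial,
      MvPolynomial.eval_X, coeff_monomial, coeff_zero] at h2
    rw [Finset.sum_eq_single s] at h2
    · simpa using h2
    · intro b _ hb
      rw [if_neg]
      exact fun h => hb (Fin.ext h)
    · simp
  · ext n
    rw [coeff_map, coeff_zero]
    by_cases hn : n < M
    · exact hx (j, ⟨n, hn⟩)
    · rw [coeff_eq_zero_of_natDegree_lt, map_zero]
      have := hp j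
      simp only [M] at hn
      omega

end Tsen

section TsenNorm

open Polynomial

/-- **Tsen's theorem**: finite extensions of `k(t)` are quasi-algebraically closed. -/
theorem exists_ne_zero_eval_eq_zero_of_finite {k K₀ R : Type*} [Field k] [IsAlgClosed k] [Field K₀]
    [Field R] [Algebra k[X] K₀] [IsFractionRing k[X] K₀] [Algebra K₀ R] [Algebra k[X] R]
    [IsScalarTower k[X] K₀ R] [FiniteDimensional K₀ R] {ι : Type*} [Fintype ι]
    (Φ : MvPolynomial ι R)
    (hdeg : Φ.totalDegree < Fintype.card ι) (h0 : MvPolynomial.eval 0 Φ = 0) :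
    ∃ y : ι → R, y ≠ 0 ∧ MvPolynomial.eval y Φ = 0 := by
  classical
  let e := Module.finBasis K₀ R
  have : FaithfulSMul k[X] R := by
    rw [faithfulSMul_iff_algebraMap_injective, IsScalarTower.algebraMap_eq k[X] K₀ R]
    exact (algebraMap K₀ R).injective.comp (IsFractionRing.injective k[X] K₀)
  refine exists_ne_zero_eval_eq_zero_of_coordinates (e := e) (fun f => ?_)
    ((LinearIndependent.iff_fractionRing k[X] K₀).2 e.linearIndependent) Φ hdeg h0
  obtain ⟨D, hD⟩ := IsLocalization.exist_integer_multiples_of_finite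
    (nonZeroDivisors k[X]) (fun j => e.repr f j)
  choose q hq using hD
  refine ⟨D, nonZeroDivisors.coe_ne_zero D, q, ?_⟩
  conv_lhs => rw [← e.sum_repr f, Finset.smul_sum]
  refine Finset.sum_congr rfl fun j _ => ?_
  rw [← smul_assoc, ← hq j, algebraMap_smul]

theorem totalDegree_det_le {R n σ : Type*} [CommRing R] [Fintype n] [DecidableEq n]
    (M : Matrix n n (MvPolynomial σ R)) (hM : ∀ i j, (M i j).totalDegree ≤ 1) :
    M.det.totalDegree ≤ Fintype.card n := by
  rw [Matrix.det_apply]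
  refine MvPolynomial.totalDegree_finsetSum_le fun τ _ => ?_
  have h : (∏ i, M (τ i) i).totalDegree ≤ Fintype.card n := by
    refine (MvPolynomial.totalDegree_finsetProd _ _).trans ?_
    refine (Finset.sum_le_sum fun i _ => hM (τ i) i).trans ?_
    simp
  rcases Int.units_eq_one_or (Equiv.Perm.sign τ) with h1 | h1 <;> simpa [h1] using h

/-- Over a finite extension of `k(t)`, every element is a norm up to powers of the degree. -/
theorem exists_norm_eq_mul_pow {k K₀ R E : Type*} [Field k] [IsAlgClosed k] [Field K₀]
    [Field R] [Algebra k[X] K₀] [IsFractionRing k[X] K₀] [Algebra K₀ R] [Algebra k[X] R]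
    [IsScalarTower k[X] K₀ R] [FiniteDimensional K₀ R] [Field E] [Algebra R E]
    [FiniteDimensional R E] (b : R) :
    ∃ (y : E) (w : R), w ≠ 0 ∧ Algebra.norm R y = b * w ^ Module.finrank R E := by
  classical
  let ε := Module.finBasis R E
  let n := Module.finrank R E
  have hn : 0 < n := Module.finrank_pos
  let M : Matrix (Fin n) (Fin n) (MvPolynomial (Option (Fin n)) R) :=
    ∑ i : Fin n, (MvPolynomial.X (some i) : MvPolynomial (Option (Fin n)) R) •
      (Algebra.leftMulMatrix ε (ε i)).map MvPolynomial.C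
  let Φ : MvPolynomial (Option (Fin n)) R :=
    M.det - MvPolynomial.C b * MvPolynomial.X none ^ n
  have hev : ∀ y : Option (Fin n) → R, MvPolynomial.eval y Φ =
      Algebra.norm R (∑ i, y (some i) • ε i) - b * y none ^ n := by
    intro y
    simp only [Φ, map_sub, map_mul, map_pow, MvPolynomial.eval_C, MvPolynomial.eval_X]
    rw [RingHom.map_det, Algebra.norm_eq_matrix_det ε]
    congr 2
    ext i j
    simp [M, Matrix.sum_apply]
  have hdeg : Φ.totalDegree < Fintype.card (Option (Fin n)) := by
    rw [Fintype.card_option, Fintype.card_fin, Nat.lt_succ_iff]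
    refine (MvPolynomial.totalDegree_sub _ _).trans (max_le ?_ ?_)
    · refine (totalDegree_det_le _ fun i j => ?_).trans (by simp)
      simp only [M, Matrix.sum_apply, Matrix.smul_apply, Matrix.map_apply, smul_eq_mul]
      refine MvPolynomial.totalDegree_finsetSum_le fun l _ => ?_
      refine (MvPolynomial.totalDegree_mul _ _).trans ?_
      simp
    · refine (MvPolynomial.totalDegree_mul _ _).trans ?_
      simp
  obtain ⟨y, hy0, hy⟩ := exists_ne_zero_eval_eq_zero_of_finite (k := k) (K₀ := K₀) Φ hdeg (by
    rw [hev]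
    simp [hn.ne'])
  rw [hev, sub_eq_zero] at hy
  refine ⟨_, _, fun hw => hy0 ?_, hy⟩
  rw [hw, zero_pow hn.ne', mul_zero, Algebra.norm_eq_zero_iff] at hy
  have := Fintype.linearIndependent_iff.1 ε.linearIndependent _ hy
  funext i
  cases i with
  | none => exact hw
  | some i => exact this i

open MilnorK2 in
theorem sym_eq_zero_of_finite {k K₀ R : Type*} [Field k] [IsAlgClosed k] [Field K₀]
    [Field R] [Algebra k[X] K₀] [IsFractionRing k[X] K₀] [Algebra K₀ R] [Algebra k[X] R]
    [IsScalarTower k[X] K₀ R] [FiniteDimensional K₀ R] {ℓ : ℕ} (hℓ : ℓ.Prime)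
    (hm : ∃ c : Rˣ, c ^ ℓ = -1) (a b : Rˣ) : sym ℓ a b = 0 := by
  by_cases ha : ∃ u : R, u ^ ℓ = a
  · obtain ⟨u, hu⟩ := ha
    have hu0 : u ≠ 0 := by
      rintro rfl
      rw [zero_pow hℓ.ne_zero] at hu
      exact a.ne_zero hu.symm
    have : a = Units.mk0 u hu0 ^ ℓ := by ext; simp [hu]
    rw [this, sym_powl_left]
  · have hirr : Irreducible (X ^ ℓ - C (a : R)) :=
      X_pow_sub_C_irreducible_of_prime hℓ fun u hu => ha ⟨u, hu⟩
    have : Fact (Irreducible (X ^ ℓ - C (a : R))) := ⟨hirr⟩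
    let E := AdjoinRoot (X ^ ℓ - C (a : R))
    have hfin : Module.finrank R E = ℓ := by
      rw [(AdjoinRoot.powerBasis hirr.ne_zero).finrank, AdjoinRoot.powerBasis_dim,
        natDegree_X_pow_sub_C]
    have : FiniteDimensional R E := Module.finite_of_finrank_pos (by rw [hfin]; exact hℓ.pos)
    obtain ⟨y, w, hw, hy⟩ := exists_norm_eq_mul_pow (k := k) (K₀ := K₀) (R := R) (E := E) (b : R)
    have hy0 : y ≠ 0 := by
      rintro rfl
      rw [Algebra.norm_zero, eq_comm, mul_eq_zero] at hy
      exact hy.elim b.ne_zero (pow_ne_zero _ hw)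
    have key := sym_norm_eq_zero hm hℓ hfin a
      ⟨AdjoinRoot.root _, by
        have := AdjoinRoot.eval₂_root (X ^ ℓ - C (a : R))
        rw [eval₂_sub, eval₂_X_pow, eval₂_C, sub_eq_zero] at this
        exact this⟩ (Units.mk0 y hy0)
    have h2 : unitsNorm R (Units.mk0 y hy0) = b * Units.mk0 w hw ^ ℓ := by
      ext
      simp only [unitsNorm, Units.coe_map, Units.val_mk0, Units.val_mul, Units.val_pow_eq_pow_val]
      rw [hy, hfin]
    rwa [h2, sym_mul_right, sym_powl_right, add_zero] at key

theorem exists_unit_pow_eq_neg_one (k : Type*) {R : Type*} [Field k] [IsAlgClosed k] [Field R]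
    [Algebra k R] {ℓ : ℕ} (hℓ : ℓ ≠ 0) : ∃ c : Rˣ, c ^ ℓ = -1 := by
  obtain ⟨c, hc⟩ := IsAlgClosed.exists_pow_nat_eq (-1 : k) (Nat.pos_of_ne_zero hℓ)
  have hc0 : c ≠ 0 := by
    rintro rfl
    rw [zero_pow hℓ] at hc
    simp at hc
  refine ⟨Units.map (algebraMap k R).toMonoidHom (Units.mk0 c hc0), ?_⟩
  ext
  simp [← map_pow, hc]

open MilnorK2 IntermediateField in
/-- The mod-`ℓ` Milnor `K₂` of an algebraic extension of `k(t)` vanishes. -/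
theorem sym_eq_zero_of_isAlgebraic {k K₀ R : Type*} [Field k] [IsAlgClosed k] [Field K₀]
    [Field R] [Algebra k[X] K₀] [IsFractionRing k[X] K₀] [Algebra K₀ R] [Algebra.IsAlgebraic K₀ R]
    {ℓ : ℕ} (hℓ : ℓ.Prime) (a b : Rˣ) : sym ℓ a b = 0 := by
  let E := adjoin K₀ {(a : R), (b : R)}
  have hE : FiniteDimensional K₀ E :=
    finiteDimensional_adjoin fun x _ => (Algebra.IsAlgebraic.isAlgebraic x).isIntegral
  let : Algebra k[X] E := ((algebraMap K₀ E).comp (algebraMap k[X] K₀)).toAlgebra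
  have : IsScalarTower k[X] K₀ E := IsScalarTower.of_algebraMap_eq fun _ => rfl
  let : Algebra k E := ((algebraMap k[X] E).comp C).toAlgebra
  have ha : (a : R) ∈ E := subset_adjoin _ _ (by simp)
  have hb : (b : R) ∈ E := subset_adjoin _ _ (by simp)
  let a' : Eˣ := Units.mk0 ⟨a, ha⟩ fun h => a.ne_zero (congrArg Subtype.val h)
  let b' : Eˣ := Units.mk0 ⟨b, hb⟩ fun h => b.ne_zero (congrArg Subtype.val h)
  have h := sym_eq_zero_of_finite (k := k) (K₀ := K₀) hℓ
    (exists_unit_pow_eq_neg_one k hℓ.ne_zero) a' b'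
  have h2 := congrArg (MilnorK2.map ℓ (algebraMap E R)) h
  rw [map_sym, _root_.map_zero] at h2
  convert h2 using 2 <;> ext <;> rfl

end TsenNorm

section Kummer

open Polynomial IntermediateField

/-- Let `E/K` be a finite Galois extension generated by elements algebraic over a subfield `F` which
is relatively algebraically closed in `K`. Then elements of `K` becoming `ℓ`-th powers in `E` come
from `F`, up to `ℓ`-th powers in `K`. -/
theorem exists_eq_mul_pow_of_isGalois {F K E : Type*} [Field F] [Field K] [Field E] [Algebra F K]
    [Algebra K E] [Algebra F E] [IsScalarTower F K E] [FiniteDimensional K E] [IsGalois K E]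
    (hF : ∀ x : K, IsAlgebraic F x → ∃ f : F, algebraMap F K f = x)
    {S : Set E} (hS : ∀ x ∈ S, IsAlgebraic F x)
    (hgen : ∀ σ τ : Gal(E/K), (∀ x ∈ S, σ x = τ x) → σ = τ)
    {ℓ : ℕ} [NeZero ℓ] {ζ : F} (hζ : IsPrimitiveRoot ζ ℓ) {w : E} {z : K} (hz : z ≠ 0)
    (hw : w ^ ℓ = algebraMap K E z) : ∃ (f : F) (u : K), z = algebraMap F K f * u ^ ℓ := by
  have hw0 : w ≠ 0 := by
    rintro rfl
    rw [zero_pow (NeZero.ne ℓ), eq_comm, map_eq_zero] at hw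
    exact hz hw
  have hζE : IsPrimitiveRoot (algebraMap F E ζ) ℓ := hζ.map_of_injective (algebraMap F E).injective
  have hχ : ∀ σ : Gal(E/K), ∃ c : F, c ≠ 0 ∧ c ^ ℓ = 1 ∧ σ w = algebraMap F E c * w := by
    intro σ
    have h1 : (σ w / w) ^ ℓ = 1 := by
      rw [div_pow, ← map_pow, hw, AlgEquiv.commutes, div_self]
      rwa [Ne, map_eq_zero]
    obtain ⟨i, -, hi⟩ := hζE.eq_pow_of_pow_eq_one h1
    refine ⟨ζ ^ i, pow_ne_zero _ (hζ.ne_zero (NeZero.ne ℓ)), ?_, ?_⟩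
    · rw [← pow_mul, mul_comm, pow_mul, hζ.pow_eq_one, one_pow]
    · rw [map_pow, hi, div_mul_cancel₀ _ hw0]
  choose χ hχ0 hχℓ hχ using hχ
  have hfix : ∀ (σ : Gal(E/K)) (c : F), σ (algebraMap F E c) = algebraMap F E c := by
    intro σ c
    rw [IsScalarTower.algebraMap_apply F K E, AlgEquiv.commutes]
  have hχmul : ∀ σ τ, χ (τ * σ) = χ τ * χ σ := by
    intro σ τ
    have h1 := hχ (τ * σ)
    rw [AlgEquiv.mul_apply, hχ, map_mul, hfix, hχ, ← mul_assoc, ← map_mul] at h1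
    have := (algebraMap F E).injective (mul_right_cancel₀ hw0 h1)
    rw [← this, mul_comm]
  let A := algebraicClosure F E
  let res : Gal(E/K) → (A →* E) := fun σ =>
    ((σ : E →ₐ[K] E) : E →* E).comp (algebraMap A E).toMonoidHom
  have hres : Function.Injective res := by
    intro σ τ h
    exact hgen σ τ fun x hx =>
      DFunLike.congr_fun h (⟨x, mem_algebraicClosure_iff.2 (hS x hx)⟩ : A)
  have hli := (linearIndependent_monoidHom A E).comp res hres
  obtain ⟨c, hc⟩ : ∃ c : A, ∑ σ, algebraMap F E (χ σ)⁻¹ * σ (c : E) ≠ 0 := by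
    by_contra! hcon
    have := Fintype.linearIndependent_iff.1 hli (fun σ => algebraMap F E (χ σ)⁻¹)
      (by ext c; simpa [Finset.sum_apply, res] using hcon c) 1
    rw [map_eq_zero, inv_eq_zero] at this
    exact hχ0 1 this
  set r : E := ∑ σ, algebraMap F E (χ σ)⁻¹ * σ (c : E) with hr
  have hτ : ∀ τ : Gal(E/K), τ r = algebraMap F E (χ τ) * r := by
    intro τ
    rw [hr, map_sum, Finset.mul_sum]
    refine Fintype.sum_equiv (Equiv.mulLeft τ) _ _ fun σ => ?_
    rw [map_mul, hfix, Equiv.coe_mulLeft, hχmul, AlgEquiv.mul_apply, ← mul_assoc, ← map_mul,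
      mul_inv, ← mul_assoc, mul_inv_cancel₀ (hχ0 τ), one_mul]
  have hcalg : ∀ σ : Gal(E/K), IsAlgebraic F (σ (c : E)) := by
    intro σ
    have h1 : IsAlgebraic F (c : E) := mem_algebraicClosure_iff.1 c.2
    exact h1.algHom ((σ : E →ₐ[K] E).restrictScalars F)
  have hralg : IsAlgebraic F r := by
    rw [← mem_algebraicClosure_iff]
    refine sum_mem fun σ _ => mul_mem ?_ (mem_algebraicClosure_iff.2 (hcalg σ))
    exact (algebraicClosure F E).algebraMap_mem _
  obtain ⟨u, hu⟩ : ∃ u : K, algebraMap K E u = w / r := by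
    have : w / r ∈ (⊥ : IntermediateField K E) := by
      rw [IsGalois.mem_bot_iff_fixed]
      intro τ
      rw [map_div₀, hχ, hτ, mul_div_mul_left]
      rw [Ne, map_eq_zero]
      exact hχ0 τ
    exact mem_bot.1 this
  obtain ⟨g, hg⟩ : ∃ g : K, algebraMap K E g = r ^ ℓ := by
    have : r ^ ℓ ∈ (⊥ : IntermediateField K E) := by
      rw [IsGalois.mem_bot_iff_fixed]
      intro τ
      rw [map_pow, hτ, mul_pow, ← map_pow, hχℓ, map_one, one_mul]
    exact mem_bot.1 this
  obtain ⟨f, rfl⟩ := hF g (by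
    rw [← isAlgebraic_algebraMap_iff (algebraMap K E).injective, hg]
    exact hralg.pow ℓ)
  refine ⟨f, u, (algebraMap K E).injective ?_⟩
  rw [← hw, map_mul, hg, map_pow, hu, div_pow, mul_div_cancel₀ _ (pow_ne_zero _ hc)]

/-- If `z` is not of the form `f * u ^ ℓ` with `f ∈ F` and `u ∈ K`, then the Galois group of
`K(z ^ (1/ℓ))` over `K` lifts to automorphisms fixing all elements algebraic over `F`. -/
theorem exists_algEquiv_root_eq_mul {F K Ω : Type*} [Field F] [Field K] [Field Ω] [Algebra F K]
    [Algebra K Ω] [Algebra F Ω] [IsScalarTower F K Ω] [IsAlgClosure K Ω]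
    (hF : ∀ x : K, IsAlgebraic F x → ∃ f : F, algebraMap F K f = x)
    {ℓ : ℕ} (hℓ : ℓ.Prime) {ζ : F} (hζ : IsPrimitiveRoot ζ ℓ) {z : K} (hz : z ≠ 0)
    (hzF : ¬ ∃ (f : F) (u : K), z = algebraMap F K f * u ^ ℓ) {y : Ω}
    (hy : y ^ ℓ = algebraMap K Ω z) :
    ∃ σ : Ω ≃ₐ[K] Ω, σ y = algebraMap F Ω ζ * y ∧ ∀ x : Ω, IsAlgebraic F x → σ x = x := by
  classical
  have : NeZero ℓ := ⟨hℓ.ne_zero⟩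
  have : IsAlgClosed Ω := IsAlgClosure.isAlgClosed K
  have : Algebra.IsAlgebraic K Ω := IsAlgClosure.isAlgebraic
  let M : IntermediateField K Ω := adjoin K {x : Ω | IsSeparable F x}
  have hnot : ∀ w : M, w ^ ℓ ≠ algebraMap K M z := by
    rintro ⟨w, hwM⟩ hw
    obtain ⟨T, hT, hwT⟩ := exists_finset_of_mem_adjoin hwM
    let P : K[X] := ∏ s ∈ T, (minpoly F s).map (algebraMap F K)
    have hP0 : P ≠ 0 := Finset.prod_ne_zero_iff.2 fun s hs =>
      (Polynomial.map_ne_zero (minpoly.ne_zero (hT hs).isIntegral))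
    let S := P.rootSet Ω
    have hSsep : ∀ x ∈ S, IsSeparable F x := by
      intro x hx
      have h1 := (mem_rootSet.1 hx).2
      rw [map_prod, Finset.prod_eq_zero_iff] at h1
      obtain ⟨s, hs, h1⟩ := h1
      rw [aeval_map_algebraMap] at h1
      have := minpoly.eq_of_irreducible_of_monic (minpoly.irreducible (hT hs).isIntegral) h1
        (minpoly.monic (hT hs).isIntegral)
      rw [IsSeparable, ← this]
      exact hT hs
    have hTS : (T : Set Ω) ⊆ S := by
      intro s hs
      refine mem_rootSet.2 ⟨hP0, ?_⟩
      rw [map_prod]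
      refine Finset.prod_eq_zero hs ?_
      rw [aeval_map_algebraMap, minpoly.aeval]
    let E := adjoin K S
    have hsplit : P.IsSplittingField K E :=
      adjoin_rootSet_isSplittingField (IsAlgClosed.splits _)
    have hfd : FiniteDimensional K E := IsSplittingField.finiteDimensional E P
    have hnormal : Normal K E := Normal.of_isSplittingField P
    have hsep : Algebra.IsSeparable K E :=
      (isSeparable_adjoin_iff_isSeparable K Ω).2 fun x hx => (hSsep x hx).tower_top K
    have hgal : IsGalois K E := ⟨⟩
    have hwE : w ∈ E := adjoin.mono K _ _ hTS hwT
    refine hzF (exists_eq_mul_pow_of_isGalois (E := E) (S := (Subtype.val : E → Ω) ⁻¹' S)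
      hF (fun x hx => ?_) ?_ hζ hz (w := ⟨w, hwE⟩)
      (Subtype.ext ((congrArg Subtype.val hw :))))
    · have h1 := (hSsep x hx).isIntegral.isAlgebraic
      exact isAlgebraic_algHom_iff (E.val.restrictScalars F) Subtype.val_injective |>.1 h1
    · intro σ τ h
      have h2 : (σ : E →ₐ[K] E) = τ := algHom_ext_of_eq_adjoin K (S := E) rfl fun x hx =>
        h ⟨x, _⟩ hx
      ext x
      exact congrArg Subtype.val (DFunLike.congr_fun h2 x)
  have hirr : Irreducible (X ^ ℓ - C (algebraMap K M z)) :=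
    X_pow_sub_C_irreducible_of_prime hℓ hnot
  have hroot : ∀ x : Ω, x ^ ℓ = algebraMap K Ω z → minpoly M x = X ^ ℓ - C (algebraMap K M z) := by
    intro x hx
    refine (minpoly.eq_of_irreducible_of_monic hirr ?_ (monic_X_pow_sub_C _ hℓ.ne_zero)).symm
    rw [map_sub, map_pow, aeval_X, aeval_C, hx, ← IsScalarTower.algebraMap_apply, sub_self]
  have : Algebra.IsAlgebraic M Ω := Algebra.IsAlgebraic.tower_top (K := K) M
  have : IsAlgClosure M Ω := ⟨inferInstance, inferInstance⟩
  have : Normal M Ω := IsAlgClosure.normal M Ω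
  obtain ⟨σ, hσ⟩ := isConjRoot_iff_exists_algEquiv.1
    (show IsConjRoot M (algebraMap F Ω ζ * y) y from (hroot _ (by
      rw [mul_pow, ← map_pow, hζ.pow_eq_one, map_one, one_mul, hy])).trans (hroot y hy).symm)
  refine ⟨σ.restrictScalars K, hσ, fun x hx => ?_⟩
  have hxF : IsIntegral F x := hx.isIntegral
  obtain ⟨p, hp⟩ := ExpChar.exists F
  obtain ⟨g, hg, n, hgn⟩ := (minpoly.irreducible hxF).hasSeparableContraction p
  have hxs : IsSeparable F (x ^ p ^ n) := by
    refine Polynomial.Separable.of_dvd hg (minpoly.dvd F _ ?_)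
    rw [← expand_aeval, hgn, minpoly.aeval]
  have h1 : σ (x ^ p ^ n) = x ^ p ^ n :=
    σ.commutes (⟨x ^ p ^ n, subset_adjoin K _ hxs⟩ : M)
  have : ExpChar Ω p := expChar_of_injective_algebraMap (algebraMap F Ω).injective p
  rw [map_pow] at h1
  exact iterateFrobenius_inj Ω p n h1

end Kummer

section Transfer

open Polynomial

/-- A system of polynomial equations over `k[X]` whose specializations at infinitely many `c ∈ k`
are solvable is solvable over the algebraic closure of the fraction field of `k[X]`. -/
theorem exists_algebraic_solution {k L Ω τ : Type*} [Field k] [Field L] [Field Ω]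
    [Algebra k[X] L] [IsFractionRing k[X] L] [Algebra L Ω] [Algebra k[X] Ω]
    [IsScalarTower k[X] L Ω] [IsAlgClosed Ω] [Finite τ] (S : Set (MvPolynomial τ k[X]))
    (hS : {c : k | ∃ s : τ → k, ∀ p ∈ S,
      MvPolynomial.eval s (MvPolynomial.map (evalRingHom c) p) = 0}.Infinite) :
    ∃ s : τ → Ω, (∀ i, IsAlgebraic L (s i)) ∧ ∀ p ∈ S, MvPolynomial.aeval s p = 0 := by
  let K' := algebraicClosure L Ω
  have : IsAlgClosed K' := IsAlgClosure.isAlgClosed L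
  let φ : MvPolynomial τ k[X] →+* MvPolynomial τ L := MvPolynomial.map (algebraMap k[X] L)
  let J : Ideal (MvPolynomial τ L) := (Ideal.span S).map φ
  have hJ : J ≠ ⊤ := by
    intro hJ
    let _ := MvPolynomial.algebraMvPolynomial (σ := τ) (R := k[X]) (S := L)
    have hloc := MvPolynomial.isLocalization (σ := τ) (nonZeroDivisors k[X]) L
    have h1 : (1 : MvPolynomial τ L) ∈ (Ideal.span S).map (algebraMap _ (MvPolynomial τ L)) := by
      have : (Ideal.span S).map (algebraMap _ (MvPolynomial τ L)) = J := rfl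
      rw [this, hJ]
      exact Submodule.mem_top
    rw [IsLocalization.mem_map_algebraMap_iff ((nonZeroDivisors k[X]).map MvPolynomial.C)] at h1
    obtain ⟨⟨⟨a, ha⟩, ⟨_, ⟨d, hd, rfl⟩⟩⟩, h1⟩ := h1
    rw [one_mul] at h1
    have hinj : Function.Injective (algebraMap (MvPolynomial τ k[X]) (MvPolynomial τ L)) :=
      MvPolynomial.map_injective _ (IsFractionRing.injective k[X] L)
    have h2 : MvPolynomial.C d = a := hinj h1
    have hd0 : d ≠ 0 := nonZeroDivisors.ne_zero hd
    refine hS ((d.rootSet_finite k).subset ?_)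
    rintro c ⟨s, hs⟩
    rw [mem_rootSet_of_ne hd0, coe_aeval_eq_eval]
    have h3 : Ideal.span S ≤ RingHom.ker ((MvPolynomial.eval s).comp
        (MvPolynomial.map (σ := τ) (evalRingHom c))) := Ideal.span_le.2 fun p hp => hs p hp
    have h4 := h3 (h2 ▸ ha)
    rw [RingHom.mem_ker] at h4
    simpa using h4
  obtain ⟨s, hs⟩ : (MvPolynomial.zeroLocus K' J).Nonempty := by
    by_contra hcon
    rw [Set.not_nonempty_iff_eq_empty] at hcon
    have := MvPolynomial.vanishingIdeal_zeroLocus_eq_radical (K := K') J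
    rw [hcon, MvPolynomial.vanishingIdeal_empty, eq_comm, Ideal.radical_eq_top] at this
    exact hJ this
  refine ⟨fun i => (s i : Ω), fun i => mem_algebraicClosure_iff.1 (s i).2, fun p hp => ?_⟩
  have h1 := hs (φ p) (Ideal.mem_map_of_mem φ (Ideal.subset_span hp))
  have h2 := congrArg (algebraMap K' Ω) h1
  rw [map_zero] at h2
  rw [← h2, MvPolynomial.aeval_def, MvPolynomial.aeval_def, MvPolynomial.eval₂_map,
    MvPolynomial.hom_eval₂, ← RingHom.comp_assoc, IsScalarTower.algebraMap_eq k[X] L Ω,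
    IsScalarTower.algebraMap_eq L K' Ω]
  rfl

variable {R : Type*} [CommRing R] {ι : Type*}

/-- The substitution `Y ↦ a * Y` in the distinguished variable. -/
def twist (a : R) : MvPolynomial (Option ι) R →ₐ[R] MvPolynomial (Option ι) R :=
  MvPolynomial.aeval fun o => o.elim (MvPolynomial.C a * MvPolynomial.X none)
    fun i => MvPolynomial.X (some i)

theorem map_twist {S : Type*} [CommRing S] (f : R →+* S) (a : R) (Q : MvPolynomial (Option ι) R) :
    MvPolynomial.map f (twist a Q) = twist (f a) (MvPolynomial.map f Q) := by
  induction Q using MvPolynomial.induction_on with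
  | C r => simp [twist, MvPolynomial.algHom_C]
  | add p q hp hq => simp only [map_add, hp, hq]
  | mul_X p o hp =>
    simp only [map_mul, hp, MvPolynomial.map_X]
    congr 1
    cases o <;> simp [twist]

theorem twist_one (Q : MvPolynomial (Option ι) R) : twist 1 Q = Q := by
  have : twist (1 : R) = AlgHom.id R (MvPolynomial (Option ι) R) := by
    ext o
    cases o <;> simp [twist]
  rw [this, AlgHom.id_apply]

/-- `∏ Q(ζ ^ i * Y)` for `i < n`. -/
def twistProd (n : ℕ) (ζ : R) (Q : MvPolynomial (Option ι) R) : MvPolynomial (Option ι) R :=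
  ∏ i ∈ Finset.range n, twist (ζ ^ i) Q

theorem map_twistProd {S : Type*} [CommRing S] (f : R →+* S) (n : ℕ) (ζ : R)
    (Q : MvPolynomial (Option ι) R) :
    MvPolynomial.map f (twistProd n ζ Q) = twistProd n (f ζ) (MvPolynomial.map f Q) := by
  simp only [twistProd, map_prod, map_twist, map_pow]

theorem dvd_twistProd {n : ℕ} (hn : n ≠ 0) (ζ : R) (Q : MvPolynomial (Option ι) R) :
    Q ∣ twistProd n ζ Q := by
  have := Finset.dvd_prod_of_mem (fun i => twist (ζ ^ i) Q)
    (Finset.mem_range.2 (Nat.pos_of_ne_zero hn))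
  rwa [pow_zero, twist_one] at this

theorem map_sub_twistProd {S : Type*} [CommRing S] (f : R →+* S) (n : ℕ) (ζ : R)
    (H : MvPolynomial (Option ι) R) (D : Finset (Option ι →₀ ℕ)) (s : D → S) :
    MvPolynomial.map (MvPolynomial.eval₂Hom f s) (MvPolynomial.map MvPolynomial.C H -
      twistProd n (MvPolynomial.C ζ) (∑ d : D, MvPolynomial.monomial d.1 (MvPolynomial.X d))) =
      MvPolynomial.map f H - twistProd n (f ζ) (∑ d : D, MvPolynomial.monomial d.1 (s d)) := by
  have h1 : (MvPolynomial.eval₂Hom f s).comp MvPolynomial.C = f := by ext; simp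
  simp only [map_sub, map_twistProd, map_sum, MvPolynomial.map_monomial,
    MvPolynomial.map_map, h1, MvPolynomial.eval₂Hom_X', MvPolynomial.eval₂Hom_C]

/-- If infinitely many specializations of `H` are of the form `∏ Q(ζ ^ i * Y)`, then so is `H`, with
`Q` having algebraic coefficients. -/
theorem exists_eq_twistProd {k L Ω : Type*} [Field k] [Field L] [Field Ω]
    [Algebra k[X] L] [IsFractionRing k[X] L] [Algebra L Ω] [Algebra k[X] Ω]
    [IsScalarTower k[X] L Ω] [IsAlgClosed Ω] [Finite ι] {n : ℕ} (hn : n ≠ 0) (ζ : k)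
    (H : MvPolynomial (Option ι) k[X])
    (hH : {c : k | MvPolynomial.map (evalRingHom c) H ≠ 0 ∧
      ∃ Q, MvPolynomial.map (evalRingHom c) H = twistProd n ζ Q}.Infinite) :
    ∃ Q : MvPolynomial (Option ι) Ω, (∀ d, IsAlgebraic L (Q.coeff d)) ∧
      MvPolynomial.map (algebraMap k[X] Ω) H = twistProd n (algebraMap k[X] Ω (C ζ)) Q := by
  classical
  let N := H.totalDegree
  have hfin : {d : Option ι →₀ ℕ | ∀ o, d o ≤ N}.Finite := by
    refine Set.Finite.of_finite_image (f := fun d : Option ι →₀ ℕ => (d : Option ι → ℕ)) ?_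
      DFunLike.coe_injective.injOn
    refine (Set.Finite.pi' fun _ : Option ι => Set.finite_Iic N).subset ?_
    rintro _ ⟨d, hd, rfl⟩
    exact hd
  let D := hfin.toFinset
  let A := MvPolynomial D k[X]
  let Qu : MvPolynomial (Option ι) A := ∑ d : D, MvPolynomial.monomial d.1 (MvPolynomial.X d)
  let E : MvPolynomial (Option ι) A :=
    MvPolynomial.map MvPolynomial.C H - twistProd n (MvPolynomial.C (C ζ)) Qu
  obtain ⟨s, hs, hs'⟩ := exists_algebraic_solution (L := L) (Ω := Ω)
    (S := Set.range fun d => E.coeff d) (by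
      refine hH.mono ?_
      rintro c ⟨hc0, Q, hQ⟩
      refine ⟨fun d => Q.coeff d.1, ?_⟩
      rintro _ ⟨d, rfl⟩
      have h1 : (MvPolynomial.eval fun d : D => Q.coeff d.1).comp
          (MvPolynomial.map (evalRingHom c)) =
          MvPolynomial.eval₂Hom (evalRingHom c) fun d : D => Q.coeff d.1 := by
        ext <;> simp
      have h2 : ∑ d : D, MvPolynomial.monomial d.1 (Q.coeff d.1) = Q := by
        rw [Finset.sum_coe_sort D fun d => MvPolynomial.monomial d (Q.coeff d)]
        conv_rhs => rw [Q.as_sum]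
        refine (Finset.sum_subset (fun d hd => ?_) fun d _ hd => ?_).symm
        · rw [Set.Finite.mem_toFinset]
          intro o
          have h3 : Q ∣ MvPolynomial.map (evalRingHom c) H := hQ ▸ dvd_twistProd hn ζ Q
          refine (Finsupp.le_degree o d).trans ?_
          refine (MvPolynomial.le_totalDegree hd).trans ?_
          refine (MvPolynomial.totalDegree_le_of_dvd_of_isDomain h3 hc0).trans ?_
          exact Finset.sup_mono (MvPolynomial.support_map_subset _ _)
        · rw [MvPolynomial.notMem_support_iff.1 hd, MvPolynomial.monomial_zero]
      change ((MvPolynomial.eval fun d : D => Q.coeff d.1).comp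
          (MvPolynomial.map (evalRingHom c))) _ = 0
      rw [h1, ← MvPolynomial.coeff_map, map_sub_twistProd, h2, coe_evalRingHom, eval_C, hQ,
        sub_self,
        MvPolynomial.coeff_zero])
  refine ⟨∑ d : D, MvPolynomial.monomial d.1 (s d), fun d => ?_, ?_⟩
  · rw [MvPolynomial.coeff_sum, ← mem_algebraicClosure_iff]
    refine sum_mem fun e _ => ?_
    rw [MvPolynomial.coeff_monomial]
    split_ifs
    · exact mem_algebraicClosure_iff.2 (hs e)
    · exact zero_mem _
  · rw [← sub_eq_zero, ← map_sub_twistProd]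
    ext d
    rw [MvPolynomial.coeff_map, MvPolynomial.coeff_zero]
    exact hs' _ ⟨d, rfl⟩

end Transfer

section FactorRoot

open Polynomial

/-- `g(Y ^ ℓ)` splits as `∏ Q(ζ ^ i * Y)` for some polynomial `Q`. -/
def IsTwistProd {A : Type*} [CommRing A] (ℓ : ℕ) (ζ : A) (g : A[X]) : Prop :=
  ∃ Q : A[X], expand A ℓ g = ∏ i ∈ Finset.range ℓ, Q.comp (C (ζ ^ i) * X)

theorem IsTwistProd.mul {A : Type*} [CommRing A] {ℓ : ℕ} {ζ : A} {g h : A[X]}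
    (hg : IsTwistProd ℓ ζ g) (hh : IsTwistProd ℓ ζ h) : IsTwistProd ℓ ζ (g * h) := by
  obtain ⟨Q, hQ⟩ := hg
  obtain ⟨P, hP⟩ := hh
  exact ⟨Q * P, by simp only [map_mul, hQ, hP, mul_comp, Finset.prod_mul_distrib]⟩

theorem prod_charpoly_comp {L n : Type*} [Field L] [Fintype n] [DecidableEq n] (M : Matrix n n L)
    {ℓ : ℕ} (hℓ : 0 < ℓ) {ζ : L} (hζ : IsPrimitiveRoot ζ ℓ) :
    ∃ ε : ℤˣ, expand L ℓ (M ^ ℓ).charpoly =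
      ((ε : ℤ) : L[X]) * ∏ i ∈ Finset.range ℓ, M.charpoly.comp (C (ζ ^ i) * X) := by
  let D : L[X][X] →* L[X] :=
    Matrix.detMonoidHom.comp ((aeval (R := L[X]) (M.map C)) : L[X][X] →* Matrix n n L[X])
  have hD : ∀ p, D p = (aeval (R := L[X]) (M.map C) p).det := fun _ => rfl
  have hcomp : ∀ (N : Matrix n n L) (q : L[X]), N.charpoly.comp q = (q • 1 - N.map C).det := by
    intro N q
    change (compRingHom q) N.charpoly = _
    rw [Matrix.charpoly, RingHom.map_det]
    congr 1
    ext i j : 1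
    by_cases h : i = j <;> simp [h]
  have hneg : ∀ (N : Matrix n n L) (q : L[X]), (N.map C - q • (1 : Matrix n n L[X])).det =
      (-1) ^ Fintype.card n * N.charpoly.comp q := by
    intro N q
    rw [hcomp, ← Matrix.det_neg, neg_sub]
  have hζ' : IsPrimitiveRoot (C ζ : L[X]) ℓ := hζ.map_of_injective C_injective
  have key := congrArg D (X_pow_sub_C_eq_prod hζ' hℓ (rfl : (X : L[X]) ^ ℓ = X ^ ℓ))
  rw [map_prod] at key
  have h1 : D (X ^ ℓ - C (X ^ ℓ)) = (-1) ^ Fintype.card n * expand L ℓ (M ^ ℓ).charpoly := by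
    rw [hD, map_sub, map_pow, aeval_X, aeval_C, Algebra.algebraMap_eq_smul_one,
      expand_eq_comp_X_pow, ← hneg, Matrix.map_pow]
  have h2 : ∀ i, D (X - C (C ζ ^ i * X)) =
      (-1) ^ Fintype.card n * M.charpoly.comp (C (ζ ^ i) * X) := by
    intro i
    rw [hD, map_sub, aeval_X, aeval_C, Algebra.algebraMap_eq_smul_one, ← hneg, C_pow]
  simp only [h1, h2] at key
  rw [Finset.prod_mul_distrib] at key
  refine ⟨(-1) ^ Fintype.card n * ((-1) ^ Fintype.card n) ^ ℓ, ?_⟩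
  have h3 : ((-1 : L[X]) ^ Fintype.card n) * (-1) ^ Fintype.card n = 1 := by
    rw [← mul_pow]; simp
  calc _ = ((-1 : L[X]) ^ Fintype.card n * (-1) ^ Fintype.card n) *
        expand L ℓ (M ^ ℓ).charpoly := by rw [h3, one_mul]
    _ = _ := by
      rw [mul_assoc, key]
      push_cast
      rw [Finset.prod_const, Finset.card_range]
      ring

variable {k A : Type*} [Field k] [IsAlgClosed k] [CommRing A] [Algebra k A] [IsDomain A]

/-- If the root of a monic irreducible polynomial `g` is an `ℓ`-th power in the extension it
generates, then `g(Y ^ ℓ)` is of the form `∏ Q(ζ ^ i * Y)`. -/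
theorem isTwistProd_of_root_eq_pow [IsIntegrallyClosed A] {L : Type*} [Field L] [Algebra A L]
    [IsFractionRing A L] {ℓ : ℕ} (hℓ : 0 < ℓ) {ζ : k} (hζ : IsPrimitiveRoot ζ ℓ) {g : A[X]}
    (hg : g.Monic) (hirr : Irreducible (g.map (algebraMap A L)))
    {η : AdjoinRoot (g.map (algebraMap A L))}
    (hη : η ^ ℓ = AdjoinRoot.root (g.map (algebraMap A L))) :
    IsTwistProd ℓ (algebraMap k A ζ) g := by
  classical
  let pb := AdjoinRoot.powerBasis hirr.ne_zero
  let M := Algebra.leftMulMatrix pb.basis η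
  have hinj : Function.Injective (algebraMap A L) := IsFractionRing.injective A L
  have hMℓ : (M ^ ℓ).charpoly = g.map (algebraMap A L) := by
    have h1 := charpoly_leftMulMatrix pb
    rw [AdjoinRoot.powerBasis_gen, AdjoinRoot.minpoly_root hirr.ne_zero,
      (hg.map _).leadingCoeff, inv_one, C_1, mul_one] at h1
    have h2 : Algebra.leftMulMatrix pb.basis (AdjoinRoot.root (g.map (algebraMap A L))) =
        M ^ ℓ := by
      rw [← hη, map_pow]
    rwa [h2] at h1
  have hζL : IsPrimitiveRoot (algebraMap A L (algebraMap k A ζ)) ℓ :=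
    (hζ.map_of_injective (algebraMap k A).injective).map_of_injective hinj
  obtain ⟨ε, hε⟩ := prod_charpoly_comp M hℓ hζL
  rw [hMℓ, ← map_expand] at hε
  have hdvd : M.charpoly ∣ (expand A ℓ g).map (algebraMap A L) := by
    rw [hε]
    refine Dvd.dvd.mul_left ?_ _
    have := Finset.dvd_prod_of_mem
      (fun i => M.charpoly.comp (C ((algebraMap A L (algebraMap k A ζ)) ^ i) * X))
      (Finset.mem_range.2 hℓ)
    simpa using this
  obtain ⟨Q, hQ⟩ := IsIntegrallyClosed.eq_map_mul_C_of_dvd L (hg.expand hℓ) hdvd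
  rw [(Matrix.charpoly_monic M).leadingCoeff, C_1, mul_one] at hQ
  have h2 : expand A ℓ g = ((ε : ℤ) : A[X]) *
      ∏ i ∈ Finset.range ℓ, Q.comp (C (algebraMap k A ζ ^ i) * X) := by
    apply map_injective _ hinj
    rw [hε, ← hQ, Polynomial.map_mul, Polynomial.map_prod, Polynomial.map_intCast]
    simp [map_comp]
  obtain ⟨c, hc⟩ := IsAlgClosed.exists_pow_nat_eq ((ε : ℤ) : k) hℓ
  refine ⟨C (algebraMap k A c) * Q, ?_⟩
  simp only [mul_comp, C_comp, Finset.prod_mul_distrib, Finset.prod_const, Finset.card_range]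
  rw [h2, ← C_pow, ← map_pow, hc]
  simp

theorem exists_monic_irreducible_dvd {A : Type*} [CommRing A] [IsDomain A]
    [UniqueFactorizationMonoid A] {G : A[X]} (hG : G.Monic)
    (hu : ¬ IsUnit G) : ∃ g : A[X], g.Monic ∧ Irreducible g ∧ g ∣ G := by
  obtain ⟨p, hp, hpG⟩ := WfDvdMonoid.exists_irreducible_factor hu hG.ne_zero
  obtain ⟨u, hu'⟩ := isUnit_of_dvd_one
    (hG.leadingCoeff ▸ leadingCoeff_dvd_leadingCoeff hpG : p.leadingCoeff ∣ 1)
  have hgass : Associated (C ((u⁻¹ : Aˣ) : A) * p) p :=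
    associated_unit_mul_left p _ (isUnit_C.2 (Units.isUnit _))
  refine ⟨_, ?_, hgass.symm.irreducible hp, hgass.dvd.trans hpG⟩
  rw [Monic, leadingCoeff_mul, leadingCoeff_C, ← hu', Units.inv_mul]

theorem isTwistProd_of_forall_factor {A : Type*} [CommRing A] [IsDomain A]
    [UniqueFactorizationMonoid A] {ℓ : ℕ} (ζ : A) :
    ∀ G : A[X], G.Monic → (∀ g : A[X], g.Monic → Irreducible g → g ∣ G → IsTwistProd ℓ ζ g) →
      IsTwistProd ℓ ζ G := by
  intro G
  induction hn : G.natDegree using Nat.strong_induction_on generalizing G with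
  | _ n ih =>
    intro hG h
    by_cases hu : IsUnit G
    · rw [hG.isUnit_iff.1 hu]
      exact ⟨1, by simp⟩
    · obtain ⟨g, hgm, hgirr, hgG⟩ := exists_monic_irreducible_dvd hG hu
      obtain ⟨q, rfl⟩ := id hgG
      have hq : q.Monic := hgm.of_mul_monic_left hG
      refine (h g hgm hgirr hgG).mul (ih q.natDegree ?_ q rfl hq fun r hr hr' hrq =>
        h r hr hr' (hrq.mul_left g))
      rw [← hn, hgm.natDegree_mul hq]
      have : 0 < g.natDegree := hgm.natDegree_pos_of_not_isUnit hgirr.not_isUnit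
      omega

end FactorRoot

section Specialization

open Polynomial

variable {A A₀ L K : Type*} [CommRing A] [IsNoetherianRing A] [CommRing A₀]
  [Field L] [Algebra A₀ L] [FaithfulSMul A₀ L] [Field K]

theorem C_dvd_of_map_eq_zero {A A₀ : Type*} [CommRing A] [CommRing A₀] {ρ : A →+* A₀} {τ : A}
    (hker : ∀ a, ρ a = 0 → τ ∣ a) {p : A[X]} (hp : p.map ρ = 0) : C τ ∣ p := by
  rw [C_dvd_iff_dvd_coeff]
  intro i
  apply hker
  rw [← coeff_map, hp, coeff_zero]

/-- The valuation of `Frac(A[X]/(G))` attached to a simple irreducible factor `g` of the reduction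
of `G` modulo a principal prime `τ`. -/
theorem exists_tameDatum_of_factor {G : A[X]} [IsDomain (AdjoinRoot G)]
    [Algebra (AdjoinRoot G) K] [IsFractionRing (AdjoinRoot G) K] {ρ : A →+* A₀}
    (hρ : Function.Surjective ρ) {τ : A} (hτ0 : AdjoinRoot.of G τ ≠ 0) (hτ : ρ τ = 0)
    (hker : ∀ a, ρ a = 0 → τ ∣ a) {g h : A₀[X]} (hg : g.Monic) (hGgh : G.map ρ = g * h)
    [Fact (Irreducible (g.map (algebraMap A₀ L)))]
    (hgh : ¬ g.map (algebraMap A₀ L) ∣ h.map (algebraMap A₀ L))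
    (hg0 : g.coeff 0 ≠ 0) :
    ∃ T : TameDatum K (AdjoinRoot (g.map (algebraMap A₀ L))),
      (∀ x : Kˣ, (x : K) = algebraMap (AdjoinRoot G) K (AdjoinRoot.of G τ) →
        T.v x = 1 ∧ T.s x = 1) ∧
      ∀ x : Kˣ, (x : K) = algebraMap (AdjoinRoot G) K (AdjoinRoot.root G) →
        T.v x = 0 ∧ (T.s x : AdjoinRoot (g.map (algebraMap A₀ L))) = AdjoinRoot.root _ := by
  have hinj := FaithfulSMul.algebraMap_injective A₀ L
  have hev : ∀ p : A[X], p.eval₂ ((AdjoinRoot.of (g.map (algebraMap A₀ L))).comp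
      ((algebraMap A₀ L).comp ρ)) (AdjoinRoot.root _) =
      AdjoinRoot.mk _ ((p.map ρ).map (algebraMap A₀ L)) := by
    intro p
    rw [← eval₂_map, ← AdjoinRoot.aeval_eq, aeval_def, Polynomial.map_map]
    rfl
  let φ : AdjoinRoot G →+* AdjoinRoot (g.map (algebraMap A₀ L)) :=
    AdjoinRoot.lift ((AdjoinRoot.of _).comp ((algebraMap A₀ L).comp ρ)) (AdjoinRoot.root _) (by
      rw [hev, hGgh, Polynomial.map_mul, map_mul, AdjoinRoot.mk_self, zero_mul])
  have hφ : ∀ p, φ (AdjoinRoot.mk G p) = AdjoinRoot.mk _ ((p.map ρ).map (algebraMap A₀ L)) := by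
    intro p
    rw [← hev]
    exact AdjoinRoot.lift_mk _ _
  obtain ⟨h', hh'⟩ := map_surjective ρ hρ h
  obtain ⟨T, hT1, hT2⟩ := exists_tameDatum (K := K) φ (π := AdjoinRoot.of G τ)
    (h := AdjoinRoot.mk G h') hτ0 (by
      rw [← AdjoinRoot.mk_C, hφ, map_C, hτ, C_0, Polynomial.map_zero, map_zero]) (by
      rw [hφ, hh', Ne, AdjoinRoot.mk_eq_zero]
      exact hgh) (by
      intro f hf
      obtain ⟨p, rfl⟩ := AdjoinRoot.mk_surjective f
      rw [hφ, AdjoinRoot.mk_eq_zero, map_dvd_map _ hinj hg] at hf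
      obtain ⟨e, he⟩ := hf
      obtain ⟨e', rfl⟩ := map_surjective ρ hρ e
      obtain ⟨r, hr⟩ := C_dvd_of_map_eq_zero hker (p := h' * p - G * e') (by
        rw [Polynomial.map_sub, Polynomial.map_mul, Polynomial.map_mul, hh', he, hGgh]
        ring)
      refine ⟨AdjoinRoot.mk G r, ?_⟩
      rw [← AdjoinRoot.mk_C, ← map_mul, ← map_mul, ← hr, map_sub, map_mul (AdjoinRoot.mk G) G,
        AdjoinRoot.mk_self, zero_mul, sub_zero])
  refine ⟨T, hT1, fun x hx => ?_⟩
  have hr : φ (AdjoinRoot.root G) = AdjoinRoot.root _ := by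
    rw [← AdjoinRoot.mk_X, hφ, map_X, map_X, AdjoinRoot.mk_X]
  rw [← hr]
  refine hT2 _ x ?_ hx
  rw [hr]
  intro h0
  rw [← AdjoinRoot.mk_X, AdjoinRoot.mk_eq_zero] at h0
  have hirr : Irreducible (g.map (algebraMap A₀ L)) := Fact.out
  have hX := hirr.dvd_symm irreducible_X h0
  rw [X_dvd_iff, coeff_map, map_eq_zero_iff _ hinj] at hX
  exact hg0 hX

/-- A factor of the separable reduction of `G`, and the corresponding valuation. -/
theorem exists_tameDatum_of_dvd {G : A[X]} [IsDomain (AdjoinRoot G)]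
    [Algebra (AdjoinRoot G) K] [IsFractionRing (AdjoinRoot G) K] {ρ : A →+* A₀}
    (hρ : Function.Surjective ρ) {τ : A} (hτ0 : AdjoinRoot.of G τ ≠ 0) (hτ : ρ τ = 0)
    (hker : ∀ a, ρ a = 0 → τ ∣ a) {U V : A[X]} {d : A} (hd : U * G + V * derivative G = C d)
    (hρd : ρ d ≠ 0) (hG0 : ρ (G.coeff 0) ≠ 0) {g : A₀[X]} (hg : g.Monic) (hgG : g ∣ G.map ρ)
    [Fact (Irreducible (g.map (algebraMap A₀ L)))] :
    ∃ T : TameDatum K (AdjoinRoot (g.map (algebraMap A₀ L))),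
      (∀ x : Kˣ, (x : K) = algebraMap (AdjoinRoot G) K (AdjoinRoot.of G τ) →
        T.v x = 1 ∧ T.s x = 1) ∧
      ∀ x : Kˣ, (x : K) = algebraMap (AdjoinRoot G) K (AdjoinRoot.root G) →
        T.v x = 0 ∧ (T.s x : AdjoinRoot (g.map (algebraMap A₀ L))) = AdjoinRoot.root _ := by
  have hinj := FaithfulSMul.algebraMap_injective A₀ L
  have hirr : Irreducible (g.map (algebraMap A₀ L)) := Fact.out
  obtain ⟨h, hGgh⟩ := hgG
  refine exists_tameDatum_of_factor hρ hτ0 hτ hker hg hGgh (fun hgh => ?_) fun h0 => hG0 ?_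
  · have h1 := congrArg (fun p : A[X] => (p.map ρ).map (algebraMap A₀ L)) hd
    simp only [Polynomial.map_add, Polynomial.map_mul, map_C, ← derivative_map, hGgh,
      derivative_mul] at h1
    have h2 : g.map (algebraMap A₀ L) ∣ C (algebraMap A₀ L (ρ d)) := by
      rw [← h1]
      exact dvd_add (Dvd.dvd.mul_left (Dvd.intro _ rfl) _)
        (Dvd.dvd.mul_left (dvd_add (hgh.mul_left _) (Dvd.intro _ rfl)) _)
    exact hirr.not_isUnit (isUnit_of_dvd_unit h2
      (isUnit_C.2 ((map_ne_zero_iff _ hinj).2 hρd).isUnit))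
  · rw [← coeff_map, hGgh, mul_coeff_zero, h0, zero_mul]

theorem isTwistProd_map_of_sym_eq_zero {k A₀ : Type*} [Field k] [IsAlgClosed k] [CommRing A₀]
    [IsDomain A₀] [UniqueFactorizationMonoid A₀] [Algebra k A₀] {ℓ : ℕ} (hℓ : 0 < ℓ) {ζ : k}
    (hζ : IsPrimitiveRoot ζ ℓ) {G : A[X]} (hG : G.Monic) [IsDomain (AdjoinRoot G)]
    [Algebra (AdjoinRoot G) K] [IsFractionRing (AdjoinRoot G) K] {ρ : A →+* A₀}
    (hρ : Function.Surjective ρ) {τ : A} (hτ : ρ τ = 0)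
    (hker : ∀ a, ρ a = 0 → τ ∣ a) {U V : A[X]} {d : A} (hd : U * G + V * derivative G = C d)
    (hρd : ρ d ≠ 0) (hG0 : ρ (G.coeff 0) ≠ 0) (x z : Kˣ)
    (hx : (x : K) = algebraMap (AdjoinRoot G) K (AdjoinRoot.of G τ))
    (hz : (z : K) = algebraMap (AdjoinRoot G) K (AdjoinRoot.root G))
    (hxz : MilnorK2.sym ℓ x z = 0) :
    IsTwistProd ℓ (algebraMap k A₀ ζ) (G.map ρ) := by
  refine isTwistProd_of_forall_factor _ _ (hG.map ρ) fun g hg hirr hgG => ?_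
  have hirr' : Irreducible (g.map (algebraMap A₀ (FractionRing A₀))) :=
    (hg.irreducible_iff_irreducible_map_fraction_map).1 hirr
  have : Fact (Irreducible (g.map (algebraMap A₀ (FractionRing A₀)))) := ⟨hirr'⟩
  obtain ⟨T, hT1, hT2⟩ := exists_tameDatum_of_dvd (K := K) (L := FractionRing A₀) hρ
    (τ := τ) (fun h => x.ne_zero (by rw [hx, h, map_zero])) hτ hker hd hρd hG0 hg hgG
  obtain ⟨D, hD⟩ := T.exists_tame (ℓ := ℓ)
    (exists_unit_pow_eq_neg_one k hℓ.ne')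
  have h1 := hD x z
  rw [hxz, map_zero, (hT2 z hz).1, zero_smul, zero_sub, (hT1 x hx).1, one_smul, eq_comm,
    neg_eq_zero, unitsMod_eq_zero] at h1
  obtain ⟨η, hη⟩ := h1
  refine isTwistProd_of_root_eq_pow (L := FractionRing A₀) hℓ hζ hg hirr' (η := (η : _)) ?_
  rw [← (hT2 z hz).2, ← hη, Units.val_pow_eq_pow_val]

/-- If `τ` generates the kernel of `ρ`, and the reduction of `G` by `ρ` is separable, then `τ` is
not a proper power in `Frac(A[X]/(G))`. -/
theorem not_exists_pow_eq {A₀ : Type*} [CommRing A₀]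
    [IsDomain A₀] [UniqueFactorizationMonoid A₀] {ℓ : ℕ} (hℓ : 1 < ℓ)
    {G : A[X]} (hG : G.Monic) (hG1 : G ≠ 1) [IsDomain (AdjoinRoot G)]
    [Algebra (AdjoinRoot G) K] [IsFractionRing (AdjoinRoot G) K] {ρ : A →+* A₀}
    (hρ : Function.Surjective ρ) {τ : A} (hτ : ρ τ = 0)
    (hker : ∀ a, ρ a = 0 → τ ∣ a) {U V : A[X]} {d : A} (hd : U * G + V * derivative G = C d)
    (hρd : ρ d ≠ 0) (hG0 : ρ (G.coeff 0) ≠ 0) (x : Kˣ)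
    (hx : (x : K) = algebraMap (AdjoinRoot G) K (AdjoinRoot.of G τ)) :
    ¬ ∃ u : Kˣ, u ^ ℓ = x := by
  by_contra! hpow
  obtain ⟨u, rfl⟩ := hpow
  obtain ⟨g, hg, hirr, hgG⟩ := exists_monic_irreducible_dvd (hG.map ρ) (by
    rw [(hG.map ρ).isUnit_iff, ← (hG.map ρ).natDegree_eq_zero, hG.natDegree_map,
      hG.natDegree_eq_zero]
    exact hG1)
  have : Fact (Irreducible (g.map (algebraMap A₀ (FractionRing A₀)))) :=
    ⟨(hg.irreducible_iff_irreducible_map_fraction_map).1 hirr⟩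
  obtain ⟨T, hT1, -⟩ := exists_tameDatum_of_dvd (K := K) (L := FractionRing A₀) hρ
    (τ := τ) (fun h => (u ^ ℓ).ne_zero (by rw [hx, h, map_zero])) hτ hker hd hρd hG0 hg hgG
  have h1 := (hT1 _ hx).1
  have h2 : ∀ n : ℕ, T.v (u ^ n) = n * T.v u := by
    intro n
    induction n with
    | zero =>
      have := T.v_mul 1 1
      rw [mul_one] at this
      simpa using this
    | succ n ih =>
      rw [pow_succ, T.v_mul, ih]
      push_cast
      ring
  rw [h2] at h1
  have := Int.isUnit_iff_natAbs_eq.1 (IsUnit.of_mul_eq_one _ h1)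
  rw [Int.natAbs_natCast] at this
  omega

end Specialization

section IntegralGenerator

open Polynomial IntermediateField

variable {A L K : Type*} [CommRing A] [IsDomain A] [Field L] [Field K] [Algebra A L]
  [IsFractionRing A L] [Algebra A K] [Algebra L K] [IsScalarTower A L K]

/-- Every class modulo `n`-th powers contains a primitive element of `K / L`. -/
theorem exists_adjoin_mul_pow_eq_top (L : Type*) [Field L] [Algebra L K] [Infinite L]
    [FiniteDimensional L K] [Algebra.IsSeparable L K] {n : ℕ} (hn : n ≠ 0) {z : K} (hz : z ≠ 0) :
    ∃ u : K, u ≠ 0 ∧ L⟮z * u ^ n⟯ = ⊤ := by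
  classical
  obtain ⟨w, hw⟩ := Field.exists_primitive_element L K
  let E := AlgebraicClosure K
  let φ : K →ₐ[L] E := IsScalarTower.toAlgHom L K E
  have hsplit : ∀ x : K, ((minpoly L x).map (algebraMap L E)).Splits :=
    fun x => IsAlgClosed.splits _
  let P : (K →ₐ[L] E) → E[X] := fun ψ =>
    C (φ z) * (X + C (φ w)) ^ n - C (ψ z) * (X + C (ψ w)) ^ n
  have hP : ∀ ψ, φ ≠ ψ → P ψ ≠ 0 := by
    intro ψ hψ h0
    have hlc : ∀ a b : E, (C a * (X + C b) ^ n).leadingCoeff = a := by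
      intro a b
      rw [leadingCoeff_mul, leadingCoeff_C, ((monic_X_add_C b).pow n).leadingCoeff, mul_one]
    have h1 : φ z = ψ z := by
      have := congrArg leadingCoeff (sub_eq_zero.1 h0)
      rwa [hlc, hlc] at this
    have h2 := congrArg (eval (-φ w)) h0
    simp only [P, ← h1, eval_sub, eval_mul, eval_C, eval_pow, eval_add, eval_X, eval_zero,
      neg_add_cancel, zero_pow hn, mul_zero, zero_sub, neg_eq_zero, mul_eq_zero, pow_eq_zero_iff hn,
      map_eq_zero, hz, false_or] at h2
    exact hψ ((Field.primitive_element_iff_algHom_eq_of_eval L E hsplit w φ).1 hw ψ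
      (by linear_combination -h2))
  let B : E[X] := (X + C (φ w)) * ∏ ψ ∈ Finset.univ.erase φ, P ψ
  have hB : B ≠ 0 := mul_ne_zero (monic_X_add_C _).ne_zero
    (Finset.prod_ne_zero_iff.2 fun ψ hψ => hP ψ (Finset.ne_of_mem_erase hψ).symm)
  obtain ⟨s, hs⟩ : ∃ s : L, B.eval (algebraMap L E s) ≠ 0 := by
    by_contra! h
    refine hB (eq_zero_of_infinite_isRoot B
      ((Set.infinite_range_of_injective (algebraMap L E).injective).mono ?_))
    rintro _ ⟨s, rfl⟩
    exact h s
  rw [eval_mul, eval_prod, mul_ne_zero_iff, Finset.prod_ne_zero_iff] at hs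
  refine ⟨algebraMap L K s + w, fun h0 => hs.1 ?_, ?_⟩
  · rw [eval_add, eval_X, eval_C, ← φ.commutes s, ← map_add, h0, map_zero]
  · refine (Field.primitive_element_iff_algHom_eq_of_eval L E hsplit _ φ).2 fun ψ hψ => ?_
    by_contra hne
    refine hs.2 ψ (Finset.mem_erase.2 ⟨Ne.symm hne, Finset.mem_univ _⟩) ?_
    simp only [map_mul, map_pow, map_add, AlgHom.commutes] at hψ
    simp [P, hψ]

theorem exists_isIntegral_adjoin_mul_pow_eq_top [Infinite L] [FiniteDimensional L K]
    [Algebra.IsSeparable L K] {n : ℕ} (hn : n ≠ 0) {z : K} (hz : z ≠ 0) :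
    ∃ u : K, u ≠ 0 ∧ IsIntegral A (z * u ^ n) ∧ L⟮z * u ^ n⟯ = ⊤ := by
  obtain ⟨u, hu, htop⟩ := exists_adjoin_mul_pow_eq_top L hn hz
  have halg : IsAlgebraic A (z * u ^ n) :=
    (IsFractionRing.isAlgebraic_iff A L K).2 (Algebra.IsAlgebraic.isAlgebraic _)
  obtain ⟨d, hd, hInt⟩ := halg.exists_integral_multiple
  have hdL : algebraMap A L d ≠ 0 := by simpa using hd
  have hdK : algebraMap A K d ≠ 0 := by
    rw [IsScalarTower.algebraMap_apply A L K]
    simpa using hd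
  refine ⟨u * algebraMap A K d, mul_ne_zero hu hdK, ?_, ?_⟩
  · have : z * (u * algebraMap A K d) ^ n = algebraMap A K (d ^ (n - 1)) * (d • (z * u ^ n)) := by
      obtain ⟨m, rfl⟩ := Nat.exists_eq_succ_of_ne_zero hn
      rw [Algebra.smul_def, map_pow, Nat.succ_sub_one, mul_pow, Nat.succ_eq_add_one,
        pow_succ (_ : K) m,
        pow_succ (algebraMap A K d) m]
      ring
    rw [this]
    exact isIntegral_algebraMap.mul hInt
  · rw [← htop]
    have : z * (u * algebraMap A K d) ^ n =
        algebraMap L K (algebraMap A L d ^ n) * (z * u ^ n) := by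
      rw [map_pow, ← IsScalarTower.algebraMap_apply]
      ring
    rw [this]
    refine le_antisymm (adjoin_simple_le_iff.2 (mul_mem (IntermediateField.algebraMap_mem _ _)
      (mem_adjoin_simple_self _ _))) (adjoin_simple_le_iff.2 ?_)
    have h1 : z * u ^ n = algebraMap L K (algebraMap A L d ^ n)⁻¹ *
        (algebraMap L K (algebraMap A L d ^ n) * (z * u ^ n)) := by
      rw [← mul_assoc, ← map_mul, inv_mul_cancel₀ (pow_ne_zero _ hdL), map_one, one_mul]
    have h2 := mul_mem (IntermediateField.algebraMap_mem _ (algebraMap A L d ^ n)⁻¹)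
      (mem_adjoin_simple_self L (algebraMap L K (algebraMap A L d ^ n) * (z * u ^ n)))
    rwa [← h1] at h2

theorem exists_map_eq_C_mul (p : L[X]) :
    ∃ (b : A) (q : A[X]), b ≠ 0 ∧ q.map (algebraMap A L) = C (algebraMap A L b) * p := by
  obtain ⟨b, hb0, hb⟩ := IsLocalization.integerNormalization_spec (nonZeroDivisors A) p
  refine ⟨b, _, nonZeroDivisors.ne_zero hb0, hb.trans ?_⟩
  rw [← smul_eq_C_mul, algebraMap_smul]

theorem exists_bezout_derivative [IsIntegrallyClosed A] [Algebra.IsSeparable L K] {w : K}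
    (hw : IsIntegral A w) : ∃ (U V : A[X]) (d : A), d ≠ 0 ∧
      U * minpoly A w + V * derivative (minpoly A w) = C d := by
  have hsep : (minpoly L w).Separable := Algebra.IsSeparable.isSeparable L w
  obtain ⟨u, v, huv⟩ := hsep
  obtain ⟨b, U, hb, hU⟩ := exists_map_eq_C_mul (A := A) u
  obtain ⟨c, V, hc, hV⟩ := exists_map_eq_C_mul (A := A) v
  refine ⟨C c * U, C b * V, b * c, mul_ne_zero hb hc, ?_⟩
  apply map_injective _ (IsFractionRing.injective A L)
  simp only [Polynomial.map_add, Polynomial.map_mul, map_C, ← derivative_map, hU, hV,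
    ← minpoly.isIntegrallyClosed_eq_field_fractions L K hw, map_mul]
  linear_combination (C (algebraMap A L b) * C (algebraMap A L c)) * huv

theorem exists_algebra_adjoinRoot [IsIntegrallyClosed A] [FaithfulSMul A K] {w : K}
    (hw : IsIntegral A w) (htop : L⟮w⟯ = ⊤) :
    ∃ _ : Algebra (AdjoinRoot (minpoly A w)) K, IsFractionRing (AdjoinRoot (minpoly A w)) K ∧
      (∀ a, algebraMap (AdjoinRoot (minpoly A w)) K (AdjoinRoot.of _ a) = algebraMap A K a) ∧
      algebraMap (AdjoinRoot (minpoly A w)) K (AdjoinRoot.root _) = w := by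
  let j : AdjoinRoot (minpoly A w) →+* K :=
    AdjoinRoot.lift (algebraMap A K) w (minpoly.aeval A w)
  have hj : ∀ p, j (AdjoinRoot.mk _ p) = aeval w p := fun p => AdjoinRoot.lift_mk _ p
  have hinj : Function.Injective j := by
    rw [injective_iff_map_eq_zero]
    intro f hf
    obtain ⟨p, rfl⟩ := AdjoinRoot.mk_surjective f
    rw [hj] at hf
    exact AdjoinRoot.mk_eq_zero.2 (minpoly.isIntegrallyClosed_dvd hw hf)
  refine ⟨j.toAlgebra, ?_, fun a => AdjoinRoot.lift_of _, AdjoinRoot.lift_root _⟩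
  let := j.toAlgebra
  have : FaithfulSMul (AdjoinRoot (minpoly A w)) K :=
    (faithfulSMul_iff_algebraMap_injective _ _).2 hinj
  refine IsFractionRing.of_field _ _ fun x => ?_
  obtain ⟨p, q, rfl⟩ := (mem_adjoin_simple_iff L x).1 (htop ▸ mem_top : x ∈ L⟮w⟯)
  obtain ⟨b, P, hb, hP⟩ := exists_map_eq_C_mul (A := A) p
  obtain ⟨c, Q, hc, hQ⟩ := exists_map_eq_C_mul (A := A) q
  refine ⟨AdjoinRoot.mk _ (C c * P), AdjoinRoot.mk _ (C b * Q), ?_⟩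
  change _ = j _ / j _
  have hb' : algebraMap A K b ≠ 0 := by simpa using hb
  have hc' : algebraMap A K c ≠ 0 := by simpa using hc
  have h : ∀ (b : A) (P : A[X]) (p : L[X]), P.map (algebraMap A L) = C (algebraMap A L b) * p →
      aeval w P = algebraMap A K b * aeval w p := by
    intro b P p h
    rw [← aeval_map_algebraMap L w P, h, map_mul, aeval_C, ← IsScalarTower.algebraMap_apply]
  rw [hj, hj, map_mul, map_mul, aeval_C, aeval_C, h b P p hP, h c Q q hQ]
  rw [mul_left_comm (algebraMap A K b), mul_div_mul_left _ _ hc', mul_div_mul_left _ _ hb']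

/-- Up to `n`-th powers, every element of `K` is the class of `X` under an isomorphism
`K ≃ Frac(A[X]/(G))` with `G` monic and separable over `Frac A`. -/
theorem exists_isFractionRing_adjoinRoot (L : Type*) [Field L] [Algebra A L] [IsFractionRing A L]
    [Algebra L K] [IsScalarTower A L K] [IsIntegrallyClosed A] [Infinite L]
    [FiniteDimensional L K] [Algebra.IsSeparable L K] {n : ℕ} (hn : n ≠ 0) {z : K} (hz : z ≠ 0) :
    ∃ (u : K) (G : A[X]), u ≠ 0 ∧ G.Monic ∧ G.coeff 0 ≠ 0 ∧ aeval (z * u ^ n) G = 0 ∧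
      (∃ (U V : A[X]) (d : A), d ≠ 0 ∧ U * G + V * derivative G = C d) ∧
      IsDomain (AdjoinRoot G) ∧
      ∃ _ : Algebra (AdjoinRoot G) K, IsFractionRing (AdjoinRoot G) K ∧
        (∀ a, algebraMap (AdjoinRoot G) K (AdjoinRoot.of _ a) = algebraMap A K a) ∧
        algebraMap (AdjoinRoot G) K (AdjoinRoot.root _) = z * u ^ n := by
  have : FaithfulSMul A K := by
    rw [faithfulSMul_iff_algebraMap_injective, IsScalarTower.algebraMap_eq A L K]
    exact (algebraMap L K).injective.comp (IsFractionRing.injective A L)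
  obtain ⟨u, hu, hw, htop⟩ := exists_isIntegral_adjoin_mul_pow_eq_top (A := A) (L := L) hn hz
  refine ⟨u, minpoly A (z * u ^ n), hu, minpoly.monic hw, fun h => ?_, minpoly.aeval _ _,
    exists_bezout_derivative (L := L) hw,
    AdjoinRoot.isDomain_of_prime (minpoly.prime_of_isIntegrallyClosed hw),
    exists_algebra_adjoinRoot hw htop⟩
  refine minpoly.coeff_zero_ne_zero (A := L) (hw.tower_top) (mul_ne_zero hz (pow_ne_zero n hu)) ?_
  rw [minpoly.isIntegrallyClosed_eq_field_fractions' L hw, coeff_map, h, map_zero]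

end IntegralGenerator

section TwistTranslation

open Polynomial

variable {ι R S : Type*} [CommRing R] [CommRing S]

theorem optionEquivLeft_twist (a : R) (Q : MvPolynomial (Option ι) R) :
    MvPolynomial.optionEquivLeft R ι (twist a Q) =
      (MvPolynomial.optionEquivLeft R ι Q).comp (C (MvPolynomial.C a) * X) := by
  induction Q using MvPolynomial.induction_on with
  | C r => simp [twist, MvPolynomial.algHom_C, MvPolynomial.optionEquivLeft_C]
  | add p q hp hq => simp only [map_add, hp, hq, add_comp]
  | mul_X p o hp =>
    rw [map_mul, map_mul, hp, map_mul, mul_comp]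
    refine congrArg _ ?_
    cases o <;> simp [twist, MvPolynomial.optionEquivLeft_X_none,
      MvPolynomial.optionEquivLeft_X_some, MvPolynomial.optionEquivLeft_C]

theorem optionEquivLeft_map (f : R →+* S) (Q : MvPolynomial (Option ι) R) :
    MvPolynomial.optionEquivLeft S ι (MvPolynomial.map f Q) =
      (MvPolynomial.optionEquivLeft R ι Q).map (MvPolynomial.map f) := by
  induction Q using MvPolynomial.induction_on with
  | C r => simp [MvPolynomial.optionEquivLeft_C]
  | add p q hp hq => simp only [map_add, hp, hq, Polynomial.map_add]
  | mul_X p o hp =>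
    simp only [map_mul, hp, Polynomial.map_mul]
    congr 1
    cases o <;> simp [MvPolynomial.optionEquivLeft_X_none, MvPolynomial.optionEquivLeft_X_some]

theorem IsTwistProd.exists_eq_twistProd {n : ℕ} {ζ : R} {g : (MvPolynomial ι R)[X]}
    (h : IsTwistProd n (MvPolynomial.C ζ) g) :
    ∃ Q, (MvPolynomial.optionEquivLeft R ι).symm (expand _ n g) = twistProd n ζ Q := by
  obtain ⟨Q, hQ⟩ := h
  refine ⟨(MvPolynomial.optionEquivLeft R ι).symm Q, ?_⟩
  rw [AlgEquiv.symm_apply_eq, hQ, twistProd, map_prod]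
  refine Finset.prod_congr rfl fun i _ => ?_
  rw [optionEquivLeft_twist, AlgEquiv.apply_symm_apply, MvPolynomial.C_pow]

theorem finite_setOf_map_evalRingHom_eq_zero {k : Type*} [Field k] {a : MvPolynomial ι k[X]}
    (ha : a ≠ 0) : {c : k | MvPolynomial.map (evalRingHom c) a = 0}.Finite := by
  classical
  obtain ⟨m, hm⟩ := MvPolynomial.ne_zero_iff.1 ha
  refine (a.coeff m).roots.toFinset.finite_toSet.subset fun c hc => ?_
  have := congrArg (MvPolynomial.coeff m) (Set.mem_ofPred.1 hc)
  rw [MvPolynomial.coeff_map, MvPolynomial.coeff_zero] at this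
  simpa [hm] using this

theorem C_X_sub_C_dvd {k : Type*} [Field k] (c : k) (a : MvPolynomial ι k[X])
    (ha : MvPolynomial.map (evalRingHom c) a = 0) : MvPolynomial.C (X - C c) ∣ a := by
  rw [MvPolynomial.C_dvd_iff_dvd_coeff]
  intro m
  rw [dvd_iff_isRoot]
  have := congrArg (MvPolynomial.coeff m) ha
  rwa [MvPolynomial.coeff_map, MvPolynomial.coeff_zero] at this

/-- If `q(a ^ i * y)` and `q(a ^ (i + 1) * y)` vanish, then `y` is a multiple root of
`∏ q(a ^ i * Y)`. -/
theorem X_sub_C_sq_dvd_prod {E : Type*} [Field E] {n : ℕ} (hn : 1 < n) {a y : E} (ha : a ^ n = 1)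
    {q : E[X]} {i : ℕ} (hi : i < n) (h0 : q.eval (a ^ i * y) = 0)
    (h1 : q.eval (a ^ (i + 1) * y) = 0) :
    (X - C y) ^ 2 ∣ ∏ i ∈ Finset.range n, q.comp (C (a ^ i) * X) := by
  classical
  have hdvd : ∀ i, q.eval (a ^ i * y) = 0 → X - C y ∣ q.comp (C (a ^ i) * X) := by
    intro i hi
    rw [dvd_iff_isRoot, IsRoot, eval_comp, eval_mul, eval_C, eval_X, hi]
  obtain ⟨j, hj, hij, hj0⟩ : ∃ j < n, j ≠ i ∧ q.eval (a ^ j * y) = 0 := by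
    by_cases h : i + 1 < n
    · exact ⟨i + 1, h, by omega, h1⟩
    · refine ⟨0, by omega, by omega, ?_⟩
      rwa [show i + 1 = n by omega, ha, ← pow_zero a] at h1
  rw [← Finset.mul_prod_erase _ _ (Finset.mem_range.2 hi),
    ← Finset.mul_prod_erase _ _ (Finset.mem_erase.2 ⟨hij, Finset.mem_range.2 hj⟩), ← mul_assoc, sq]
  exact Dvd.dvd.mul_right (mul_dvd_mul (hdvd i h0) (hdvd j hj0)) _

end TwistTranslation

section Core

open Polynomial

variable {k F K E ι : Type*} [Field k] [IsAlgClosed k] [Field F] [Field K] [Algebra F K]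

/-- `∏ Q(ζ ^ i * Y)` is not separable at an `ℓ`-th root of an element of `K` which is not
an `ℓ`-th power up to `F`, if `Q` is algebraic over `F`. -/
theorem eval_derivative_eq_zero_of_eq_twistProd [Field E] [Algebra K E]
    [Algebra F E] [IsScalarTower F K E] [IsAlgClosure K E]
    (hF : ∀ x : K, IsAlgebraic F x → ∃ f : F, algebraMap F K f = x) {ℓ : ℕ} (hℓ : ℓ.Prime)
    (hchar : (ℓ : E) ≠ 0) {ζ : F} (hζ : IsPrimitiveRoot ζ ℓ) {z : K} (hz : z ≠ 0)
    (hzF : ¬ ∃ (f : F) (u : K), z = algebraMap F K f * u ^ ℓ) {G : K[X]} (hG : G.eval z = 0)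
    (x : ι → K) {Q : MvPolynomial (Option ι) E}
    (hQ : ∀ d, IsAlgebraic F (Q.coeff d))
    (hGQ : expand _ ℓ (G.map (algebraMap K E)) =
      ((MvPolynomial.optionEquivLeft _ ι (twistProd ℓ (algebraMap F _ ζ) Q)).map
        (MvPolynomial.eval fun i => algebraMap K E (x i)))) :
    (derivative G).eval z = 0 := by
  have : IsAlgClosed E := IsAlgClosure.isAlgClosed K
  obtain ⟨y, hy⟩ := IsAlgClosed.exists_pow_nat_eq (algebraMap K E z) hℓ.pos
  obtain ⟨σ, hσy, hσ⟩ := exists_algEquiv_root_eq_mul hF hℓ hζ hz hzF hy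
  set q : E[X] := (MvPolynomial.optionEquivLeft E ι Q).map
    (MvPolynomial.eval fun i => algebraMap K E (x i)) with hq
  have hprod : expand _ ℓ (G.map (algebraMap K E)) =
      ∏ i ∈ Finset.range ℓ, q.comp (C (algebraMap F E ζ ^ i) * X) := by
    rw [hGQ, twistProd, map_prod, Polynomial.map_prod]
    refine Finset.prod_congr rfl fun i _ => ?_
    rw [optionEquivLeft_twist, map_comp]
    simp [hq]
  have hy0 : y ≠ 0 := by
    rintro rfl
    rw [zero_pow hℓ.ne_zero, eq_comm, map_eq_zero] at hy
    exact hz hy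
  have hqσ : q.map (σ : E →+* E) = q := by
    have hQσ : MvPolynomial.map (σ : E →+* E) Q = Q := by
      ext d
      rw [MvPolynomial.coeff_map]
      exact hσ _ (hQ d)
    conv_rhs => rw [hq, ← hQσ, optionEquivLeft_map, Polynomial.map_map]
    rw [hq, Polynomial.map_map]
    congr 1
    ext i
    · simp
    · simp
  have hroot : ∃ i < ℓ, q.eval (algebraMap F E ζ ^ i * y) = 0 := by
    have h1 := congrArg (eval y) hprod
    rw [expand_eval, hy, eval_map_algebraMap, aeval_algebraMap_apply, aeval_def, eval₂_eq_eval_map,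
      Algebra.algebraMap_self, Polynomial.map_id, hG, map_zero, eval_prod, eq_comm,
      Finset.prod_eq_zero_iff] at h1
    obtain ⟨i, hi, h⟩ := h1
    refine ⟨i, Finset.mem_range.1 hi, ?_⟩
    rwa [eval_comp, eval_mul, eval_C, eval_X] at h
  obtain ⟨i, hi, hi0⟩ := hroot
  have hi1 : q.eval (algebraMap F E ζ ^ (i + 1) * y) = 0 := by
    have h1 := congrArg (σ : E →+* E) hi0
    rw [← eval_map_apply, hqσ, map_zero, map_mul, map_pow] at h1
    have h2 : (σ : E →+* E) (algebraMap F E ζ) = algebraMap F E ζ := hσ _ (isAlgebraic_algebraMap _)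
    have h3 : (σ : E →+* E) y = algebraMap F E ζ * y := hσy
    rwa [h2, h3, ← mul_assoc, ← pow_succ] at h1
  have hζE : algebraMap F E ζ ^ ℓ = 1 := by rw [← map_pow, hζ.pow_eq_one, map_one]
  obtain ⟨r, hr⟩ := X_sub_C_sq_dvd_prod hℓ.one_lt hζE hi hi0 hi1
  rw [← hprod] at hr
  have h1 := congrArg (fun p => (derivative p).eval y) hr
  simp only [derivative_expand, derivative_mul, derivative_pow, eval_mul, eval_add, expand_eval, hy,
    eval_sub, eval_X, eval_C, eval_pow, sub_self, eval_natCast] at h1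
  rw [zero_pow two_ne_zero, zero_mul, zero_pow (by norm_num), mul_zero, zero_mul, zero_mul,
    add_zero] at h1
  have h2 := (mul_eq_zero.1 h1).resolve_right (mul_ne_zero hchar (pow_ne_zero _ hy0))
  rwa [derivative_map, eval_map_algebraMap, aeval_algebraMap_apply, map_eq_zero, aeval_def,
    eval₂_eq_eval_map, Algebra.algebraMap_self, Polynomial.map_id] at h2

theorem infinite_setOf_map_evalRingHom_ne_zero {a b : MvPolynomial ι k[X]} (ha : a ≠ 0)
    (hb : b ≠ 0) : {c : k | MvPolynomial.map (evalRingHom c) a ≠ 0 ∧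
      MvPolynomial.map (evalRingHom c) b ≠ 0}.Infinite := by
  have := ((finite_setOf_map_evalRingHom_eq_zero ha).union
    (finite_setOf_map_evalRingHom_eq_zero hb)).infinite_compl
  refine this.mono fun c hc => ?_
  simpa using hc

variable [Finite ι] [Algebra (MvPolynomial ι k[X]) K]

/-- If `t, x₁, …, xₙ` is a separating transcendence basis of `K`, then some `t - c` is not a proper
power. -/
theorem exists_X_sub_C_not_pow (L : Type*) [Field L]
    [Algebra (MvPolynomial ι k[X]) L] [IsFractionRing (MvPolynomial ι k[X]) L] [Algebra L K]
    [IsScalarTower (MvPolynomial ι k[X]) L K] [FiniteDimensional L K] [Algebra.IsSeparable L K]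
    {ℓ : ℕ} (hℓ : 1 < ℓ) :
    ∃ (c : k) (x : Kˣ), (x : K) = algebraMap (MvPolynomial ι k[X]) K (MvPolynomial.C (X - C c)) ∧
      ¬ ∃ u : Kˣ, u ^ ℓ = x := by
  have hinjL : Function.Injective (algebraMap (MvPolynomial ι k[X]) L) :=
    IsFractionRing.injective _ _
  have hinj : Function.Injective (algebraMap (MvPolynomial ι k[X]) K) := by
    rw [IsScalarTower.algebraMap_eq _ L K]
    exact (algebraMap L K).injective.comp hinjL
  have : Infinite L := Infinite.of_injective _ (hinjL.comp (MvPolynomial.C_injective ι k[X]))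
  obtain ⟨u, G, hu, hG, hG0, haG, ⟨U, V, d, hd, hUV⟩, _, _, _, hof, hroot⟩ :=
    exists_isFractionRing_adjoinRoot (A := MvPolynomial ι k[X]) (K := K) L one_ne_zero one_ne_zero
  obtain ⟨c, hdc, hGc⟩ := (infinite_setOf_map_evalRingHom_ne_zero hd hG0).nonempty
  have hx0 : algebraMap (MvPolynomial ι k[X]) K (MvPolynomial.C (X - C c)) ≠ 0 := by
    rw [map_ne_zero_iff _ hinj, map_ne_zero_iff _ (MvPolynomial.C_injective ι k[X])]
    exact X_sub_C_ne_zero c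
  refine ⟨c, Units.mk0 _ hx0, rfl, not_exists_pow_eq hℓ hG ?_
    (MvPolynomial.map_surjective _ fun a => ⟨C a, by simp⟩) (by simp)
      (C_X_sub_C_dvd c) hUV hdc hGc _ (hof _).symm⟩
  rintro rfl
  simp at haG

theorem exists_sym_ne_zero (L : Type*) [Field L]
    [Algebra (MvPolynomial ι k[X]) L] [IsFractionRing (MvPolynomial ι k[X]) L] [Algebra L K]
    [IsScalarTower (MvPolynomial ι k[X]) L K] [FiniteDimensional L K] [Algebra.IsSeparable L K]
    [Algebra k[X] K] [IsScalarTower k[X] (MvPolynomial ι k[X]) K] [Algebra k[X] F]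
    [IsScalarTower k[X] F K]
    (hF : ∀ x : K, IsAlgebraic F x → ∃ f : F, algebraMap F K f = x) {ℓ : ℕ} (hℓ : ℓ.Prime)
    (hchar : (ℓ : k) ≠ 0) (z : Kˣ)
    (hzF : ¬ ∃ (f : F) (u : K), (z : K) = algebraMap F K f * u ^ ℓ) :
    ∃ (c : k) (x : Kˣ), (x : K) = algebraMap (MvPolynomial ι k[X]) K (MvPolynomial.C (X - C c)) ∧
      MilnorK2.sym ℓ x z ≠ 0 := by
  have hinjL : Function.Injective (algebraMap (MvPolynomial ι k[X]) L) :=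
    IsFractionRing.injective _ _
  have hinj : Function.Injective (algebraMap (MvPolynomial ι k[X]) K) := by
    rw [IsScalarTower.algebraMap_eq _ L K]
    exact (algebraMap L K).injective.comp hinjL
  have : Infinite L := Infinite.of_injective _ (hinjL.comp (MvPolynomial.C_injective ι k[X]))
  have : NeZero (ℓ : k) := ⟨hchar⟩
  obtain ⟨ζ, hζ⟩ := HasEnoughRootsOfUnity.exists_primitiveRoot k ℓ
  obtain ⟨u, G, hu, hG, hG0, haG, ⟨U, V, d, hd, hUV⟩, _, _, _, hof, hroot⟩ :=
    exists_isFractionRing_adjoinRoot (A := MvPolynomial ι k[X]) L hℓ.ne_zero z.ne_zero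
  set w := (z : K) * u ^ ℓ with hwdef
  have hw0 : w ≠ 0 := mul_ne_zero z.ne_zero (pow_ne_zero _ hu)
  by_contra! hzero
  have hspec : ∀ c : k, MvPolynomial.map (evalRingHom c) d ≠ 0 →
      MvPolynomial.map (evalRingHom c) (G.coeff 0) ≠ 0 →
      IsTwistProd ℓ (MvPolynomial.C ζ) (G.map (MvPolynomial.map (evalRingHom c))) := by
    intro c hdc hGc
    have hx0 : algebraMap (MvPolynomial ι k[X]) K (MvPolynomial.C (X - C c)) ≠ 0 := by
      rw [map_ne_zero_iff _ hinj, map_ne_zero_iff _ (MvPolynomial.C_injective ι k[X])]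
      exact X_sub_C_ne_zero c
    refine isTwistProd_map_of_sym_eq_zero (τ := MvPolynomial.C (X - C c)) hℓ.pos hζ
      hG (MvPolynomial.map_surjective _ fun a => ⟨C a, by simp⟩) (by simp)
      (C_X_sub_C_dvd c) hUV hdc hGc (Units.mk0 _ hx0) (z * (Units.mk0 u hu) ^ ℓ) ?_ ?_ ?_
    · rw [hof, Units.val_mk0]
    · rw [hroot]
      simp [hwdef]
    · rw [MilnorK2.sym_mul_right, hzero c _ rfl, zero_add, MilnorK2.sym_powl_right]
  let E := AlgebraicClosure K
  let H := (MvPolynomial.optionEquivLeft k[X] ι).symm (expand _ ℓ G)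
  have hmapH : ∀ c, MvPolynomial.map (evalRingHom c) H = (MvPolynomial.optionEquivLeft k ι).symm
      (expand _ ℓ (G.map (MvPolynomial.map (evalRingHom c)))) := by
    intro c
    rw [AlgEquiv.eq_symm_apply, optionEquivLeft_map, AlgEquiv.apply_symm_apply, map_expand]
  have hinjX : Function.Injective (algebraMap k[X] E) := by
    rw [IsScalarTower.algebraMap_eq k[X] K E,
      IsScalarTower.algebraMap_eq k[X] (MvPolynomial ι k[X]) K]
    exact (algebraMap K E).injective.comp (hinj.comp (MvPolynomial.C_injective ι k[X]))
  have : FaithfulSMul k[X] E := (faithfulSMul_iff_algebraMap_injective _ _).2 hinjX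
  have hinjF : Function.Injective (algebraMap k[X] F) := by
    rw [IsScalarTower.algebraMap_eq k[X] F E, RingHom.coe_comp] at hinjX
    exact hinjX.of_comp
  let := FractionRing.liftAlgebra k[X] E
  obtain ⟨Q, hQ, hHQ⟩ := exists_eq_twistProd (L := FractionRing k[X]) (Ω := E) hℓ.ne_zero ζ H (by
    refine (infinite_setOf_map_evalRingHom_ne_zero hd hG0).mono fun c hc => ⟨?_, ?_⟩
    · rw [hmapH, EmbeddingLike.map_ne_zero_iff]
      exact ((hG.map _).expand hℓ.pos).ne_zero
    · rw [hmapH]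
      exact (hspec c hc.1 hc.2).exists_eq_twistProd)
  have hderiv := eval_derivative_eq_zero_of_eq_twistProd (E := E) (ζ := algebraMap k[X] F (C ζ))
    (G := G.map (algebraMap _ K)) (Q := Q) hF hℓ ?_ ?_ hw0 ?_ ?_
    (fun i => algebraMap (MvPolynomial ι k[X]) K (MvPolynomial.X i)) ?_ ?_
  · have h1 := congrArg (aeval w) hUV
    rw [map_add, map_mul, map_mul, haG, mul_zero, zero_add, aeval_C] at h1
    rw [derivative_map, eval_map_algebraMap] at hderiv
    rw [hderiv, mul_zero, eq_comm, map_eq_zero_iff _ hinj] at h1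
    exact hd h1
  · have h1 := (map_ne_zero_iff _ hinjX).2 (C_ne_zero.2 hchar)
    simpa using h1
  · exact (hζ.map_of_injective C_injective).map_of_injective hinjF
  · rintro ⟨f, v, hv⟩
    refine hzF ⟨f, v * u⁻¹, ?_⟩
    rw [mul_pow, ← mul_assoc, ← hv, hwdef, inv_pow, mul_inv_cancel_right₀ (pow_ne_zero _ hu)]
  · rwa [eval_map_algebraMap]
  · intro d
    have h1 := (IsFractionRing.isAlgebraic_iff k[X] (FractionRing k[X]) E).2 (hQ d)
    exact h1.extendScalars hinjF
  · have h1 := congrArg (MvPolynomial.optionEquivLeft E ι) hHQ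
    rw [optionEquivLeft_map, AlgEquiv.apply_symm_apply, map_expand] at h1
    rw [← IsScalarTower.algebraMap_apply, ← h1, Polynomial.map_map, map_expand, Polynomial.map_map]
    refine congrArg _ (congrArg (fun f => Polynomial.map f G) (MvPolynomial.ringHom_ext ?_ ?_))
    · intro p
      simp [IsScalarTower.algebraMap_apply k[X] K E,
        IsScalarTower.algebraMap_apply k[X] (MvPolynomial ι k[X]) K, MvPolynomial.algebraMap_eq]
    · simp

end Core

section Inseparable

open Polynomial

variable {k K ι : Type*} [Field k] [IsAlgClosed k] [Field K] [Finite ι]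
  [Algebra (MvPolynomial ι k[X]) K]

theorem exists_sym_ne_zero_of_isAlgebraic (L : Type*) [Field L] [Algebra (MvPolynomial ι k[X]) L]
    [IsFractionRing (MvPolynomial ι k[X]) L] [Algebra L K]
    [IsScalarTower (MvPolynomial ι k[X]) L K] [FiniteDimensional L K] [Algebra.IsSeparable L K]
    [Algebra k[X] K] [IsScalarTower k[X] (MvPolynomial ι k[X]) K] {ℓ : ℕ} (hℓ : ℓ.Prime)
    (hchar : (ℓ : k) ≠ 0) (z : Kˣ)
    (hz : ¬ ∃ f u : K, IsAlgebraic k[X] f ∧ (z : K) = f * u ^ ℓ) :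
    ∃ (c : k) (x : Kˣ), (x : K) = algebraMap (MvPolynomial ι k[X]) K (MvPolynomial.C (X - C c)) ∧
      MilnorK2.sym ℓ x z ≠ 0 := by
  have hinj : Function.Injective (algebraMap k[X] K) := by
    rw [IsScalarTower.algebraMap_eq k[X] (MvPolynomial ι k[X]) K,
      IsScalarTower.algebraMap_eq (MvPolynomial ι k[X]) L K]
    exact ((algebraMap L K).injective.comp (IsFractionRing.injective _ L)).comp
      (MvPolynomial.C_injective ι k[X])
  have : FaithfulSMul k[X] K := (faithfulSMul_iff_algebraMap_injective _ _).2 hinj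
  let := FractionRing.liftAlgebra k[X] K
  have : IsScalarTower k[X] (algebraicClosure (FractionRing k[X]) K) K :=
    inferInstanceAs (IsScalarTower k[X] (algebraicClosure (FractionRing k[X]) K).toSubalgebra K)
  refine exists_sym_ne_zero (F := algebraicClosure (FractionRing k[X]) K) L
    (fun x hx => ⟨⟨x, ?_⟩, rfl⟩) hℓ hchar z ?_
  · exact mem_algebraicClosure_iff.2 (hx.restrictScalars (FractionRing k[X]))
  · rintro ⟨f, u, hfu⟩
    exact hz ⟨f, u, (IsFractionRing.isAlgebraic_iff k[X] (FractionRing k[X]) K).2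
      (mem_algebraicClosure_iff.1 f.2), hfu⟩

/-- A power of the Frobenius endomorphism, of exponent prime to `ℓ`, maps `K` into the separable
closure of `L` in `K`. -/
theorem exists_ringHom_separableClosure (L K : Type*) [Field L] [Field K] [Algebra L K]
    [FiniteDimensional L K] {ℓ : ℕ} (hℓ : ℓ.Prime) (hchar : (ℓ : K) ≠ 0) :
    ∃ (q : ℕ) (φ : K →+* separableClosure L K), q.Coprime ℓ ∧
      (∀ a, (φ a : K) = a ^ q) ∧ ∀ a : separableClosure L K, φ a = a ^ q := by
  have : IsPurelyInseparable (separableClosure L K) K := separableClosure.isPurelyInseparable L K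
  obtain ⟨p, hp⟩ := ExpChar.exists K
  have : ExpChar (separableClosure L K) p :=
    (algebraMap (separableClosure L K) K).expChar
      (algebraMap (separableClosure L K) K).injective p
  let φ := IsPurelyInseparable.iterateFrobenius (separableClosure L K) K p le_rfl
  refine ⟨_, φ, ?_, fun a => IsPurelyInseparable.algebraMap_iterateFrobenius
    (separableClosure L K) p le_rfl a, fun a => ?_⟩
  · apply Nat.Coprime.pow_left
    cases hp with
    | zero => exact Nat.coprime_one_left ℓ
    | prime hp =>
      refine (Nat.coprime_primes hp hℓ).2 ?_
      rintro rfl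
      exact hchar (CharP.cast_eq_zero K p)
  · exact IsPurelyInseparable.iterateFrobenius_algebraMap K p le_rfl a

theorem exists_pow_eq_of_pow_eq_mul_pow {G : Type*} [CommGroup G] {q ℓ : ℕ} (h : q.Coprime ℓ)
    {z f u : G} (hz : z ^ q = f * u ^ ℓ) : ∃ (m : ℤ) (v : G), z = f ^ m * v ^ ℓ := by
  refine ⟨q.gcdA ℓ, u ^ q.gcdA ℓ * z ^ q.gcdB ℓ, ?_⟩
  have h1 : (1 : ℤ) = q * q.gcdA ℓ + ℓ * q.gcdB ℓ := by
    rw [← Nat.gcd_eq_gcd_ab, h.gcd_eq_one, Nat.cast_one]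
  calc z = z ^ (q * q.gcdA ℓ + ℓ * q.gcdB ℓ) := by rw [← h1, zpow_one]
    _ = (z ^ q) ^ q.gcdA ℓ * (z ^ q.gcdB ℓ) ^ ℓ := by
      rw [zpow_add, zpow_mul, zpow_natCast, mul_comm (ℓ : ℤ), zpow_mul, zpow_natCast]
    _ = _ := by
      rw [hz, mul_zpow, mul_pow, mul_assoc, ← zpow_natCast u, ← zpow_natCast (u ^ _), ← zpow_mul,
        ← zpow_mul, mul_comm (ℓ : ℤ)]

theorem exists_pow_eq_of_pow_eq_pow {G : Type*} [CommGroup G] {q ℓ : ℕ} (h : q.Coprime ℓ)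
    {x u : G} (hx : x ^ q = u ^ ℓ) : ∃ v, v ^ ℓ = x := by
  obtain ⟨m, v, hv⟩ := exists_pow_eq_of_pow_eq_mul_pow h (z := x) (f := 1) (u := u) (by simpa)
  exact ⟨v, by simpa using hv.symm⟩

theorem exists_X_sub_C_not_pow_of_finite (L : Type*) [Field L] [Algebra (MvPolynomial ι k[X]) L]
    [IsFractionRing (MvPolynomial ι k[X]) L] [Algebra L K]
    [IsScalarTower (MvPolynomial ι k[X]) L K] [FiniteDimensional L K] {ℓ : ℕ} (hℓ : ℓ.Prime)
    (hchar : (ℓ : K) ≠ 0) :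
    ∃ (c : k) (x : Kˣ), (x : K) = algebraMap (MvPolynomial ι k[X]) K (MvPolynomial.C (X - C c)) ∧
      ¬ ∃ u : Kˣ, u ^ ℓ = x := by
  obtain ⟨q, φ, hq, -, hφ⟩ := exists_ringHom_separableClosure L K hℓ hchar
  obtain ⟨c, x, hx, hxu⟩ := exists_X_sub_C_not_pow (K := separableClosure L K) L (k := k) (ι := ι)
    hℓ.one_lt
  refine ⟨c, Units.map (algebraMap (separableClosure L K) K).toMonoidHom x, ?_, ?_⟩
  · exact congrArg (algebraMap (separableClosure L K) K) hx
  · rintro ⟨u, hu⟩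
    refine hxu (exists_pow_eq_of_pow_eq_pow hq (u := Units.map φ.toMonoidHom u) (Units.ext ?_))
    rw [← map_pow, hu]
    exact (hφ x).symm

theorem exists_sym_ne_zero_of_finite (L : Type*) [Field L] [Algebra (MvPolynomial ι k[X]) L]
    [IsFractionRing (MvPolynomial ι k[X]) L] [Algebra L K]
    [IsScalarTower (MvPolynomial ι k[X]) L K] [FiniteDimensional L K]
    [Algebra k[X] K] [IsScalarTower k[X] (MvPolynomial ι k[X]) K] {ℓ : ℕ} (hℓ : ℓ.Prime)
    (hchar : (ℓ : k) ≠ 0) (z : Kˣ)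
    (hz : ¬ ∃ f u : K, IsAlgebraic k[X] f ∧ (z : K) = f * u ^ ℓ) :
    ∃ (c : k) (x : Kˣ), (x : K) = algebraMap (MvPolynomial ι k[X]) K (MvPolynomial.C (X - C c)) ∧
      MilnorK2.sym ℓ x z ≠ 0 := by
  have hcharK : (ℓ : K) ≠ 0 := by
    have h1 := ((algebraMap (MvPolynomial ι k[X]) K).comp
      (MvPolynomial.C.comp (C : k →+* k[X]))).injective.ne hchar
    simpa using h1
  obtain ⟨q, φ, hq, hφ1, hφ⟩ := exists_ringHom_separableClosure L K hℓ hcharK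
  let : Algebra k[X] (separableClosure L K) :=
    ((algebraMap (MvPolynomial ι k[X]) (separableClosure L K)).comp MvPolynomial.C).toAlgebra
  have : IsScalarTower k[X] (MvPolynomial ι k[X]) (separableClosure L K) :=
    .of_algebraMap_eq fun _ => rfl
  have : IsScalarTower k[X] (separableClosure L K) K := .of_algebraMap_eq fun p => by
    rw [IsScalarTower.algebraMap_apply k[X] (MvPolynomial ι k[X]) K]
    rfl
  obtain ⟨c, x, hx, hxz⟩ := exists_sym_ne_zero_of_isAlgebraic (ι := ι) (K := separableClosure L K) L
    hℓ hchar (Units.map φ.toMonoidHom z) (by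
      rintro ⟨f, u, hf, hfu⟩
      have hfu' : ((φ z : separableClosure L K) : K) = (f : K) * (u : K) ^ ℓ :=
        congrArg (algebraMap (separableClosure L K) K) hfu
      rw [hφ1] at hfu'
      have h0 : (f : K) * (u : K) ^ ℓ ≠ 0 := hfu' ▸ pow_ne_zero q z.ne_zero
      obtain ⟨m, v, hv⟩ := exists_pow_eq_of_pow_eq_mul_pow hq (z := z)
        (f := Units.mk0 (f : K) (left_ne_zero_of_mul h0))
        (u := Units.mk0 (u : K) (ne_zero_pow hℓ.ne_zero (right_ne_zero_of_mul h0)))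
        (Units.ext (by simpa using hfu'))
      refine hz ⟨(f : K) ^ m, v, ?_, by simpa using congrArg Units.val hv⟩
      have hfK : IsAlgebraic k[X] (f : K) := hf.algebraMap
      cases m with
      | ofNat m => simpa using hfK.pow m
      | negSucc m => simpa [zpow_negSucc] using (hfK.pow (m + 1)).inv)
  refine ⟨c, Units.map (algebraMap (separableClosure L K) K).toMonoidHom x, ?_, fun h => hxz ?_⟩
  · exact congrArg (algebraMap (separableClosure L K) K) hx
  · have h1 := congrArg (MilnorK2.map ℓ φ) h
    rw [map_zero, MilnorK2.map_sym] at h1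
    have h2 : Units.map φ.toMonoidHom
        (Units.map (algebraMap (separableClosure L K) K).toMonoidHom x) = x ^ q := Units.ext (hφ x)
    rw [h2, MilnorK2.sym_pow_left] at h1
    have h3 : (ℓ : ℤ) • MilnorK2.sym ℓ x (Units.map φ.toMonoidHom z) = 0 := by
      simpa using MilnorK2.smul_eq_zero' _
    have h4 : (q : ℤ) • MilnorK2.sym ℓ x (Units.map φ.toMonoidHom z) = 0 := by simpa using h1
    have h5 : (1 : ℤ) = q * q.gcdA ℓ + ℓ * q.gcdB ℓ := by
      rw [← Nat.gcd_eq_gcd_ab, hq.gcd_eq_one, Nat.cast_one]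
    rw [← one_zsmul (MilnorK2.sym ℓ x _), h5, add_zsmul, mul_comm, mul_comm (ℓ : ℤ), mul_zsmul,
      mul_zsmul, h3, h4, smul_zero, smul_zero, add_zero]

end Inseparable

section Setup

open Polynomial

variable {k K : Type*} [Field k] [Field K] [Algebra k K]

theorem IsFunctionField.exists_isTranscendenceBasis_option (hK : IsFunctionField k K) {t : K}
    (ht : Transcendental k t) : ∃ (ι : Set K) (y : Option ι → K), Finite ι ∧ y none = t ∧
      IsTranscendenceBasis k y := by
  obtain ⟨s, hs⟩ := hK
  have halg : Algebra.IsAlgebraic (Algebra.adjoin k (insert t (s : Set K))) K := by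
    refine ⟨fun x => ?_⟩
    have hx : x ∈ IntermediateField.adjoin k (insert t (s : Set K)) :=
      IntermediateField.adjoin.mono k _ _ (Set.subset_insert _ _) (hs ▸ IntermediateField.mem_top)
    obtain ⟨a, ha, b, hb, rfl⟩ := IntermediateField.mem_adjoin_iff_div.1 hx
    rw [div_eq_mul_inv]
    exact (isAlgebraic_algebraMap (⟨a, ha⟩ : Algebra.adjoin k (insert t (s : Set K)))).mul
      (isAlgebraic_algebraMap (⟨b, hb⟩ : Algebra.adjoin k (insert t (s : Set K)))).inv
  obtain ⟨u, htu, hus, hu⟩ := exists_isTranscendenceBasis_between (R := k) {t}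
    (insert t (s : Set K)) (by simp)
    ((algebraicIndependent_singleton_iff (⟨t, rfl⟩ : ({t} : Set K))).2 ht)
  have htu := htu rfl
  let y : Option ↥(u \ {t}) → K := fun o => o.elim t Subtype.val
  have hy : Function.Injective y := by
    rintro (_ | ⟨a, ha⟩) (_ | ⟨b, hb⟩) h
    · rfl
    · exact (hb.2 h.symm).elim
    · exact (ha.2 h).elim
    · exact congrArg some (Subtype.ext h)
  have hr : Set.range y = u := by
    ext a
    constructor
    · rintro ⟨_ | ⟨a, ha⟩, rfl⟩
      exacts [htu, ha.1]
    · intro ha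
      by_cases h : a = t
      · exact ⟨none, h.symm⟩
      · exact ⟨some ⟨a, ha, h⟩, rfl⟩
  refine ⟨u \ {t}, y, ?_, rfl, ?_⟩
  · exact ((s.finite_toSet.insert t).subset (Set.sdiff_subset.trans hus)).to_subtype
  · exact (isTranscendenceBasis_subtype_range hy).1 (by rw [hr]; exact hu)

theorem IsFunctionField.finiteDimensional (hK : IsFunctionField k K) (L : Type*) [Field L]
    [Algebra k L] [Algebra L K] [IsScalarTower k L K] [Algebra.IsAlgebraic L K] :
    FiniteDimensional L K := by
  obtain ⟨s, hs⟩ := hK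
  have h1 := IntermediateField.finiteDimensional_adjoin (K := L) (S := (s : Set K))
    fun x _ => Algebra.IsIntegral.isIntegral x
  have h2 : IntermediateField.adjoin L (s : Set K) = ⊤ := by
    rw [eq_top_iff]
    intro x _
    have hx : x ∈ IntermediateField.adjoin k (s : Set K) := hs ▸ IntermediateField.mem_top
    have hle : IntermediateField.adjoin k (s : Set K) ≤
        (IntermediateField.adjoin L (s : Set K)).restrictScalars k :=
      IntermediateField.adjoin_le_iff.2 (IntermediateField.subset_adjoin L _)
    exact hle hx
  rw [h2] at h1
  exact Module.Finite.equiv (IntermediateField.topEquiv (F := L) (E := K)).toLinearEquiv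

theorem IsFunctionField.exists_not_pow_and_sym_ne_zero [IsAlgClosed k] (hK : IsFunctionField k K)
    {ℓ : ℕ} (hℓ : ℓ.Prime) (hchar : (ℓ : k) ≠ 0) {t : K} (ht : Transcendental k t) :
    (∃ (c : k) (x : Kˣ), (x : K) = t - algebraMap k K c ∧ ¬ ∃ u : Kˣ, u ^ ℓ = x) ∧
    ∀ z : Kˣ, (¬ ∃ f u : K, IsAlgebraic (IntermediateField.adjoin k {t}) f ∧ (z : K) = f * u ^ ℓ) →
      ∃ (c : k) (x : Kˣ), (x : K) = t - algebraMap k K c ∧ MilnorK2.sym ℓ x z ≠ 0 := by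
  obtain ⟨ι, y, hι, rfl, hy⟩ := hK.exists_isTranscendenceBasis_option ht
  let e := MvPolynomial.optionEquivRight k ι
  let a := (MvPolynomial.aeval y).comp e.symm.toAlgHom
  have ha : Function.Injective a :=
    (algebraicIndependent_iff_injective_aeval.1 hy.1).comp e.symm.injective
  have haX : ∀ p : k[X], a (MvPolynomial.C p) = aeval (y none) p := by
    intro p
    suffices h : a.comp (IsScalarTower.toAlgHom k k[X] (MvPolynomial ι k[X])) = aeval (y none) from
      DFunLike.congr_fun h p
    ext
    have h1 : e.symm (MvPolynomial.C X) = MvPolynomial.X none := by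
      rw [AlgEquiv.symm_apply_eq, MvPolynomial.optionEquivRight_X_none]
    simp [a, MvPolynomial.algebraMap_eq, h1]
  let : Algebra (MvPolynomial ι k[X]) K := a.toRingHom.toAlgebra
  let : Algebra k[X] K := (aeval (y none)).toRingHom.toAlgebra
  have : IsScalarTower k[X] (MvPolynomial ι k[X]) K := .of_algebraMap_eq fun p => (haX p).symm
  have : FaithfulSMul (MvPolynomial ι k[X]) K := (faithfulSMul_iff_algebraMap_injective _ _).2 ha
  let L := FractionRing (MvPolynomial ι k[X])
  let := FractionRing.liftAlgebra (MvPolynomial ι k[X]) K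
  have : IsScalarTower k (MvPolynomial ι k[X]) K := .of_algebraMap_eq fun c => (a.commutes c).symm
  have : IsScalarTower k L K := IsScalarTower.to₁₃₄ _ (MvPolynomial ι k[X]) _ _
  have : Algebra.IsAlgebraic L K := by
    refine ⟨fun x => (IsFractionRing.isAlgebraic_iff (MvPolynomial ι k[X]) L K).1 ?_⟩
    have := hy.isAlgebraic
    refine (this.isAlgebraic x).of_ringHom_of_comp_eq
      ((hy.1.aevalEquiv : _ →+* Algebra.adjoin k (Set.range y)).comp e.symm.toRingHom)
      (RingHom.id K) (hy.1.aevalEquiv.surjective.comp e.symm.surjective) Function.injective_id ?_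
    ext x <;> rfl
  have := hK.finiteDimensional L
  have hcharK : (ℓ : K) ≠ 0 := by simpa using (algebraMap k K).injective.ne hchar
  have hval : ∀ c : k, algebraMap (MvPolynomial ι k[X]) K (MvPolynomial.C (X - C c)) =
      y none - algebraMap k K c := by
    intro c
    refine (haX _).trans ?_
    simp
  constructor
  · obtain ⟨c, x, hx, h⟩ := exists_X_sub_C_not_pow_of_finite (k := k) (ι := ι) L hℓ hcharK
    exact ⟨c, x, hx.trans (hval c), h⟩
  · intro z hz
    obtain ⟨c, x, hx, h⟩ := exists_sym_ne_zero_of_finite (k := k) (ι := ι) L hℓ hchar z (by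
      rintro ⟨f, u, hf, hfu⟩
      refine hz ⟨f, u, ?_, hfu⟩
      let t' : IntermediateField.adjoin k {y none} :=
        ⟨y none, IntermediateField.mem_adjoin_simple_self k _⟩
      let : Algebra k[X] (IntermediateField.adjoin k {y none}) := (aeval t').toRingHom.toAlgebra
      have : IsScalarTower k[X] (IntermediateField.adjoin k {y none}) K :=
        .of_algebraMap_eq fun p =>
          aeval_algHom_apply (IntermediateField.val (IntermediateField.adjoin k {y none})) t' p
      refine hf.extendScalars ?_
      have h1 : Function.Injective (algebraMap k[X] K) := transcendental_iff_injective.1 ht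
      rw [IsScalarTower.algebraMap_eq k[X] (IntermediateField.adjoin k {y none}) K,
        RingHom.coe_comp] at h1
      exact h1.of_comp)
    exact ⟨c, x, hx.trans (hval c), h⟩

theorem HasTrdeg.sym_eq_zero [IsAlgClosed k] (hK : HasTrdeg k K 1) {ℓ : ℕ} (hℓ : ℓ.Prime)
    (a b : Kˣ) : MilnorK2.sym ℓ a b = 0 := by
  obtain ⟨x, hx⟩ := hK
  have ht : Transcendental k (x 0) := algebraicIndependent_unique_type_iff.1 hx.1
  let : Algebra k[X] K := (aeval (x 0)).toRingHom.toAlgebra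
  have : FaithfulSMul k[X] K :=
    (faithfulSMul_iff_algebraMap_injective _ _).2 (transcendental_iff_injective.1 ht)
  let := FractionRing.liftAlgebra k[X] K
  have : Algebra.IsAlgebraic (FractionRing k[X]) K := by
    refine ⟨fun z => (IsFractionRing.isAlgebraic_iff k[X] (FractionRing k[X]) K).1 ?_⟩
    have := hx.isAlgebraic
    let x' : Algebra.adjoin k {x 0} := ⟨x 0, Algebra.self_mem_adjoin_singleton k _⟩
    have hr : Set.range x = {x 0} := by simp
    rw [hr] at this
    refine (this.isAlgebraic z).of_ringHom_of_comp_eq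
      (aeval x').toRingHom (RingHom.id K) ?_ Function.injective_id ?_
    · rintro ⟨w, hw⟩
      obtain ⟨p, rfl⟩ := (Algebra.adjoin_singleton_eq_range_aeval k (x 0) ▸ hw :)
      exact ⟨p, Subtype.ext (aeval_algHom_apply (Algebra.adjoin k {x 0}).val x' p).symm⟩
    · ext p
      · simp [RingHom.algebraMap_toAlgebra]
      · simp [RingHom.algebraMap_toAlgebra, x']
  exact sym_eq_zero_of_isAlgebraic (k := k) (K₀ := FractionRing k[X]) hℓ a b

end Setup

section Omega

variable {k K : Type*} [Field k] [Field K] [Algebra k K]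

theorem RelAlgClosed.mem_of_isAlgebraic_adjoin {F : IntermediateField k K} (hF : RelAlgClosed F)
    {t f : K} (ht : t ∈ F) (hf : IsAlgebraic (IntermediateField.adjoin k {t}) f) : f ∈ F := by
  let i := IntermediateField.inclusion (IntermediateField.adjoin_simple_le_iff.2 ht)
  let : Algebra (IntermediateField.adjoin k {t}) F := i.toRingHom.toAlgebra
  have : IsScalarTower (IntermediateField.adjoin k {t}) F K := .of_algebraMap_eq fun _ => rfl
  exact hF f (hf.extendScalars i.injective)

theorem K1proj_mem_Omega_iff {ℓ : ℕ} {F : IntermediateField k K} {a : Kˣ} :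
    K1proj ℓ K a ∈ Omega ℓ F ↔ ∃ f u : Kˣ, (f : K) ∈ F ∧ a = f * u ^ ℓ := by
  constructor
  · rintro ⟨f, hf, hfa⟩
    obtain ⟨u, hu⟩ := QuotientGroup.eq.1 hfa
    exact ⟨f, u, hf, eq_mul_of_inv_mul_eq hu.symm⟩
  · rintro ⟨f, u, hf, rfl⟩
    exact ⟨f, hf, QuotientGroup.eq.2 ⟨u, by simp⟩⟩

theorem dimMge.mono {ℓ d : ℕ} {S T : Set (K1 ℓ K)} (hST : S ⊆ T) (h : dimMge ℓ S d) :
    dimMge ℓ T d :=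
  h.imp fun _ ha => ⟨fun i => hST (ha.1 i), ha.2⟩

theorem not_dimMge_two_Omega [IsAlgClosed k] {ℓ : ℕ} (hℓ : ℓ.Prime) {F : IntermediateField k K}
    (h1 : HasTrdeg k F 1) : ¬ dimMge ℓ (Omega ℓ F : Set (K1 ℓ K)) 2 := by
  rintro ⟨a, ha, h0⟩
  have hlift : ∀ f : Kˣ, (f : K) ∈ F → ∃ g : Fˣ, Units.map (algebraMap F K).toMonoidHom g = f :=
    fun f hf => ⟨Units.mk0 ⟨f, hf⟩ fun h => f.ne_zero (congrArg Subtype.val h), Units.ext rfl⟩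
  obtain ⟨f, u, hf, hfu⟩ := K1proj_mem_Omega_iff.1 (ha 0)
  obtain ⟨g, v, hg, hgv⟩ := K1proj_mem_Omega_iff.1 (ha 1)
  obtain ⟨f, rfl⟩ := hlift f hf
  obtain ⟨g, rfl⟩ := hlift g hg
  have h2 : a = ![a 0, a 1] := by
    ext i
    fin_cases i <;> rfl
  refine h0 ?_
  rw [h2]
  change MilnorK2.sym ℓ (a 0) (a 1) = 0
  rw [hfu, hgv, MilnorK2.sym_mul_left, MilnorK2.sym_mul_right, MilnorK2.sym_powl_left,
    MilnorK2.sym_powl_right, ← MilnorK2.map_sym, h1.sym_eq_zero hℓ, map_zero, add_zero, add_zero]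

end Omega

theorem statement_10 (ℓ : ℕ) (hℓ : ℓ.Prime) (k K : Type*) [Field k] [Field K] [Algebra k K]
    [IsAlgClosed k] (hchar : ringChar k ≠ ℓ) (hK : IsFunctionField k K)
    (htr : TrdegGe k K 2)
    (F : IntermediateField k K) (hF : RelAlgClosed F) (h1 : HasTrdeg k F 1) :
    Omega ℓ F ∈ M1Set ℓ K ∧
      dimMeq ℓ ((Omega ℓ F : Subgroup (K1 ℓ K)) : Set (K1 ℓ K)) 1 ∧
      ∀ z : K1 ℓ K, z ∉ Omega ℓ F →
        dimMge ℓ (((Omega ℓ F ⊔ Subgroup.closure {z}) : Subgroup (K1 ℓ K)) : Set (K1 ℓ K)) 2 := by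
  have hcast : (ℓ : k) ≠ 0 := by
    intro h
    have h2 := (Nat.dvd_prime hℓ).1 ((ringChar.spec k ℓ).1 h)
    exact h2.elim CharP.ringChar_ne_one hchar
  obtain ⟨x, hx⟩ := h1
  have ht : Transcendental k (x 0 : K) :=
    (transcendental_algebraMap_iff (algebraMap F K).injective).2
      (algebraicIndependent_unique_type_iff.1 hx.1)
  obtain ⟨⟨c, y, hy, hyu⟩, hsym⟩ := hK.exists_not_pow_and_sym_ne_zero hℓ hcast ht
  have hmem : ∀ (c : k) (y : Kˣ), (y : K) = x 0 - algebraMap k K c →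
      K1proj ℓ K y ∈ Omega ℓ F := fun c y hy =>
    ⟨y, (hy ▸ sub_mem (x 0).2 (F.algebraMap_mem c) : (y : K) ∈ F), rfl⟩
  have hone : dimMeq ℓ ((Omega ℓ F : Subgroup (K1 ℓ K)) : Set (K1 ℓ K)) 1 := by
    refine ⟨⟨![y], fun i => ?_, milnorSymbol_one_ne_zero hyu⟩,
      not_dimMge_two_Omega hℓ ⟨x, hx⟩⟩
    rw [Subsingleton.elim i 0]
    exact hmem c y hy
  have htwo : ∀ z : K1 ℓ K, z ∉ Omega ℓ F →
      dimMge ℓ (((Omega ℓ F ⊔ Subgroup.closure {z}) : Subgroup (K1 ℓ K)) : Set (K1 ℓ K)) 2 := by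
    intro z hz
    obtain ⟨z, rfl⟩ := QuotientGroup.mk'_surjective _ z
    obtain ⟨c, y, hy, hyz⟩ := hsym z (by
      rintro ⟨f, u, hf, hfu⟩
      have h0 : f * u ^ ℓ ≠ 0 := hfu ▸ z.ne_zero
      exact hz (K1proj_mem_Omega_iff.2 ⟨Units.mk0 f (left_ne_zero_of_mul h0),
        Units.mk0 u (ne_zero_pow hℓ.ne_zero (right_ne_zero_of_mul h0)),
        hF.mem_of_isAlgebraic_adjoin (x 0).2 hf, Units.ext hfu⟩))
    refine ⟨![y, z], fun i => ?_, hyz⟩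
    fin_cases i
    · exact (le_sup_left : Omega ℓ F ≤ _) (hmem c y hy)
    · exact (le_sup_right : _ ≤ Omega ℓ F ⊔ _) (Subgroup.subset_closure rfl)
  refine ⟨⟨hone, fun B hB hle => le_antisymm (fun z hzB => ?_) hle⟩, hone, htwo⟩
  by_contra hz
  refine hB.2 ((htwo z hz).mono (SetLike.coe_subset_coe.2 (sup_le hle ?_)))
  simpa using hzB

end
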